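/- arXiv:2107.00787 — 2 statements merged into one kernel-verified Lean document; each statement's English description precedes it below -/
import Mathlib

section
/- Let a > 1 be an integer and b a nonnegative integer such that a + b is even, a + b ≥ 4, and a + 3b ≡ 0 (mod 4). Then the limit as n → ∞ of N*(a,b; 8n+a+3b) / Ñ(a,b; 8n+a+3b) exists and equals 2 / (2^{a+b−2} + (−1)^b · 2^{(a+b−2)/2} · cos(π(a+3b)/4)). -/
/-- `N a b n` is the number of tuples `(x₁,…,x_a,y₁,…,y_b) ∈ ℤ^{a+b}` with
`n = x₁² + ⋯ + x_a² + 3y₁² + ⋯ + 3y_b²`. -/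
noncomputable def N (a b : ℕ) (n : ℤ) : ℕ :=
  Set.ncard {p : (Fin a → ℤ) × (Fin b → ℤ) |
    n = ∑ i, (p.1 i) ^ 2 + 3 * ∑ j, (p.2 j) ^ 2}

/-- `Nstar a b n` is the number of such tuples with all coordinates odd. -/
noncomputable def Nstar (a b : ℕ) (n : ℤ) : ℕ :=
  Set.ncard {p : (Fin a → ℤ) × (Fin b → ℤ) |
    (∀ i, Odd (p.1 i)) ∧ (∀ j, Odd (p.2 j)) ∧
    n = ∑ i, (p.1 i) ^ 2 + 3 * ∑ j, (p.2 j) ^ 2}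

/-- `Ntilde a b n = N a b n - N a b (n/4)`, where the second term is `0` when `4 ∤ n`. -/
noncomputable def Ntilde (a b : ℕ) (n : ℤ) : ℤ :=
  (N a b n : ℤ) - (if (4 : ℤ) ∣ n then (N a b (n / 4) : ℤ) else 0)

/-- The power `q^k`, where `q = exp (π i τ / 4)`. -/
noncomputable def nome (τ : ℂ) (k : ℤ) : ℂ := Complex.exp (Real.pi * Complex.I * k * τ / 4)

/-- The indicator function of the odd integers. -/
noncomputable def oddWt (n : ℤ) : ℂ := if Odd n then 1 else 0

/-- The indicator function of the even integers. -/
noncomputable def evenWt (n : ℤ) : ℂ := if Even n then 1 else 0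

/-- The function supported on the even integers with value `(-1)^k` at `2 * k`. -/
noncomputable def altWt (n : ℤ) : ℂ := if Even n then (if Even (n / 2) then 1 else -1) else 0

/-- The weighted theta series `∑ w(n) q^(n²)`, where `q = exp (π i τ / 4)`. -/
noncomputable def thetaSeries (w : ℤ → ℂ) (τ : ℂ) : ℂ := ∑' n : ℤ, w n * nome τ (n ^ 2)

lemma nome_add (τ : ℂ) (k l : ℤ) : nome τ (k + l) = nome τ k * nome τ l := by
  simp only [nome, ← Complex.exp_add]
  congr 1
  push_cast
  ring

lemma nome_zero (τ : ℂ) : nome τ 0 = 1 := by simp [nome]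

lemma nome_mul (τ : ℂ) (m k : ℤ) : nome (m * τ) k = nome τ (m * k) := by
  simp only [nome]
  congr 1
  push_cast
  ring

lemma norm_nome (τ : ℂ) (k : ℤ) : ‖nome τ k‖ = Real.exp (-(Real.pi * k * τ.im / 4)) := by
  rw [nome, Complex.norm_exp]
  congr 1
  simp [Complex.mul_re, Complex.mul_im]
  ring

lemma norm_oddWt_le (n : ℤ) : ‖oddWt n‖ ≤ 1 := by unfold oddWt; split_ifs <;> simp

lemma norm_evenWt_le (n : ℤ) : ‖evenWt n‖ ≤ 1 := by unfold evenWt; split_ifs <;> simp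

lemma norm_altWt_le (n : ℤ) : ‖altWt n‖ ≤ 1 := by unfold altWt; split_ifs <;> simp

lemma oddWt_of_odd {n : ℤ} (h : Odd n) : oddWt n = 1 := if_pos h

lemma oddWt_of_even {n : ℤ} (h : Even n) : oddWt n = 0 := if_neg (Int.not_odd_iff_even.2 h)

lemma evenWt_of_even {n : ℤ} (h : Even n) : evenWt n = 1 := if_pos h

lemma evenWt_of_odd {n : ℤ} (h : Odd n) : evenWt n = 0 := if_neg (Int.not_even_iff_odd.2 h)

lemma altWt_of_odd {n : ℤ} (h : Odd n) : altWt n = 0 := if_neg (Int.not_even_iff_odd.2 h)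

lemma evenWt_two_mul (k : ℤ) : evenWt (2 * k) = 1 := by simp [evenWt]

lemma altWt_two_mul (k : ℤ) : altWt (2 * k) = (-1) ^ k := by
  simp only [altWt, even_two_mul, if_true]
  rw [Int.mul_ediv_cancel_left _ two_ne_zero]
  split_ifs with h
  · rw [h.neg_one_zpow]
  · rw [(Int.not_even_iff_odd.1 h).neg_one_zpow]

lemma summable_norm_nome_sq {τ : ℂ} (hτ : 0 < τ.im) :
    Summable fun n : ℤ => ‖nome τ (n ^ 2)‖ := by
  have h : 0 < (τ / 4).im := by
    rw [show τ / 4 = ((1 / 4 : ℝ) : ℂ) * τ by push_cast; ring, Complex.im_ofReal_mul]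
    linarith
  refine ((summable_jacobiTheta₂_term_iff 0 (τ / 4)).2 h).norm.congr fun n => ?_
  simp only [jacobiTheta₂_term, nome]
  congr 2
  push_cast
  ring

lemma summable_norm_weighted {τ : ℂ} (hτ : 0 < τ.im) {w : ℤ → ℂ} (hw : ∀ n, ‖w n‖ ≤ 1) :
    Summable fun n : ℤ => ‖w n * nome τ (n ^ 2)‖ := by
  refine (summable_norm_nome_sq hτ).of_nonneg_of_le (fun _ => norm_nonneg _) fun n => ?_
  rw [norm_mul]
  exact mul_le_of_le_one_left (norm_nonneg _) (hw n)

lemma im_intCast_mul (m : ℤ) (τ : ℂ) : ((m : ℂ) * τ).im = m * τ.im := by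
  rw [Complex.mul_im]; simp

lemma summable_norm_pair {τ : ℂ} (hτ : 0 < τ.im) {m : ℤ} (hm : 0 < m) {w w' : ℤ → ℂ}
    (hw : ∀ n, ‖w n‖ ≤ 1) (hw' : ∀ n, ‖w' n‖ ≤ 1) :
    Summable fun p : ℤ × ℤ => ‖w p.1 * w' p.2 * nome τ (p.1 ^ 2 + m * p.2 ^ 2)‖ := by
  have hmτ : 0 < ((m : ℂ) * τ).im := by
    rw [im_intCast_mul]
    exact mul_pos (by exact_mod_cast hm) hτ
  refine ((summable_norm_weighted hτ hw).mul_norm (summable_norm_weighted hmτ hw')).congr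
    fun p => ?_
  rw [nome_mul, nome_add]
  congr 1
  ring

lemma thetaSeries_mul_thetaSeries {τ : ℂ} (hτ : 0 < τ.im) {m : ℤ} (hm : 0 < m) {w w' : ℤ → ℂ}
    (hw : ∀ n, ‖w n‖ ≤ 1) (hw' : ∀ n, ‖w' n‖ ≤ 1) :
    thetaSeries w τ * thetaSeries w' (m * τ) =
      ∑' p : ℤ × ℤ, w p.1 * w' p.2 * nome τ (p.1 ^ 2 + m * p.2 ^ 2) := by
  have hmτ : 0 < ((m : ℂ) * τ).im := by
    rw [im_intCast_mul]
    exact mul_pos (by exact_mod_cast hm) hτ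
  rw [thetaSeries, thetaSeries, tsum_mul_tsum_of_summable_norm
    (summable_norm_weighted hτ hw) (summable_norm_weighted hmτ hw')]
  refine tsum_congr fun p => ?_
  rw [nome_mul, nome_add]
  ring

/-- Legendre's modular equation of degree three. -/
lemma theta_modular_equation {τ : ℂ} (hτ : 0 < τ.im) :
    thetaSeries evenWt τ * thetaSeries evenWt (3 * τ) =
      thetaSeries oddWt τ * thetaSeries oddWt (3 * τ) +
        thetaSeries altWt τ * thetaSeries altWt (3 * τ) := by
  have h3 : (3 : ℂ) = ((3 : ℤ) : ℂ) := by norm_num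
  have hm : (0 : ℤ) < 3 := by norm_num
  have se := (summable_norm_pair hτ hm norm_evenWt_le norm_evenWt_le).of_norm
  have so := (summable_norm_pair hτ hm norm_oddWt_le norm_oddWt_le).of_norm
  have sa := (summable_norm_pair hτ hm norm_altWt_le norm_altWt_le).of_norm
  rw [h3, thetaSeries_mul_thetaSeries hτ hm norm_evenWt_le norm_evenWt_le,
    thetaSeries_mul_thetaSeries hτ hm norm_oddWt_le norm_oddWt_le,
    thetaSeries_mul_thetaSeries hτ hm norm_altWt_le norm_altWt_le, ← so.tsum_add sa,
    ← sub_eq_zero, ← se.tsum_sub (so.add sa)]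
  set K : ℤ × ℤ → ℂ := fun p =>
    evenWt p.1 * evenWt p.2 - (oddWt p.1 * oddWt p.2 + altWt p.1 * altWt p.2) with hK
  set f : ℤ × ℤ → ℂ := fun p => K p * nome τ (p.1 ^ 2 + 3 * p.2 ^ 2) with hf
  have hfs : Summable f := (se.sub (so.add sa)).congr fun p => by simp only [hf, hK]; ring
  have hgoal : ∑' p, f p = 0 := by
    set g : ℤ × ℤ → ℤ × ℤ := fun p => (2 * p.1 + p.2, p.2) with hg
    have ginj : Function.Injective g := by
      rintro ⟨a, b⟩ ⟨c, d⟩ h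
      simp only [hg, Prod.mk.injEq] at h ⊢
      omega
    have gsupp : Function.support f ⊆ Set.range g := by
      rintro ⟨x, y⟩ h
      by_contra hn
      apply h
      have : ¬ (Even x ↔ Even y) := by
        intro hxy
        apply hn
        refine ⟨((x - y) / 2, y), ?_⟩
        have : Even (x - y) := Int.even_sub.2 hxy
        simp only [hg, Prod.mk.injEq, and_true]
        obtain ⟨r, hr⟩ := this
        omega
      rcases Int.even_or_odd x with hx | hx <;> rcases Int.even_or_odd y with hy | hy
      · exact absurd (iff_of_true hx hy) this
      · simp [hf, hK, evenWt_of_odd hy, oddWt_of_even hx, altWt_of_odd hy]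
      · simp [hf, hK, evenWt_of_odd hx, oddWt_of_even hy, altWt_of_odd hx]
      · exact absurd (iff_of_false (Int.not_even_iff_odd.2 hx) (Int.not_even_iff_odd.2 hy)) this
    rw [← ginj.tsum_eq gsupp]
    have hfg : ∀ p : ℤ × ℤ, f (g p) = (if Even p.2 then (if Even p.1 then 0 else 2) else -1) *
        nome τ (4 * (p.1 ^ 2 + p.1 * p.2 + p.2 ^ 2)) := by
      rintro ⟨s, t⟩
      simp only [hf, hg]
      congr 2
      · by_cases ht : Even t
        · obtain ⟨r, rfl⟩ := ht
          rw [← two_mul, show 2 * s + 2 * r = 2 * (s + r) by ring]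
          simp only [hK, evenWt_two_mul, altWt_two_mul]
          have hr : ((-1 : ℂ) ^ r) * (-1) ^ r = 1 := by
            rw [← mul_zpow]; simp
          rw [zpow_add₀ (by norm_num), mul_assoc, hr]
          rcases Int.even_or_odd s with hs | hs
          · simp [oddWt_of_even, hs, hs.neg_one_zpow]
          · simp [oddWt_of_even, Int.not_even_iff_odd.2 hs, hs.neg_one_zpow]; norm_num
        · have ht' := Int.not_even_iff_odd.1 ht
          have : Odd (2 * s + t) := (even_two_mul s).add_odd ht'
          simp [hK, evenWt_of_odd ht', oddWt_of_odd ht', altWt_of_odd ht', oddWt_of_odd this, ht]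
      · ring
    let e : ℤ × ℤ ≃ ℤ × ℤ :=
      { toFun := fun p => (-p.1 - p.2, p.1)
        invFun := fun p => (p.2, -p.1 - p.2)
        left_inv := by rintro ⟨a, b⟩; simp
        right_inv := by rintro ⟨a, b⟩; simp; ring }
    set F : ℤ × ℤ → ℂ := fun p => f (g p) with hF
    have hFs : Summable F := hfs.comp_injective ginj
    have hsum : ∀ p, F p + (F (e p) + F (e (e p))) = 0 := by
      rintro ⟨s, t⟩
      simp only [hF, hfg, e, Equiv.coe_fn_mk]
      have h1 : (-s - t) ^ 2 + (-s - t) * s + s ^ 2 = s ^ 2 + s * t + t ^ 2 := by ring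
      have h2 : (-(-s - t) - s) ^ 2 + (-(-s - t) - s) * (-s - t) + (-s - t) ^ 2 =
        s ^ 2 + s * t + t ^ 2 := by ring
      rw [h1, h2, ← add_mul, ← add_mul]
      apply mul_eq_zero_of_left
      by_cases hs : Even s <;> by_cases ht : Even t <;> simp [hs, ht, Int.even_sub] <;> norm_num
    have hFe : Summable fun p => F (e p) := hFs.comp_injective e.injective
    have hFee : Summable fun p => F (e (e p)) := hFe.comp_injective e.injective
    have key : ∑' p, F p + (∑' p, F (e p) + ∑' p, F (e (e p))) = 0 := by
      rw [← hFe.tsum_add hFee, ← hFs.tsum_add (hFe.add hFee)]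
      simp [hsum]
    rw [e.tsum_eq F, e.tsum_eq (fun p => F (e p)), e.tsum_eq F] at key
    change ∑' p, F p = 0
    linear_combination key / 3
  rw [← hgoal]
  refine tsum_congr fun p => ?_
  simp only [hf, hK]
  ring

lemma thetaSeries_pair_doubling {τ : ℂ} (hτ : 0 < τ.im) {w : ℤ → ℂ} (hw : ∀ n, ‖w n‖ ≤ 1)
    (hpar : ∀ x y, w x * w y ≠ 0 → (Even x ↔ Even y)) :
    thetaSeries w τ ^ 2 =
      ∑' p : ℤ × ℤ, w (p.1 + p.2) * w (p.1 - p.2) * nome (2 * τ) (p.1 ^ 2 + p.2 ^ 2) := by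
  have h := thetaSeries_mul_thetaSeries hτ one_pos hw hw
  simp only [Int.cast_one, one_mul] at h
  rw [sq, h]
  set f : ℤ × ℤ → ℂ := fun p => w p.1 * w p.2 * nome τ (p.1 ^ 2 + p.2 ^ 2) with hf
  set g : ℤ × ℤ → ℤ × ℤ := fun p => (p.1 + p.2, p.1 - p.2) with hg
  have ginj : Function.Injective g := by
    rintro ⟨a, b⟩ ⟨c, d⟩ h
    simp only [hg, Prod.mk.injEq] at h ⊢
    omega
  have gsupp : Function.support f ⊆ Set.range g := by
    rintro ⟨x, y⟩ h
    have hxy := hpar x y (left_ne_zero_of_mul h)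
    have : Even (x - y) := Int.even_sub.2 hxy
    obtain ⟨r, hr⟩ := this
    refine ⟨(r + y, r), ?_⟩
    simp only [hg, Prod.mk.injEq]
    omega
  rw [← ginj.tsum_eq gsupp]
  refine tsum_congr fun p => ?_
  simp only [hf, hg]
  have h2 : (2 : ℂ) = ((2 : ℤ) : ℂ) := by norm_num
  rw [h2, nome_mul]
  congr 2
  ring

lemma even_iff_even_of_evenWt (x y : ℤ) (h : evenWt x * evenWt y ≠ 0) : Even x ↔ Even y := by
  rcases Int.even_or_odd x with hx | hx <;> rcases Int.even_or_odd y with hy | hy <;>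
    simp_all [evenWt_of_odd]

lemma even_iff_even_of_oddWt (x y : ℤ) (h : oddWt x * oddWt y ≠ 0) : Even x ↔ Even y := by
  rcases Int.even_or_odd x with hx | hx <;> rcases Int.even_or_odd y with hy | hy <;>
    simp_all [oddWt_of_even, Int.not_even_iff_odd.2]

lemma even_iff_even_of_altWt (x y : ℤ) (h : altWt x * altWt y ≠ 0) : Even x ↔ Even y := by
  rcases Int.even_or_odd x with hx | hx <;> rcases Int.even_or_odd y with hy | hy <;>
    simp_all [altWt_of_odd]

lemma thetaSeries_mul_self {τ : ℂ} (hτ : 0 < τ.im) {w w' : ℤ → ℂ}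
    (hw : ∀ n, ‖w n‖ ≤ 1) (hw' : ∀ n, ‖w' n‖ ≤ 1) :
    HasSum (fun p : ℤ × ℤ => w p.1 * w' p.2 * nome τ (p.1 ^ 2 + p.2 ^ 2))
      (thetaSeries w τ * thetaSeries w' τ) := by
  have h := thetaSeries_mul_thetaSeries hτ one_pos hw hw'
  have hs := (summable_norm_pair hτ one_pos hw hw').of_norm
  simp only [Int.cast_one, one_mul] at h hs
  rw [h]
  exact hs.hasSum

/-- Jacobi's identity between the fourth powers of the three theta constants. -/
lemma theta_jacobi_identity {τ : ℂ} (hτ : 0 < τ.im) :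
    thetaSeries evenWt τ ^ 4 = thetaSeries oddWt τ ^ 4 + thetaSeries altWt τ ^ 4 := by
  have h2τ : 0 < (2 * τ).im := by
    have := im_intCast_mul 2 τ
    push_cast at this
    rw [this]
    linarith
  have hee := thetaSeries_mul_self h2τ norm_evenWt_le norm_evenWt_le
  have hoo := thetaSeries_mul_self h2τ norm_oddWt_le norm_oddWt_le
  have heo := thetaSeries_mul_self h2τ norm_evenWt_le norm_oddWt_le
  have hoe := thetaSeries_mul_self h2τ norm_oddWt_le norm_evenWt_le
  have he : thetaSeries evenWt τ ^ 2 =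
      thetaSeries evenWt (2 * τ) ^ 2 + thetaSeries oddWt (2 * τ) ^ 2 := by
    rw [thetaSeries_pair_doubling hτ norm_evenWt_le even_iff_even_of_evenWt, sq, sq,
      ← (hee.add hoo).tsum_eq]
    refine tsum_congr fun ⟨s, t⟩ => ?_
    rw [← add_mul]
    congr 1
    by_cases hs : Even s <;> by_cases ht : Even t <;>
      simp [evenWt, oddWt, hs, ht, Int.even_add, Int.even_sub, ← Int.not_even_iff_odd]
  have ho : thetaSeries oddWt τ ^ 2 =
      2 * (thetaSeries evenWt (2 * τ) * thetaSeries oddWt (2 * τ)) := by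
    rw [thetaSeries_pair_doubling hτ norm_oddWt_le even_iff_even_of_oddWt,
      show ∀ x y : ℂ, 2 * (x * y) = x * y + y * x by intros; ring, ← (heo.add hoe).tsum_eq]
    refine tsum_congr fun ⟨s, t⟩ => ?_
    rw [← add_mul]
    congr 1
    by_cases hs : Even s <;> by_cases ht : Even t <;>
      simp [evenWt, oddWt, hs, ht, Int.even_add, Int.even_sub, ← Int.not_even_iff_odd]
  have ha : thetaSeries altWt τ ^ 2 =
      thetaSeries evenWt (2 * τ) ^ 2 - thetaSeries oddWt (2 * τ) ^ 2 := by
    rw [thetaSeries_pair_doubling hτ norm_altWt_le even_iff_even_of_altWt, sq, sq,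
      ← (hee.sub hoo).tsum_eq]
    refine tsum_congr fun ⟨s, t⟩ => ?_
    rw [← sub_mul]
    congr 1
    by_cases hst : Even (s + t)
    · obtain ⟨r, hr⟩ := hst
      obtain rfl : t = 2 * r - s := by omega
      rw [show s + (2 * r - s) = 2 * r by ring, show s - (2 * r - s) = 2 * (s - r) by ring,
        altWt_two_mul, altWt_two_mul, ← zpow_add₀ (by norm_num), add_sub_cancel]
      rcases Int.even_or_odd s with hs | hs
      · simp [evenWt, oddWt, hs, hs.neg_one_zpow, Int.even_sub, ← Int.not_even_iff_odd]
      · simp [evenWt, oddWt, hs, hs.neg_one_zpow, Int.even_sub,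
          Int.not_even_iff_odd.2 hs, ← Int.not_even_iff_odd]
    · have : ¬ (Even s ↔ Even t) := by rwa [← Int.even_add]
      by_cases hs : Even s <;> by_cases ht : Even t <;>
        simp_all [evenWt, oddWt, altWt, Int.even_add, ← Int.not_even_iff_odd]
  calc thetaSeries evenWt τ ^ 4 = (thetaSeries evenWt τ ^ 2) ^ 2 := by ring
    _ = (thetaSeries oddWt τ ^ 2) ^ 2 + (thetaSeries altWt τ ^ 2) ^ 2 := by
      rw [he, ho, ha]; ring
    _ = _ := by ring

lemma thetaSeries_eq_tsum_even {w : ℤ → ℂ} (hw : ∀ n, Odd n → w n = 0) (τ : ℂ) :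
    thetaSeries w τ = ∑' k : ℤ, w (2 * k) * nome τ ((2 * k) ^ 2) := by
  have hinj : Function.Injective fun k : ℤ => 2 * k := mul_right_injective₀ two_ne_zero
  rw [thetaSeries, ← hinj.tsum_eq]
  intro n hn
  by_contra h
  refine hn ?_
  have : Odd n := by
    rw [← Int.not_even_iff_odd]
    rintro ⟨r, rfl⟩
    exact h ⟨r, two_mul r⟩
  simp [hw n this]

lemma thetaSeries_eq_tsum_odd {w : ℤ → ℂ} (hw : ∀ n, Even n → w n = 0) (τ : ℂ) :
    thetaSeries w τ = ∑' k : ℤ, w (2 * k + 1) * nome τ ((2 * k + 1) ^ 2) := by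
  have hinj : Function.Injective fun k : ℤ => 2 * k + 1 := fun a b h => by
    simp only at h; omega
  rw [thetaSeries, ← hinj.tsum_eq]
  intro n hn
  by_contra h
  refine hn ?_
  have : Even n := by
    rw [← Int.not_odd_iff_even]
    rintro ⟨r, rfl⟩
    exact h ⟨r, rfl⟩
  simp [hw n this]

lemma exp_pi_mul_I_int (k : ℤ) : Complex.exp (Real.pi * Complex.I * k) = (-1) ^ k := by
  rw [← Complex.exp_pi_mul_I, ← Complex.exp_int_mul]
  congr 1
  ring

lemma thetaSeries_evenWt_eq (τ : ℂ) : thetaSeries evenWt τ = jacobiTheta₂ 0 τ := by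
  rw [thetaSeries_eq_tsum_even (fun n h => evenWt_of_odd h), jacobiTheta₂]
  refine tsum_congr fun k => ?_
  rw [evenWt_two_mul, one_mul, nome, jacobiTheta₂_term]
  congr 1
  push_cast
  ring

lemma thetaSeries_altWt_eq (τ : ℂ) : thetaSeries altWt τ = jacobiTheta₂ (1 / 2) τ := by
  rw [thetaSeries_eq_tsum_even (fun n h => altWt_of_odd h), jacobiTheta₂]
  refine tsum_congr fun k => ?_
  rw [altWt_two_mul, nome, jacobiTheta₂_term, Complex.exp_add, ← exp_pi_mul_I_int]
  congr 2
  · ring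
  · push_cast
    ring

lemma thetaSeries_oddWt_eq (τ : ℂ) : thetaSeries oddWt τ =
    Complex.exp (Real.pi * Complex.I * τ / 4) * jacobiTheta₂ (τ / 2) τ := by
  rw [thetaSeries_eq_tsum_odd (fun n h => oddWt_of_even h), jacobiTheta₂, ← tsum_mul_left]
  refine tsum_congr fun k => ?_
  rw [oddWt_of_odd (odd_two_mul_add_one k), nome, jacobiTheta₂_term, one_mul, ← Complex.exp_add]
  congr 1
  push_cast
  ring

lemma nome_add_one (τ : ℂ) (k : ℤ) :
    nome (τ + 1) k = nome τ k * Complex.exp (Real.pi * Complex.I * k / 4) := by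
  rw [nome, nome, ← Complex.exp_add]
  congr 1
  ring

lemma nome_add_one_even (τ : ℂ) (k : ℤ) :
    nome (τ + 1) ((2 * k) ^ 2) = nome τ ((2 * k) ^ 2) * (-1) ^ k := by
  rw [nome_add_one, show (Real.pi * Complex.I * ((2 * k) ^ 2 : ℤ) / 4 : ℂ) =
    Real.pi * Complex.I * (k ^ 2 : ℤ) by push_cast; ring, exp_pi_mul_I_int]
  rcases Int.even_or_odd k with h | h
  · rw [h.neg_one_zpow, (h.pow_of_ne_zero two_ne_zero).neg_one_zpow]
  · rw [h.neg_one_zpow, h.pow.neg_one_zpow]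

lemma thetaSeries_evenWt_add_one (τ : ℂ) :
    thetaSeries evenWt (τ + 1) = thetaSeries altWt τ := by
  rw [thetaSeries_eq_tsum_even (fun n h => evenWt_of_odd h),
    thetaSeries_eq_tsum_even (fun n h => altWt_of_odd h)]
  refine tsum_congr fun k => ?_
  rw [nome_add_one_even, evenWt_two_mul, altWt_two_mul]
  ring

lemma thetaSeries_altWt_add_one (τ : ℂ) :
    thetaSeries altWt (τ + 1) = thetaSeries evenWt τ := by
  rw [thetaSeries_eq_tsum_even (fun n h => evenWt_of_odd h),
    thetaSeries_eq_tsum_even (fun n h => altWt_of_odd h)]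
  refine tsum_congr fun k => ?_
  rw [nome_add_one_even, evenWt_two_mul, altWt_two_mul, mul_comm (nome _ _), ← mul_assoc,
    ← mul_zpow]
  simp

lemma norm_thetaSeries_oddWt_add_one (τ : ℂ) :
    ‖thetaSeries oddWt (τ + 1)‖ = ‖thetaSeries oddWt τ‖ := by
  have h : thetaSeries oddWt (τ + 1) =
      thetaSeries oddWt τ * Complex.exp (Real.pi * Complex.I / 4) := by
    rw [thetaSeries_eq_tsum_odd (fun n h => oddWt_of_even h),
      thetaSeries_eq_tsum_odd (fun n h => oddWt_of_even h), ← tsum_mul_right]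
    refine tsum_congr fun k => ?_
    rw [nome_add_one]
    have : Complex.exp (Real.pi * Complex.I * ((2 * k + 1) ^ 2 : ℤ) / 4) =
        Complex.exp (Real.pi * Complex.I / 4) := by
      rw [show (Real.pi * Complex.I * ((2 * k + 1) ^ 2 : ℤ) / 4 : ℂ) =
        Real.pi * Complex.I / 4 + Real.pi * Complex.I * (k * (k + 1) : ℤ) by push_cast; ring,
        Complex.exp_add, exp_pi_mul_I_int, (Int.even_mul_succ_self k).neg_one_zpow, mul_one]
    rw [this]
    ring
  rw [h, norm_mul, show (Real.pi * Complex.I / 4 : ℂ) = ((Real.pi / 4 : ℝ) : ℂ) * Complex.I by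
    push_cast; ring, Complex.norm_exp_ofReal_mul_I, mul_one]

lemma norm_neg_I_mul_cpow_half {τ : ℂ} (hτ : τ ≠ 0) :
    ‖(-Complex.I * τ) ^ (1 / 2 : ℂ)‖ = ‖τ‖ ^ (1 / 2 : ℝ) := by
  have := Complex.norm_cpow_of_ne_zero (z := -Complex.I * τ) (by simpa using hτ) (1 / 2)
  rw [this]
  simp

lemma norm_thetaSeries_evenWt_neg_inv {τ : ℂ} (hτ : τ ≠ 0) :
    ‖thetaSeries evenWt (-1 / τ)‖ = ‖τ‖ ^ (1 / 2 : ℝ) * ‖thetaSeries evenWt τ‖ := by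
  have h := jacobiTheta₂_functional_equation 0 τ
  rw [← thetaSeries_evenWt_eq] at h
  simp only [zero_div, ← thetaSeries_evenWt_eq] at h
  have hpos : 0 < ‖τ‖ ^ (1 / 2 : ℝ) := Real.rpow_pos_of_pos (norm_pos_iff.2 hτ) _
  rw [h, norm_mul, norm_mul, norm_div, norm_neg_I_mul_cpow_half hτ]
  simp
  field_simp

lemma norm_thetaSeries_oddWt_neg_inv {τ : ℂ} (hτ : τ ≠ 0) :
    ‖thetaSeries oddWt (-1 / τ)‖ = ‖τ‖ ^ (1 / 2 : ℝ) * ‖thetaSeries altWt τ‖ := by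
  have h := jacobiTheta₂_functional_equation (1 / 2) τ
  have hpos : 0 < ‖τ‖ ^ (1 / 2 : ℝ) := Real.rpow_pos_of_pos (norm_pos_iff.2 hτ) _
  rw [thetaSeries_oddWt_eq, thetaSeries_altWt_eq, h, norm_mul, norm_mul, norm_mul, norm_div,
    norm_neg_I_mul_cpow_half hτ, ← jacobiTheta₂_neg_left (-1 / τ / 2)]
  rw [show -(-1 / τ / 2) = 1 / 2 / τ by ring,
    show (Real.pi * Complex.I * (-1 / τ) / 4 : ℂ) = -Real.pi * Complex.I * (1 / 2) ^ 2 / τ by ring]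
  rw [norm_one]
  field_simp

lemma norm_thetaSeries_altWt_neg_inv {τ : ℂ} (hτ : τ ≠ 0) :
    ‖thetaSeries altWt (-1 / τ)‖ = ‖τ‖ ^ (1 / 2 : ℝ) * ‖thetaSeries oddWt τ‖ := by
  have h := norm_thetaSeries_oddWt_neg_inv (τ := -1 / τ) (by simpa using hτ)
  rw [show -1 / (-1 / τ) = τ by field_simp] at h
  have hpos : 0 < ‖τ‖ := norm_pos_iff.2 hτ
  rw [h, norm_div, norm_neg, norm_one, ← mul_assoc, ← Real.mul_rpow hpos.le (by positivity),
    mul_one_div_cancel hpos.ne', Real.one_rpow, one_mul]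

section Modular

open UpperHalfPlane ModularGroup MatrixGroups

/-- The absolute value of a weighted theta series, normalised to be of weight zero. -/
noncomputable def thetaHeight (w : ℤ → ℂ) (τ : ℍ) : ℝ :=
  τ.im ^ (1 / 4 : ℝ) * ‖thetaSeries w τ‖

/-- The normalised theta constant that decays at the cusps `-d/c` with `c`, `d` of the given
parities. -/
noncomputable def cuspHeight (c d : ℤ) (τ : ℍ) : ℝ :=
  if Even c then (if Even d then 0 else thetaHeight oddWt τ)
  else (if Even d then thetaHeight altWt τ else thetaHeight evenWt τ)

lemma coe_T_smul (τ : ℍ) : ((T • τ : ℍ) : ℂ) = τ + 1 := by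
  rw [modular_T_smul, coe_vadd]
  push_cast
  ring

lemma coe_S_smul (τ : ℍ) : ((S • τ : ℍ) : ℂ) = -1 / τ := by
  rw [modular_S_smul]
  simp [inv_neg, neg_div]

lemma thetaHeight_S_smul {w w' : ℤ → ℂ} {τ : ℍ}
    (h : ‖thetaSeries w (-1 / τ)‖ = ‖(τ : ℂ)‖ ^ (1 / 2 : ℝ) * ‖thetaSeries w' τ‖) :
    thetaHeight w (S • τ) = thetaHeight w' τ := by
  have hpos : 0 < ‖(τ : ℂ)‖ := norm_pos_iff.2 τ.ne_zero
  have him : (S • τ).im = τ.im / ‖(τ : ℂ)‖ ^ 2 := by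
    rw [← coe_im, coe_S_smul, neg_div, Complex.neg_im, one_div, Complex.inv_im,
      Complex.normSq_eq_norm_sq, coe_im]
    ring
  rw [thetaHeight, thetaHeight, coe_S_smul, h, him, Real.div_rpow τ.im_pos.le (by positivity),
    ← Real.rpow_natCast, ← Real.rpow_mul hpos.le]
  have : 0 < ‖(τ : ℂ)‖ ^ (1 / 2 : ℝ) := Real.rpow_pos_of_pos hpos _
  norm_num
  norm_num at this
  field_simp

lemma cuspHeight_S_smul (c d : ℤ) (τ : ℍ) : cuspHeight c d (S • τ) = cuspHeight d (-c) τ := by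
  have h0 := τ.ne_zero
  rw [cuspHeight, cuspHeight, thetaHeight_S_smul (norm_thetaSeries_oddWt_neg_inv h0),
    thetaHeight_S_smul (norm_thetaSeries_altWt_neg_inv h0),
    thetaHeight_S_smul (norm_thetaSeries_evenWt_neg_inv h0)]
  by_cases hc : Even c <;> by_cases hd : Even d <;> simp [hc, hd]

lemma cuspHeight_T_smul (c d : ℤ) (τ : ℍ) : cuspHeight c d (T • τ) = cuspHeight c (c + d) τ := by
  have him : (T • τ).im = τ.im := by rw [← coe_im, coe_T_smul]; simp
  simp only [cuspHeight, thetaHeight, him, coe_T_smul, thetaSeries_evenWt_add_one,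
    thetaSeries_altWt_add_one, norm_thetaSeries_oddWt_add_one, Int.even_add]
  by_cases hc : Even c <;> by_cases hd : Even d <;> simp [hc, hd]

lemma cuspHeight_smul (γ : SL(2, ℤ)) (c d : ℤ) (τ : ℍ) :
    cuspHeight c d (γ • τ) =
      cuspHeight (c * γ 0 0 + d * γ 1 0) (c * γ 0 1 + d * γ 1 1) τ := by
  have hγ : γ ∈ Subgroup.closure {S, T} := by
    rw [SpecialLinearGroup.SL2Z_generators]; trivial
  induction hγ using Subgroup.closure_induction generalizing c d τ with
  | mem x hx =>
    rcases hx with rfl | rfl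
    · rw [cuspHeight_S_smul]; simp [S]
    · rw [cuspHeight_T_smul]; simp [T]
  | one => simp
  | mul x y _ _ hx hy =>
    rw [mul_smul, hx, hy]
    simp only [Matrix.SpecialLinearGroup.coe_mul, Matrix.mul_apply, Fin.sum_univ_two]
    congr 1 <;> ring
  | inv x _ hx =>
    have h := hx (c * x⁻¹ 0 0 + d * x⁻¹ 1 0) (c * x⁻¹ 0 1 + d * x⁻¹ 1 1) (x⁻¹ • τ)
    rw [smul_inv_smul] at h
    rw [h]
    have hdet := x.det_coe
    rw [Matrix.det_fin_two] at hdet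
    simp only [Matrix.SpecialLinearGroup.SL2_inv_expl]
    simp
    congr 1
    · linear_combination (-c) * hdet
    · linear_combination (-d) * hdet

lemma exists_norm_thetaSeries_le {t : ℝ} (ht : 0 < t) : ∃ C : ℝ, 0 < C ∧
    (∀ w : ℤ → ℂ, (∀ n, ‖w n‖ ≤ 1) → ∀ τ : ℂ, t ≤ τ.im → ‖thetaSeries w τ‖ ≤ C) ∧
    ∀ τ : ℂ, t ≤ τ.im → ‖thetaSeries oddWt τ‖ ≤ C * Real.exp (-(Real.pi * τ.im / 4)) := by
  have hI : 0 < (t * Complex.I).im := by simpa using ht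
  have hs := summable_norm_nome_sq hI
  set A := ∑' n : ℤ, ‖nome (t * Complex.I) (n ^ 2)‖ with hA
  have hterm : ∀ n : ℤ, ‖nome (t * Complex.I) (n ^ 2)‖ = Real.exp (-(Real.pi * n ^ 2 * t / 4)) := by
    intro n
    rw [norm_nome]
    simp
  have hA0 : 0 < A := hs.tsum_pos (fun _ => norm_nonneg _) 0 (by rw [hterm]; positivity)
  have hpi := Real.pi_pos
  have hbase : 1 ≤ Real.exp (Real.pi * t / 4) := Real.one_le_exp (by positivity)
  refine ⟨A * Real.exp (Real.pi * t / 4), by positivity, ?_, ?_⟩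
  · intro w hw τ hτ
    refine le_trans ?_ (le_mul_of_one_le_right hA0.le hbase)
    refine tsum_of_norm_bounded hs.hasSum fun n => ?_
    rw [norm_mul]
    refine (mul_le_of_le_one_left (norm_nonneg _) (hw n)).trans ?_
    rw [hterm, norm_nome, Real.exp_le_exp]
    push_cast
    gcongr
  · intro τ hτ
    have hsum := (hs.hasSum.mul_right (Real.exp (Real.pi * t / 4))).mul_right
      (Real.exp (-(Real.pi * τ.im / 4)))
    refine tsum_of_norm_bounded hsum fun n => ?_
    rcases Int.even_or_odd n with h | h
    · rw [oddWt_of_even h]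
      simp only [zero_mul, norm_zero]
      positivity
    · rw [oddWt_of_odd h, one_mul, hterm, norm_nome, ← Real.exp_add, ← Real.exp_add,
        Real.exp_le_exp]
      have hn : (1 : ℝ) ≤ n ^ 2 := by
        have : (1 : ℤ) ≤ n ^ 2 := by
          have : n ≠ 0 := by rintro rfl; simp at h
          have := sq_pos_of_ne_zero this
          omega
        exact_mod_cast this
      push_cast
      nlinarith [mul_nonneg hpi.le (mul_nonneg (sub_nonneg.2 hn) (sub_nonneg.2 hτ))]

lemma exists_cuspHeight_le {t : ℝ} (ht : 0 < t) : ∃ C : ℝ, 0 < C ∧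
    ∀ (τ : ℍ) (γ : SL(2, ℤ)), t ≤ (γ • τ).im →
      (∀ c d, cuspHeight c d τ ≤ C * (γ • τ).im ^ (1 / 4 : ℝ)) ∧
      cuspHeight (γ 1 0) (γ 1 1) τ ≤
        C * (γ • τ).im ^ (1 / 4 : ℝ) * Real.exp (-(Real.pi * (γ • τ).im / 4)) := by
  obtain ⟨C, hC, h1, h2⟩ := exists_norm_thetaSeries_le ht
  refine ⟨C, hC, fun τ γ hγ => ?_⟩
  have hp : 0 ≤ (γ • τ).im ^ (1 / 4 : ℝ) := Real.rpow_nonneg (γ • τ).im_pos.le _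
  constructor
  · intro c d
    have h := cuspHeight_smul γ⁻¹ c d (γ • τ)
    rw [inv_smul_smul] at h
    rw [h, cuspHeight]
    split_ifs
    · positivity
    · rw [thetaHeight, mul_comm]; gcongr; exact h1 _ norm_oddWt_le _ hγ
    · rw [thetaHeight, mul_comm]; gcongr; exact h1 _ norm_altWt_le _ hγ
    · rw [thetaHeight, mul_comm]; gcongr; exact h1 _ norm_evenWt_le _ hγ
  · have h := cuspHeight_smul γ 0 1 τ
    simp only [zero_mul, one_mul, zero_add] at h
    rw [← h, cuspHeight, if_pos (by simp), if_neg (by simp), thetaHeight]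
    calc _ ≤ (γ • τ).im ^ (1 / 4 : ℝ) * (C * Real.exp (-(Real.pi * (γ • τ).im / 4))) := by
          gcongr; exact h2 _ hγ
      _ = _ := by ring

/-- Multiplication by three on the upper half plane. -/
noncomputable def triple (τ : ℍ) : ℍ := ⟨3 * τ, by
  have := im_intCast_mul 3 τ
  push_cast at this
  rw [this]
  linarith [τ.im_pos, τ.coe_im]⟩

lemma coe_triple (τ : ℍ) : (triple τ : ℂ) = 3 * τ := rfl

lemma im_triple (τ : ℍ) : (triple τ).im = 3 * τ.im := by
  have := im_intCast_mul 3 τ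
  push_cast at this
  rw [← coe_im, coe_triple, this, coe_im]

lemma exists_row_smul_triple (γ : SL(2, ℤ)) (τ : ℍ) : ∃ γ' : SL(2, ℤ),
    (Even (γ' 1 0) ↔ Even (γ 1 0)) ∧ (Even (γ' 1 1) ↔ Even (γ 1 1)) ∧
    ((γ' • triple τ).im = 3 * (γ • τ).im ∨ (γ' • triple τ).im = (γ • τ).im / 3) := by
  have hcop := bottom_row_coprime γ
  by_cases h3 : (3 : ℤ) ∣ γ 1 0
  · obtain ⟨c, hc⟩ := h3
    rw [hc] at hcop
    obtain ⟨γ', -, hγ'⟩ := bottom_row_surj (R := ℤ) (a := ![c, γ 1 1])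
      (by simpa using hcop.of_mul_left_right)
    have h0 : γ' 1 0 = c := by simpa using congrFun hγ' 0
    have h1 : γ' 1 1 = γ 1 1 := by simpa using congrFun hγ' 1
    refine ⟨γ', ?_, by rw [h1], Or.inl ?_⟩
    · rw [h0, hc, Int.even_mul]; simp [show ¬ Even (3 : ℤ) by decide]
    · rw [ModularGroup.im_smul_eq_div_normSq, ModularGroup.im_smul_eq_div_normSq, denom_apply, denom_apply, h0, h1, hc,
        coe_triple, im_triple, mul_div_assoc]
      congr 4
      push_cast
      ring
  · have hcop' : IsCoprime (γ 1 0) (3 * γ 1 1) := by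
      refine IsCoprime.mul_right ?_ hcop
      exact ((Int.prime_three.coprime_iff_not_dvd).2 h3).symm
    obtain ⟨γ', -, hγ'⟩ := bottom_row_surj (R := ℤ) (a := ![γ 1 0, 3 * γ 1 1])
      (by simpa using hcop')
    have h0 : γ' 1 0 = γ 1 0 := by simpa using congrFun hγ' 0
    have h1 : γ' 1 1 = 3 * γ 1 1 := by simpa using congrFun hγ' 1
    refine ⟨γ', by rw [h0], ?_, Or.inr ?_⟩
    · rw [h1, Int.even_mul]; simp [show ¬ Even (3 : ℤ) by decide]
    · rw [ModularGroup.im_smul_eq_div_normSq, ModularGroup.im_smul_eq_div_normSq, denom_apply, denom_apply, h0, h1,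
        coe_triple, im_triple]
      rw [show ((γ 1 0 : ℤ) : ℂ) * (3 * τ) + ((3 * γ 1 1 : ℤ) : ℂ) =
        (3 : ℝ) * ((γ 1 0 : ℤ) * (τ : ℂ) + (γ 1 1 : ℤ)) by push_cast; ring, map_mul,
        Complex.normSq_ofReal]
      rw [mul_assoc (3 : ℝ) 3, mul_div_mul_left _ _ (by norm_num), div_div, mul_comm (3 : ℝ)]

/-- A uniform bound for the normalised theta constants at `τ` and `3τ`, exhibiting one of the three
characteristics at which both of them are small. -/
lemma exists_theta_cusp_bound : ∃ C : ℝ, 1 ≤ C ∧ ∀ τ : ℍ, ∃ Y : ℝ, 1 / 2 ≤ Y ∧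
    (∀ w ∈ ({oddWt, evenWt, altWt} : Set (ℤ → ℂ)),
      τ.im ^ (1 / 4 : ℝ) * ‖thetaSeries w τ‖ ≤ C * Y ∧
      τ.im ^ (1 / 4 : ℝ) * ‖thetaSeries w (3 * τ)‖ ≤ C * Y) ∧
    ∃ w ∈ ({oddWt, evenWt, altWt} : Set (ℤ → ℂ)),
      τ.im ^ (1 / 4 : ℝ) * ‖thetaSeries w τ‖ ≤ C * Y * Real.exp (-(Real.pi * Y / 12)) ∧
      τ.im ^ (1 / 4 : ℝ) * ‖thetaSeries w (3 * τ)‖ ≤ C * Y * Real.exp (-(Real.pi * Y / 12)) := by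
  obtain ⟨C, hC, hb⟩ := exists_cuspHeight_le (t := 1 / 6) (by norm_num)
  have hpi := Real.pi_pos
  have hrpow : ∀ x : ℝ, 0 < x → x ^ (1 / 4 : ℝ) ≤ 1 + x := fun x hx => by
    rcases le_total x 1 with h | h
    · linarith [Real.rpow_le_one hx.le h (by norm_num : (0 : ℝ) ≤ 1 / 4)]
    · have := Real.rpow_le_rpow_of_exponent_le h (by norm_num : (1 / 4 : ℝ) ≤ 1)
      rw [Real.rpow_one] at this
      linarith
  refine ⟨5 * C + 1, by linarith, fun τ => ?_⟩
  obtain ⟨γ, hγ⟩ := exists_smul_mem_fd τ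
  have h34 := three_le_four_mul_im_sq_of_mem_fd hγ
  set Y := (γ • τ).im with hY
  have hYpos : 0 < Y := (γ • τ).im_pos
  have hY2 : 1 / 2 ≤ Y := by nlinarith
  obtain ⟨γ', hc, hd, him⟩ := exists_row_smul_triple γ τ
  rw [← hY] at him
  have him1 : (γ' • triple τ).im ≤ 3 * Y := by rcases him with h | h <;> linarith
  have him2 : Y / 3 ≤ (γ' • triple τ).im := by rcases him with h | h <;> linarith
  obtain ⟨b1, b2⟩ := hb τ γ (by linarith)
  obtain ⟨b3, b4⟩ := hb (triple τ) γ' (by linarith)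
  have hsame : cuspHeight (γ' 1 0) (γ' 1 1) (triple τ) =
      cuspHeight (γ 1 0) (γ 1 1) (triple τ) := by simp only [cuspHeight, hc, hd]
  rw [hsame] at b4
  have hle3 : ∀ w, τ.im ^ (1 / 4 : ℝ) * ‖thetaSeries w (3 * τ)‖ ≤ thetaHeight w (triple τ) := by
    intro w
    rw [thetaHeight, coe_triple, im_triple]
    gcongr
    linarith [τ.im_pos]
  have u1 : ∀ c d, cuspHeight c d τ ≤ (5 * C + 1) * Y := fun c d => by
    refine (b1 c d).trans ?_
    nlinarith [hrpow Y hYpos]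
  have u3 : ∀ c d, cuspHeight c d (triple τ) ≤ (5 * C + 1) * Y := fun c d => by
    refine (b3 c d).trans ?_
    nlinarith [hrpow _ (γ' • triple τ).im_pos]
  have v1 : cuspHeight (γ 1 0) (γ 1 1) τ ≤ (5 * C + 1) * Y * Real.exp (-(Real.pi * Y / 12)) := by
    refine b2.trans ?_
    have : C * Y ^ (1 / 4 : ℝ) ≤ (5 * C + 1) * Y := by nlinarith [hrpow Y hYpos]
    gcongr
    norm_num
  have v3 : cuspHeight (γ 1 0) (γ 1 1) (triple τ) ≤
      (5 * C + 1) * Y * Real.exp (-(Real.pi * Y / 12)) := by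
    refine b4.trans ?_
    have : C * (γ' • triple τ).im ^ (1 / 4 : ℝ) ≤ (5 * C + 1) * Y := by
      nlinarith [hrpow _ (γ' • triple τ).im_pos]
    gcongr ?_ * Real.exp (-?_)
    nlinarith
  have e01 : ∀ σ, cuspHeight 0 1 σ = thetaHeight oddWt σ := fun σ => by simp [cuspHeight]
  have e10 : ∀ σ, cuspHeight 1 0 σ = thetaHeight altWt σ := fun σ => by simp [cuspHeight]
  have e11 : ∀ σ, cuspHeight 1 1 σ = thetaHeight evenWt σ := fun σ => by simp [cuspHeight]
  refine ⟨Y, hY2, ?_, ?_⟩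
  · rintro w (rfl | rfl | rfl)
    · exact ⟨(e01 τ).ge.trans (u1 0 1), (hle3 _).trans ((e01 _).ge.trans (u3 0 1))⟩
    · exact ⟨(e11 τ).ge.trans (u1 1 1), (hle3 _).trans ((e11 _).ge.trans (u3 1 1))⟩
    · exact ⟨(e10 τ).ge.trans (u1 1 0), (hle3 _).trans ((e10 _).ge.trans (u3 1 0))⟩
  · by_cases h0 : Even (γ 1 0) <;> by_cases h1 : Even (γ 1 1)
    · exfalso
      obtain ⟨x, y, hxy⟩ := bottom_row_coprime γ
      have : Even (1 : ℤ) := hxy ▸ (h0.mul_left x).add (h1.mul_left y)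
      simp at this
    · simp only [cuspHeight, h0, h1, if_true, if_false] at v1 v3
      exact ⟨oddWt, by simp, v1, (hle3 _).trans v3⟩
    · simp only [cuspHeight, h0, h1, if_true, if_false] at v1 v3
      exact ⟨altWt, by simp, v1, (hle3 _).trans v3⟩
    · simp only [cuspHeight, h0, h1, if_false] at v1 v3
      exact ⟨evenWt, by simp, v1, (hle3 _).trans v3⟩


end Modular

/-- A family of complex numbers is tame relative to `B` if it is bounded by a constant times a
power of `B`. -/
def Tame {ι : Type*} (B : ι → ℝ) (g : ι → ℂ) : Prop :=
  ∃ K : ℝ, ∃ p : ℕ, ∀ i, ‖g i‖ ≤ K * B i ^ p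

/-- A family is negligible relative to `B` and `δ` if it is bounded by `δ` times a constant times
a power of `B`. -/
def Negl {ι : Type*} (B δ : ι → ℝ) (g : ι → ℂ) : Prop :=
  ∃ K : ℝ, ∃ p : ℕ, ∀ i, ‖g i‖ ≤ δ i * (K * B i ^ p)

section Tame

variable {ι : Type*} {B δ : ι → ℝ}

lemma Tame.mul {f g : ι → ℂ} (hf : Tame B f) (hg : Tame B g) :
    Tame B (fun i => f i * g i) := by
  obtain ⟨K, p, h⟩ := hf
  obtain ⟨K', p', h'⟩ := hg
  refine ⟨K * K', p + p', fun i => ?_⟩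
  rw [norm_mul, pow_add, mul_mul_mul_comm]
  have := (norm_nonneg _).trans (h i)
  exact mul_le_mul (h i) (h' i) (norm_nonneg _) this

lemma tame_const (c : ℂ) : Tame B (fun _ => c) := ⟨‖c‖, 0, fun i => by simp⟩

lemma Tame.pow {f : ι → ℂ} (hf : Tame B f) (n : ℕ) :
    Tame B (fun i => f i ^ n) := by
  induction n with
  | zero => simpa using tame_const 1
  | succ n ih => simpa only [pow_succ] using ih.mul hf

lemma add_pow_le_sum {K K' b : ℝ} (hb : 1 ≤ b) (p p' : ℕ) :
    K * b ^ p + K' * b ^ p' ≤ (|K| + |K'|) * b ^ (p + p') := by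
  have h0 : 0 ≤ b := by linarith
  have h1 : b ^ p ≤ b ^ (p + p') := pow_le_pow_right₀ hb (by omega)
  have h2 : b ^ p' ≤ b ^ (p + p') := pow_le_pow_right₀ hb (by omega)
  rw [add_mul]
  gcongr
  · exact le_abs_self K
  · exact le_abs_self K'

lemma Tame.add {f g : ι → ℂ} (hB : ∀ i, 1 ≤ B i) (hf : Tame B f) (hg : Tame B g) :
    Tame B (fun i => f i + g i) := by
  obtain ⟨K, p, h⟩ := hf
  obtain ⟨K', p', h'⟩ := hg
  exact ⟨|K| + |K'|, p + p', fun i => (norm_add_le _ _).trans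
    ((add_le_add (h i) (h' i)).trans (add_pow_le_sum (hB i) p p'))⟩

lemma Negl.mul {f g : ι → ℂ} (hf : Negl B δ f) (hg : Tame B g) :
    Negl B δ (fun i => f i * g i) := by
  obtain ⟨K, p, h⟩ := hf
  obtain ⟨K', p', h'⟩ := hg
  refine ⟨K * K', p + p', fun i => ?_⟩
  rw [norm_mul, pow_add, mul_mul_mul_comm, ← mul_assoc]
  have := (norm_nonneg _).trans (h i)
  exact mul_le_mul (h i) (h' i) (norm_nonneg _) this

lemma Negl.add {f g : ι → ℂ} (hB : ∀ i, 1 ≤ B i) (hδ : ∀ i, 0 ≤ δ i) (hf : Negl B δ f)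
    (hg : Negl B δ g) : Negl B δ (fun i => f i + g i) := by
  obtain ⟨K, p, h⟩ := hf
  obtain ⟨K', p', h'⟩ := hg
  refine ⟨|K| + |K'|, p + p', fun i => (norm_add_le _ _).trans
    ((add_le_add (h i) (h' i)).trans ?_)⟩
  rw [← mul_add]
  exact mul_le_mul_of_nonneg_left (add_pow_le_sum (hB i) p p') (hδ i)

lemma Negl.congr {f g : ι → ℂ} (hf : Negl B δ f) (h : ∀ i, g i = f i) : Negl B δ g := by
  rwa [show g = f from funext h]

lemma negl_zero (B δ : ι → ℝ) : Negl B δ (fun _ => 0) := ⟨0, 0, fun i => by simp⟩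

lemma Negl.sub_pow {f g : ι → ℂ} (hB : ∀ i, 1 ≤ B i) (hδ : ∀ i, 0 ≤ δ i) (hf : Tame B f)
    (hg : Tame B g) (h : Negl B δ (fun i => f i - g i)) (n : ℕ) :
    Negl B δ (fun i => f i ^ n - g i ^ n) := by
  induction n with
  | zero => simpa using negl_zero B δ
  | succ n ih =>
    exact ((ih.mul hf).add hB hδ (h.mul (hg.pow n))).congr fun i => by ring

lemma Negl.sub_mul {f g f' g' : ι → ℂ} (hB : ∀ i, 1 ≤ B i) (hδ : ∀ i, 0 ≤ δ i) (hf' : Tame B f')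
    (hg : Tame B g) (h : Negl B δ (fun i => f i - g i)) (h' : Negl B δ (fun i => f' i - g' i)) :
    Negl B δ (fun i => f i * f' i - g i * g' i) :=
  ((h.mul hf').add hB hδ (h'.mul hg)).congr fun i => by ring

lemma Negl.mul_pow {x X : ι → ℂ} (hx : Tame B x) (hX : Tame B X)
    (sx : Negl B δ x) (sX : Negl B δ X) {m n : ℕ} (h : 1 ≤ m + n) :
    Negl B δ (fun i => x i ^ m * X i ^ n) := by
  rcases m with _ | m
  · obtain ⟨n, rfl⟩ := Nat.exists_eq_add_of_le' (show 1 ≤ n by omega)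
    exact (sX.mul (hX.pow n)).congr fun i => by ring
  · exact (sx.mul ((hx.pow m).mul (hX.pow n))).congr fun i => by ring

lemma negl_monomial_sub {x X z Z : ι → ℂ} (hB : ∀ i, 1 ≤ B i) (hδ : ∀ i, 0 ≤ δ i)
    (hx : Tame B x) (hX : Tame B X) (hz : Tame B z) (hZ : Tame B Z) {σ : ℂ} (hσ : σ ^ 2 = 1)
    (h1 : Negl B δ (fun i => x i * X i - σ * (z i * Z i)))
    (h4 : Negl B δ (fun i => x i ^ 4 - σ * z i ^ 4))
    (h4' : Negl B δ (fun i => X i ^ 4 - σ * Z i ^ 4)) {m n L : ℕ} (hL : m + 3 * n = 4 * L) :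
    Negl B δ (fun i => x i ^ m * X i ^ n - σ ^ L * (z i ^ m * Z i ^ n)) := by
  have hσt : Tame B (fun _ => σ) := tame_const σ
  have txX := hx.mul hX
  have tzZ := hσt.mul (hz.mul hZ)
  have tx4 := hx.pow 4
  have tX4 := hX.pow 4
  have tz4 := hσt.mul (hz.pow 4)
  have tZ4 := hσt.mul (hZ.pow 4)
  rcases le_total n m with h | h
  · obtain ⟨t, rfl⟩ : ∃ t, m = n + 4 * t := ⟨(m - n) / 4, by omega⟩
    obtain rfl : L = n + t := by omega
    refine (Negl.sub_mul hB hδ (tx4.pow t) (tzZ.pow n) (h1.sub_pow hB hδ txX tzZ n)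
      (h4.sub_pow hB hδ tx4 tz4 t)).congr fun i => ?_
    ring
  · obtain ⟨t, rfl⟩ : ∃ t, n = m + 4 * t := ⟨(n - m) / 4, by omega⟩
    obtain rfl : L = m + t + 2 * t := by omega
    refine (Negl.sub_mul hB hδ (tX4.pow t) (tzZ.pow m) (h1.sub_pow hB hδ txX tzZ m)
      (h4'.sub_pow hB hδ tX4 tZ4 t)).congr fun i => ?_
    rw [pow_add σ, pow_mul σ 2 t, hσ]
    ring

lemma negl_bracket {x y z X Y Z : ι → ℂ} (hB : ∀ i, 1 ≤ B i) (hδ : ∀ i, 0 ≤ δ i)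
    (hx : Tame B x) (hX : Tame B X) (hy : Tame B y) (hY : Tame B Y) (hz : Tame B z)
    (hZ : Tame B Z) (hmod : ∀ i, y i * Y i = x i * X i + z i * Z i)
    (h4 : ∀ i, y i ^ 4 = x i ^ 4 + z i ^ 4) (h4' : ∀ i, Y i ^ 4 = X i ^ 4 + Z i ^ 4)
    (hs : Negl B δ x ∧ Negl B δ X ∨ Negl B δ y ∧ Negl B δ Y ∨ Negl B δ z ∧ Negl B δ Z)
    {k l m n L : ℕ} (hL : m + 3 * n = 4 * L) (hkl : 1 ≤ k + l) (hmn : 1 ≤ m + n) :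
    Negl B δ (fun i => x i ^ k * X i ^ l * (y i ^ m * Y i ^ n + (-1) ^ L * (z i ^ m * Z i ^ n)
      - x i ^ m * X i ^ n)) := by
  have hmon : ∀ {f g : ι → ℂ}, Tame B f → Tame B g → ∀ p q, Tame B fun i => f i ^ p * g i ^ q :=
    fun hf hg p q => (hf.pow p).mul (hg.pow q)
  have c1 : ∀ c : ℂ, Tame B (fun _ => c) := tame_const
  rcases hs with ⟨s, s'⟩ | ⟨s, s'⟩ | ⟨s, s'⟩
  · refine ((Negl.mul_pow hx hX s s' hkl).mul (((hmon hy hY m n).add hB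
      ((c1 ((-1) ^ L)).mul (hmon hz hZ m n))).add hB ((c1 (-1)).mul (hmon hx hX m n)))).congr
      fun i => ?_
    ring
  · have key := negl_monomial_sub hB hδ hx hX hz hZ (σ := -1) (by norm_num)
      ((s.mul hY).congr fun i => by linear_combination -hmod i)
      ((s.mul (hy.pow 3)).congr fun i => by linear_combination -h4 i)
      ((s'.mul (hY.pow 3)).congr fun i => by linear_combination -h4' i) hL
    refine (((Negl.mul_pow hy hY s s' hmn).add hB hδ (key.mul (c1 (-1)))).mul
      (hmon hx hX k l)).congr fun i => ?_
    ring
  · have key := negl_monomial_sub hB hδ hy hY hx hX (σ := 1) (by norm_num)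
      ((s.mul hZ).congr fun i => by linear_combination hmod i)
      ((s.mul (hz.pow 3)).congr fun i => by linear_combination h4 i)
      ((s'.mul (hZ.pow 3)).congr fun i => by linear_combination h4' i) hL
    refine ((((Negl.mul_pow hz hZ s s' hmn).mul (c1 ((-1) ^ L))).add hB hδ key).mul
      (hmon hx hX k l)).congr fun i => ?_
    simp only [one_pow]
    ring

end Tame

/-- The combination of theta constants comparing tuples with `k` and `l` odd entries of the two
kinds to tuples with all entries odd. -/
noncomputable def thetaBracket (k l m n L : ℕ) (τ : ℂ) : ℂ :=
  thetaSeries oddWt τ ^ k * thetaSeries oddWt (3 * τ) ^ l *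
    (thetaSeries evenWt τ ^ m * thetaSeries evenWt (3 * τ) ^ n +
      (-1) ^ L * (thetaSeries altWt τ ^ m * thetaSeries altWt (3 * τ) ^ n) -
      thetaSeries oddWt τ ^ m * thetaSeries oddWt (3 * τ) ^ n)

open UpperHalfPlane in
lemma norm_thetaBracket_le {k l m n L : ℕ} (hL : m + 3 * n = 4 * L) (hkl : 1 ≤ k + l)
    (hmn : 1 ≤ m + n) : ∃ C : ℝ, ∀ τ : ℍ,
      (τ.im ^ (1 / 4 : ℝ)) ^ (k + l + m + n) * ‖thetaBracket k l m n L τ‖ ≤ C := by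
  obtain ⟨C, hC, h⟩ := exists_theta_cusp_bound
  choose Y hY hle hsm using h
  have him3 : ∀ τ : ℍ, 0 < (3 * (τ : ℂ)).im := fun τ => by
    have := im_intCast_mul 3 τ
    push_cast at this
    rw [this]
    exact mul_pos (by norm_num) τ.im_pos
  have hdecay : ∀ p : ℕ, ∃ M : ℝ, ∀ y : ℝ, 0 ≤ y → Real.exp (-(Real.pi * y / 12)) * y ^ p ≤ M := by
    refine fun p => ⟨p.factorial * (12 / Real.pi) ^ p, fun y hy => ?_⟩
    have h := Real.pow_div_factorial_le_exp (Real.pi * y / 12) (by positivity) p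
    rw [div_le_iff₀ (by positivity)] at h
    rw [Real.exp_neg, inv_mul_le_iff₀ (Real.exp_pos _)]
    calc y ^ p = (12 / Real.pi) ^ p * (Real.pi * y / 12) ^ p := by
          rw [← mul_pow]
          congr 1
          field_simp
      _ ≤ (12 / Real.pi) ^ p * (Real.exp (Real.pi * y / 12) * p.factorial) := by gcongr
      _ = _ := by ring
  set lam : ℍ → ℂ := fun τ => ((τ.im ^ (1 / 4 : ℝ) : ℝ) : ℂ) with hlam
  have hlamn : ∀ τ, ‖lam τ‖ = τ.im ^ (1 / 4 : ℝ) := fun τ => by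
    rw [hlam, Complex.norm_real, Real.norm_of_nonneg (Real.rpow_nonneg τ.im_pos.le _)]
  have key : ∀ w ∈ ({oddWt, evenWt, altWt} : Set (ℤ → ℂ)), ∃ M : ℝ, ∀ τ : ℍ,
      (τ.im ^ (1 / 4 : ℝ) * ‖thetaSeries w τ‖ ≤
        C * Y τ * Real.exp (-(Real.pi * Y τ / 12)) ∧
      τ.im ^ (1 / 4 : ℝ) * ‖thetaSeries w (3 * τ)‖ ≤
        C * Y τ * Real.exp (-(Real.pi * Y τ / 12))) →
      (τ.im ^ (1 / 4 : ℝ)) ^ (k + l + m + n) * ‖thetaBracket k l m n L τ‖ ≤ M := by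
    intro w hw
    let S := {τ : ℍ // τ.im ^ (1 / 4 : ℝ) * ‖thetaSeries w τ‖ ≤
        C * Y τ * Real.exp (-(Real.pi * Y τ / 12)) ∧
      τ.im ^ (1 / 4 : ℝ) * ‖thetaSeries w (3 * τ)‖ ≤
        C * Y τ * Real.exp (-(Real.pi * Y τ / 12))}
    let B : S → ℝ := fun τ => 2 * Y τ.1
    let δ : S → ℝ := fun τ => Real.exp (-(Real.pi * Y τ.1 / 12))
    have hB : ∀ i, 1 ≤ B i := fun i => by have := hY i.1; simp only [B]; linarith
    have hδ : ∀ i, 0 ≤ δ i := fun i => (Real.exp_pos _).le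
    have t1 : ∀ v ∈ ({oddWt, evenWt, altWt} : Set (ℤ → ℂ)),
        Tame B (fun τ => lam τ.1 * thetaSeries v τ.1) := fun v hv =>
      ⟨C / 2, 1, fun τ => by
        rw [norm_mul, hlamn]
        exact (hle τ.1 v hv).1.trans (by simp only [B]; linarith)⟩
    have t3 : ∀ v ∈ ({oddWt, evenWt, altWt} : Set (ℤ → ℂ)),
        Tame B (fun τ => lam τ.1 * thetaSeries v (3 * τ.1)) := fun v hv =>
      ⟨C / 2, 1, fun τ => by
        rw [norm_mul, hlamn]
        exact (hle τ.1 v hv).2.trans (by simp only [B]; linarith)⟩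
    have s1 : Negl B δ (fun τ => lam τ.1 * thetaSeries w τ.1) :=
      ⟨C / 2, 1, fun τ => by
        rw [norm_mul, hlamn]
        exact τ.2.1.trans (by simp only [B, δ]; apply le_of_eq; ring)⟩
    have s3 : Negl B δ (fun τ => lam τ.1 * thetaSeries w (3 * τ.1)) :=
      ⟨C / 2, 1, fun τ => by
        rw [norm_mul, hlamn]
        exact τ.2.2.trans (by simp only [B, δ]; apply le_of_eq; ring)⟩
    obtain ⟨K, p, hK⟩ := negl_bracket hB hδ (t1 oddWt (by simp)) (t3 oddWt (by simp))
      (t1 evenWt (by simp)) (t3 evenWt (by simp)) (t1 altWt (by simp)) (t3 altWt (by simp))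
      (fun τ => by linear_combination lam τ.1 ^ 2 * theta_modular_equation τ.1.im_pos)
      (fun τ => by linear_combination lam τ.1 ^ 4 * theta_jacobi_identity τ.1.im_pos)
      (fun τ => by linear_combination lam τ.1 ^ 4 * theta_jacobi_identity (him3 τ.1))
      (by rcases hw with rfl | rfl | rfl
          · exact Or.inl ⟨s1, s3⟩
          · exact Or.inr (Or.inl ⟨s1, s3⟩)
          · exact Or.inr (Or.inr ⟨s1, s3⟩)) hL hkl hmn
    obtain ⟨M, hM⟩ := hdecay p
    refine ⟨|K| * 2 ^ p * M, fun τ hτ => ?_⟩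
    have := hK ⟨τ, hτ⟩
    calc _ = ‖lam τ ^ (k + l + m + n) * thetaBracket k l m n L τ‖ := by
          rw [norm_mul, norm_pow, hlamn]
      _ ≤ δ ⟨τ, hτ⟩ * (K * B ⟨τ, hτ⟩ ^ p) := by
          refine le_trans (le_of_eq ?_) this
          congr 1
          rw [thetaBracket]
          ring
      _ ≤ δ ⟨τ, hτ⟩ * (|K| * B ⟨τ, hτ⟩ ^ p) := by
          have h1 := hδ ⟨τ, hτ⟩
          have h2 := hB ⟨τ, hτ⟩
          gcongr
          exact le_abs_self K
      _ = |K| * 2 ^ p * (Real.exp (-(Real.pi * Y τ / 12)) * Y τ ^ p) := by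
          simp only [B, δ]; ring
      _ ≤ _ := by
          gcongr
          exact hM _ (by linarith [hY τ])
  obtain ⟨M1, h1⟩ := key oddWt (by simp)
  obtain ⟨M2, h2⟩ := key evenWt (by simp)
  obtain ⟨M3, h3⟩ := key altWt (by simp)
  refine ⟨max M1 (max M2 M3), fun τ => ?_⟩
  obtain ⟨w, rfl | rfl | rfl, hw⟩ := hsm τ
  · exact (h1 τ hw).trans (by simp)
  · exact (h2 τ hw).trans (by simp)
  · exact (h3 τ hw).trans (by simp)

lemma continuous_nome_line (y : ℝ) (k : ℤ) :
    Continuous fun x : ℝ => nome ((x : ℂ) + y * Complex.I) k := by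
  unfold nome
  fun_prop

lemma integral_nome_line (y : ℝ) {k : ℤ} (hk : k ≠ 0) :
    ∫ x in (0 : ℝ)..8, nome ((x : ℂ) + y * Complex.I) k = 0 := by
  have hc : (Real.pi * Complex.I * k / 4 : ℂ) ≠ 0 := by
    simp [Real.pi_ne_zero, hk]
  have : ∀ x : ℝ, nome ((x : ℂ) + y * Complex.I) k =
      nome (y * Complex.I) k * Complex.exp (Real.pi * Complex.I * k / 4 * x) := fun x => by
    rw [nome, nome, ← Complex.exp_add]
    congr 1
    ring
  simp_rw [this]
  rw [intervalIntegral.integral_const_mul, integral_exp_mul_complex hc]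
  have h8 : Complex.exp (Real.pi * Complex.I * k / 4 * (8 : ℝ)) = 1 := by
    rw [show (Real.pi * Complex.I * k / 4 * (8 : ℝ) : ℂ) = k * (2 * Real.pi * Complex.I) by
      push_cast; ring]
    exact Complex.exp_int_mul_two_pi_mul_I k
  rw [h8]
  simp

/-- Cauchy's estimate for the coefficients of a theta-like series. -/
lemma norm_coeff_le {V : Type*} [Countable V] (K : V → ℂ) (Q : V → ℤ) {y B : ℝ}
    (hsum : ∀ x : ℝ, Summable fun v => ‖K v * nome (x + y * Complex.I) (Q v)‖)
    (hB : ∀ x : ℝ, ‖∑' v, K v * nome (x + y * Complex.I) (Q v)‖ ≤ B) (M : ℤ) :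
    ‖∑' v, (if Q v = M then K v else 0)‖ ≤ B * Real.exp (Real.pi * M * y / 4) := by
  have him : ∀ x : ℝ, ((x : ℂ) + y * Complex.I).im = y := fun x => by simp
  have hnorm : ∀ (x : ℝ) (v : V), ‖K v * nome ((x : ℂ) + y * Complex.I) (Q v - M)‖ =
      ‖K v * nome (((0 : ℝ) : ℂ) + y * Complex.I) (Q v)‖ * Real.exp (Real.pi * M * y / 4) :=
    fun x v => by
      rw [norm_mul, norm_mul, norm_nome, norm_nome, him, him, mul_assoc ‖K v‖, ← Real.exp_add]
      congr 2
      push_cast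
      ring
  have hfac : ∀ (x : ℝ) (v : V), K v * nome ((x : ℂ) + y * Complex.I) (Q v - M) =
      K v * nome ((x : ℂ) + y * Complex.I) (Q v) * nome ((x : ℂ) + y * Complex.I) (-M) :=
    fun x v => by rw [sub_eq_add_neg, nome_add, mul_assoc]
  have hs : HasSum (fun v => ∫ x in (0 : ℝ)..8, K v * nome ((x : ℂ) + y * Complex.I) (Q v - M))
      (∫ x in (0 : ℝ)..8, ∑' v, K v * nome ((x : ℂ) + y * Complex.I) (Q v - M)) := by
    refine intervalIntegral.hasSum_integral_of_dominated_convergence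
      (fun v _ => ‖K v * nome (((0 : ℝ) : ℂ) + y * Complex.I) (Q v)‖ *
        Real.exp (Real.pi * M * y / 4)) ?_ ?_ ?_ ?_ ?_
    · exact fun v => (continuous_const.mul (continuous_nome_line y _)).aestronglyMeasurable
    · exact fun v => Filter.Eventually.of_forall fun x _ => (hnorm x v).le
    · exact Filter.Eventually.of_forall fun x _ => (hsum 0).mul_right _
    · exact intervalIntegrable_const
    · refine Filter.Eventually.of_forall fun x _ => ?_
      have : Summable fun v => ‖K v * nome ((x : ℂ) + y * Complex.I) (Q v - M)‖ := by
        simp_rw [hnorm]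
        exact (hsum 0).mul_right _
      exact this.of_norm.hasSum
  have hval : ∀ v, (∫ x in (0 : ℝ)..8, K v * nome ((x : ℂ) + y * Complex.I) (Q v - M)) =
      8 * (if Q v = M then K v else 0) := fun v => by
    split_ifs with h
    · simp [h, nome_zero]
    · rw [intervalIntegral.integral_const_mul, integral_nome_line y (sub_ne_zero.2 h)]
      simp
  simp_rw [hval] at hs
  have heq := hs.tsum_eq
  rw [tsum_mul_left] at heq
  have hle : ‖∫ x in (0 : ℝ)..8, ∑' v, K v * nome ((x : ℂ) + y * Complex.I) (Q v - M)‖ ≤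
      B * Real.exp (Real.pi * M * y / 4) * |8 - 0| := by
    refine intervalIntegral.norm_integral_le_of_norm_le_const fun x _ => ?_
    simp_rw [hfac]
    rw [tsum_mul_right, norm_mul, norm_nome, him]
    refine le_of_le_of_eq (mul_le_mul_of_nonneg_right (hB x) (Real.exp_pos _).le) ?_
    congr 2
    push_cast
    ring
  rw [← heq, norm_mul] at hle
  norm_num at hle
  linarith

lemma hasSum_pi_prod {n : ℕ} (f : Fin n → ℤ → ℂ) (hf : ∀ i, Summable fun k => ‖f i k‖) :
    (Summable fun p : Fin n → ℤ => ‖∏ i, f i (p i)‖) ∧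
      ∑' p : Fin n → ℤ, ∏ i, f i (p i) = ∏ i, ∑' k, f i k := by
  induction n with
  | zero => exact ⟨(hasSum_fintype _).summable, by simp⟩
  | succ n ih =>
    obtain ⟨h1, h2⟩ := ih (fun i => f i.succ) (fun i => hf i.succ)
    have hfun : (fun q : ℤ × (Fin n → ℤ) => ∏ i, f i ((Fin.consEquiv fun _ => ℤ) q i)) =
        fun q => f 0 q.1 * ∏ i : Fin n, f i.succ (q.2 i) := by
      funext q
      simp [Fin.prod_univ_succ, Fin.consEquiv]
    constructor
    · rw [← (Fin.consEquiv fun _ => ℤ).summable_iff]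
      have := (hf 0).mul_norm h1
      refine this.congr fun q => ?_
      exact congrArg norm (congrFun hfun q).symm
    · rw [← (Fin.consEquiv fun _ => ℤ).tsum_eq, hfun, Fin.prod_univ_succ, ← h2,
        tsum_mul_tsum_of_summable_norm (hf 0) h1]

/-- The quadratic form `x₁² + ⋯ + x_a² + 3y₁² + ⋯ + 3y_b²`. -/
def sqForm {a b : ℕ} (p : (Fin a → ℤ) × (Fin b → ℤ)) : ℤ :=
  ∑ i, (p.1 i) ^ 2 + 3 * ∑ j, (p.2 j) ^ 2

lemma nome_sum {ι : Type*} (s : Finset ι) (τ : ℂ) (k : ι → ℤ) :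
    nome τ (∑ i ∈ s, k i) = ∏ i ∈ s, nome τ (k i) := by
  classical
  induction s using Finset.induction_on with
  | empty => simp [nome_zero]
  | insert i s hi ih => rw [Finset.sum_insert hi, Finset.prod_insert hi, nome_add, ih]

lemma im_three_mul {τ : ℂ} (hτ : 0 < τ.im) : 0 < (3 * τ).im := by
  have := im_intCast_mul 3 τ
  push_cast at this
  rw [this]
  linarith

lemma prod_thetaSeries_eq_tsum {a b : ℕ} {u : Fin a → ℤ → ℂ} {v : Fin b → ℤ → ℂ}
    (hu : ∀ i n, ‖u i n‖ ≤ 1) (hv : ∀ j n, ‖v j n‖ ≤ 1) {τ : ℂ} (hτ : 0 < τ.im) :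
    (Summable fun p : (Fin a → ℤ) × (Fin b → ℤ) =>
      ‖(∏ i, u i (p.1 i)) * (∏ j, v j (p.2 j)) * nome τ (sqForm p)‖) ∧
    ∑' p : (Fin a → ℤ) × (Fin b → ℤ),
      (∏ i, u i (p.1 i)) * (∏ j, v j (p.2 j)) * nome τ (sqForm p) =
      (∏ i, thetaSeries (u i) τ) * ∏ j, thetaSeries (v j) (3 * τ) := by
  obtain ⟨s1, e1⟩ := hasSum_pi_prod (fun i k => u i k * nome τ (k ^ 2))
    (fun i => summable_norm_weighted hτ (hu i))
  obtain ⟨s2, e2⟩ := hasSum_pi_prod (fun j k => v j k * nome (3 * τ) (k ^ 2))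
    (fun j => summable_norm_weighted (im_three_mul hτ) (hv j))
  have hterm : ∀ p : (Fin a → ℤ) × (Fin b → ℤ),
      (∏ i, u i (p.1 i)) * (∏ j, v j (p.2 j)) * nome τ (sqForm p) =
      (∏ i, u i (p.1 i) * nome τ (p.1 i ^ 2)) * ∏ j, v j (p.2 j) * nome (3 * τ) (p.2 j ^ 2) := by
    intro p
    have h3 : nome (3 * τ) (∑ j, p.2 j ^ 2) = nome τ (3 * ∑ j, p.2 j ^ 2) := by
      have := nome_mul τ 3 (∑ j, p.2 j ^ 2)
      push_cast at this
      exact this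
    rw [Finset.prod_mul_distrib, Finset.prod_mul_distrib, ← nome_sum, ← nome_sum, h3, sqForm,
      nome_add]
    ring
  refine ⟨(s1.mul_norm s2).congr fun p => congrArg norm (hterm p).symm, ?_⟩
  rw [tsum_congr hterm, ← tsum_mul_tsum_of_summable_norm s1 s2, e1, e2]
  simp only [thetaSeries]

lemma nome_one_four_mul (k : ℤ) : nome 1 (4 * k) = (-1) ^ k := by
  rw [nome, ← exp_pi_mul_I_int]
  congr 1
  push_cast
  ring

lemma neg_one_zpow_odd_mul_sq {c : ℤ} (hc : Odd c) (k : ℤ) : (-1 : ℂ) ^ (c * k ^ 2) = (-1) ^ k := by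
  rcases Int.even_or_odd k with h | h
  · rw [h.neg_one_zpow, ((h.pow_of_ne_zero two_ne_zero).mul_left c).neg_one_zpow]
  · rw [h.neg_one_zpow, (hc.mul h.pow).neg_one_zpow]

lemma altWt_eq_evenWt_mul_nome {c : ℤ} (hc : Odd c) (x : ℤ) :
    altWt x = evenWt x * nome 1 (c * x ^ 2) := by
  rcases Int.even_or_odd' x with ⟨k, rfl | rfl⟩
  · rw [altWt_two_mul, evenWt_two_mul, show c * (2 * k) ^ 2 = 4 * (c * k ^ 2) by ring,
      nome_one_four_mul, neg_one_zpow_odd_mul_sq hc, one_mul]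
  · rw [altWt_of_odd ⟨k, rfl⟩, evenWt_of_odd ⟨k, rfl⟩, zero_mul]

lemma oddWt_mul_nome_one (c x : ℤ) : oddWt x * nome 1 c = oddWt x * nome 1 (c * x ^ 2) := by
  rcases Int.even_or_odd' x with ⟨k, rfl | rfl⟩
  · rw [oddWt_of_even ⟨k, by ring⟩, zero_mul, zero_mul]
  · rw [show c * (2 * k + 1) ^ 2 = c + 4 * (c * (k * (k + 1))) by ring, nome_add,
      nome_one_four_mul, ((Int.even_mul_succ_self k).mul_left c).neg_one_zpow, mul_one]

/-- The weight which is `oddWt` in the coordinates in `P` and `w` in the others. -/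
noncomputable def mixedWt {a : ℕ} (w : ℤ → ℂ) (P : Finset (Fin a)) (i : Fin a) : ℤ → ℂ :=
  if i ∈ P then oddWt else w

/-- The set of coordinates at which `x` is odd. -/
noncomputable def oddSupport {a : ℕ} (x : Fin a → ℤ) : Finset (Fin a) :=
  Finset.univ.filter fun i => Odd (x i)

lemma norm_mixedWt_le {a : ℕ} {w : ℤ → ℂ} (hw : ∀ n, ‖w n‖ ≤ 1) (P : Finset (Fin a)) (i : Fin a)
    (n : ℤ) : ‖mixedWt w P i n‖ ≤ 1 := by
  unfold mixedWt
  split_ifs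
  exacts [norm_oddWt_le n, hw n]

lemma prod_thetaSeries_mixedWt {a : ℕ} (w : ℤ → ℂ) (P : Finset (Fin a)) (τ : ℂ) :
    ∏ i, thetaSeries (mixedWt w P i) τ =
      thetaSeries oddWt τ ^ P.card * thetaSeries w τ ^ (a - P.card) := by
  have : ∀ i, thetaSeries (mixedWt w P i) τ =
      if i ∈ P then thetaSeries oddWt τ else thetaSeries w τ := fun i => by
    unfold mixedWt
    split_ifs <;> rfl
  simp_rw [this]
  rw [Finset.prod_ite, Finset.prod_const, Finset.prod_const]
  congr 2
  · simp
  · rw [Finset.filter_not, Finset.card_sdiff]; simp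

lemma prod_mixedWt_evenWt {a : ℕ} (P : Finset (Fin a)) (x : Fin a → ℤ) :
    ∏ i, mixedWt evenWt P i (x i) = if oddSupport x = P then 1 else 0 := by
  split_ifs with h
  · refine Finset.prod_eq_one fun i _ => ?_
    rw [mixedWt, ← h]
    by_cases hi : Odd (x i)
    · rw [if_pos (by simp [oddSupport, hi]), oddWt_of_odd hi]
    · rw [if_neg (by simp [oddSupport, hi]), evenWt_of_even (Int.not_odd_iff_even.1 hi)]
  · obtain ⟨i, hi⟩ : ∃ i, ¬ (i ∈ oddSupport x ↔ i ∈ P) := by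
      by_contra! hc
      exact h (Finset.ext hc)
    refine Finset.prod_eq_zero (Finset.mem_univ i) ?_
    simp only [oddSupport, Finset.mem_filter, Finset.mem_univ, true_and] at hi
    rw [mixedWt]
    split_ifs with hP
    · exact oddWt_of_even (Int.not_odd_iff_even.1 fun h => hi (by simp [h, hP]))
    · exact evenWt_of_odd (by by_contra h; exact hi (by simp [h, hP]))

lemma prod_oddWt {a : ℕ} (x : Fin a → ℤ) :
    ∏ i, oddWt (x i) = if oddSupport x = Finset.univ then 1 else 0 := by
  rw [← prod_mixedWt_evenWt]
  simp [mixedWt]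

lemma prod_mixedWt_altWt {a : ℕ} {c : ℤ} (hc : Odd c) (P : Finset (Fin a)) (x : Fin a → ℤ) :
    (∏ i, mixedWt altWt P i (x i)) * nome 1 (c * P.card) =
      (∏ i, mixedWt evenWt P i (x i)) * nome 1 (c * ∑ i, x i ^ 2) := by
  have h1 : nome 1 (c * P.card) = ∏ i, if i ∈ P then nome 1 c else 1 := by
    rw [Finset.prod_ite_mem, Finset.univ_inter, ← nome_sum]
    simp [mul_comm]
  rw [h1, Finset.mul_sum, nome_sum, ← Finset.prod_mul_distrib, ← Finset.prod_mul_distrib]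
  refine Finset.prod_congr rfl fun i _ => ?_
  unfold mixedWt
  split_ifs
  · exact oddWt_mul_nome_one _ _
  · rw [mul_one, altWt_eq_evenWt_mul_nome hc]

lemma prod_mixedWt_altWt_eq {a b : ℕ} {P : Finset (Fin a)} {R : Finset (Fin b)} {L : ℕ}
    (hL : (a - P.card) + 3 * (b - R.card) = 4 * L) {p : (Fin a → ℤ) × (Fin b → ℤ)}
    (hp : (8 : ℤ) ∣ sqForm p - (a + 3 * b)) :
    (-1) ^ L * ((∏ i, mixedWt altWt P i (p.1 i)) * ∏ j, mixedWt altWt R j (p.2 j)) =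
      (∏ i, mixedWt evenWt P i (p.1 i)) * ∏ j, mixedWt evenWt R j (p.2 j) := by
  have hP := Finset.card_le_univ P
  have hR := Finset.card_le_univ R
  rw [Fintype.card_fin] at hP hR
  obtain ⟨r, hr⟩ := hp
  have h1 := prod_mixedWt_altWt (c := 1) (by decide) P p.1
  have h3 := prod_mixedWt_altWt (c := 3) (by decide) R p.2
  set c0 : ℤ := 1 * P.card + 3 * R.card with hc0
  have hQ : 1 * ∑ i, p.1 i ^ 2 + 3 * ∑ j, p.2 j ^ 2 = c0 + 4 * (L + 2 * r) := by
    have : 1 * ∑ i, p.1 i ^ 2 + 3 * ∑ j, p.2 j ^ 2 = sqForm p := by rw [sqForm, one_mul]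
    rw [this]
    omega
  have hmul := congrArg₂ (· * ·) h1 h3
  simp only [mul_mul_mul_comm _ (nome 1 _)] at hmul
  rw [← nome_add, ← nome_add, hQ, ← hc0, nome_add 1 c0, nome_one_four_mul, zpow_add₀ (by norm_num),
    (even_two_mul r).neg_one_zpow, mul_one, zpow_natCast] at hmul
  have hne : nome 1 c0 ≠ 0 := Complex.exp_ne_zero _
  have hsq : ((-1 : ℂ) ^ L) * (-1) ^ L = 1 := by rw [← mul_pow]; simp
  refine mul_right_cancel₀ hne ?_
  linear_combination (-1 : ℂ) ^ L * hmul + ((∏ i, mixedWt evenWt P i (p.1 i)) *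
    ∏ j, mixedWt evenWt R j (p.2 j)) * nome 1 c0 * hsq

lemma finite_sqForm_eq (a b : ℕ) (M : ℤ) :
    {p : (Fin a → ℤ) × (Fin b → ℤ) | sqForm p = M}.Finite := by
  classical
  refine (Set.finite_Icc ((fun _ => -M, fun _ => -M) : (Fin a → ℤ) × (Fin b → ℤ))
    (fun _ => M, fun _ => M)).subset ?_
  rintro p (hp : sqForm p = M)
  have h1 : ∀ i, p.1 i ^ 2 ≤ ∑ i, p.1 i ^ 2 := fun i =>
    Finset.single_le_sum (f := fun i => p.1 i ^ 2) (fun i _ => sq_nonneg _) (Finset.mem_univ i)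
  have h2 : ∀ i, p.2 i ^ 2 ≤ ∑ i, p.2 i ^ 2 := fun i =>
    Finset.single_le_sum (f := fun i => p.2 i ^ 2) (fun i _ => sq_nonneg _) (Finset.mem_univ i)
  have h3 : 0 ≤ ∑ i, p.1 i ^ 2 := Finset.sum_nonneg fun i _ => sq_nonneg _
  have h4 : 0 ≤ ∑ i, p.2 i ^ 2 := Finset.sum_nonneg fun i _ => sq_nonneg _
  rw [sqForm] at hp
  have key : ∀ x : ℤ, x ^ 2 ≤ M → -M ≤ x ∧ x ≤ M := fun x hx => by
    constructor <;> nlinarith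
  refine ⟨⟨fun i => ?_, fun j => ?_⟩, ⟨fun i => ?_, fun j => ?_⟩⟩
  · exact (key _ (by linarith [h1 i])).1
  · exact (key _ (by linarith [h2 j])).1
  · exact (key _ (by linarith [h1 i])).2
  · exact (key _ (by linarith [h2 j])).2

/-- The finite set of representations of `M`. -/
noncomputable def reps (a b : ℕ) (M : ℤ) : Finset ((Fin a → ℤ) × (Fin b → ℤ)) :=
  (finite_sqForm_eq a b M).toFinset

@[simp] lemma mem_reps {a b : ℕ} {M : ℤ} {p : (Fin a → ℤ) × (Fin b → ℤ)} :
    p ∈ reps a b M ↔ sqForm p = M := by simp [reps]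

/-- The number of representations of `M` with odd coordinates exactly those in `P` and `R`. -/
noncomputable def patternCount {a b : ℕ} (P : Finset (Fin a)) (R : Finset (Fin b)) (M : ℤ) : ℕ :=
  ((reps a b M).filter fun p => oddSupport p.1 = P ∧ oddSupport p.2 = R).card

lemma norm_patternCount_sub_le {a b : ℕ} {P : Finset (Fin a)} {R : Finset (Fin b)} {L : ℕ}
    (hL : (a - P.card) + 3 * (b - R.card) = 4 * L) {M : ℤ} (hM : (8 : ℤ) ∣ M - (a + 3 * b))
    {y B : ℝ} (hy : 0 < y) (hB : ∀ τ : ℂ, τ.im = y →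
      ‖thetaBracket P.card R.card (a - P.card) (b - R.card) L τ‖ ≤ B) :
    |2 * (patternCount P R M : ℝ) -
      patternCount (Finset.univ : Finset (Fin a)) (Finset.univ : Finset (Fin b)) M| ≤
      B * Real.exp (Real.pi * M * y / 4) := by
  have hP := Finset.card_le_univ P
  have hR := Finset.card_le_univ R
  rw [Fintype.card_fin] at hP hR
  set E : (Fin a → ℤ) × (Fin b → ℤ) → ℂ := fun p =>
    (∏ i, mixedWt evenWt P i (p.1 i)) * ∏ j, mixedWt evenWt R j (p.2 j) with hE
  set A : (Fin a → ℤ) × (Fin b → ℤ) → ℂ := fun p =>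
    (∏ i, mixedWt altWt P i (p.1 i)) * ∏ j, mixedWt altWt R j (p.2 j) with hA
  set O : (Fin a → ℤ) × (Fin b → ℤ) → ℂ := fun p =>
    (∏ i, oddWt (p.1 i)) * ∏ j, oddWt (p.2 j) with hO
  have hEi : ∀ p, E p = if oddSupport p.1 = P ∧ oddSupport p.2 = R then 1 else 0 := fun p => by
    simp only [hE, prod_mixedWt_evenWt, ite_and]
    split_ifs <;> simp
  have hOi : ∀ p, O p =
      if oddSupport p.1 = Finset.univ ∧ oddSupport p.2 = Finset.univ then 1 else 0 := fun p => by
    simp only [hO, prod_oddWt, ite_and]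
    split_ifs <;> simp
  have hser : ∀ τ : ℂ, 0 < τ.im →
      (Summable fun p => ‖(E p + (-1) ^ L * A p - O p) * nome τ (sqForm p)‖) ∧
      ∑' p, (E p + (-1) ^ L * A p - O p) * nome τ (sqForm p) =
        thetaBracket P.card R.card (a - P.card) (b - R.card) L τ := by
    intro τ hτ
    obtain ⟨sE, eE⟩ := prod_thetaSeries_eq_tsum
      (norm_mixedWt_le norm_evenWt_le P) (norm_mixedWt_le norm_evenWt_le R) hτ
    obtain ⟨sA, eA⟩ := prod_thetaSeries_eq_tsum
      (norm_mixedWt_le norm_altWt_le P) (norm_mixedWt_le norm_altWt_le R) hτ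
    obtain ⟨sO, eO⟩ := prod_thetaSeries_eq_tsum (a := a) (b := b)
      (u := fun _ => oddWt) (v := fun _ => oddWt)
      (fun _ => norm_oddWt_le) (fun _ => norm_oddWt_le) hτ
    have hsplit : ∀ p : (Fin a → ℤ) × (Fin b → ℤ),
        (E p + (-1) ^ L * A p - O p) * nome τ (sqForm p) =
        E p * nome τ (sqForm p) + (-1) ^ L * (A p * nome τ (sqForm p)) -
          O p * nome τ (sqForm p) := fun p => by ring
    constructor
    · refine Summable.of_nonneg_of_le (fun _ => norm_nonneg _) (fun p => ?_) ((sE.add sA).add sO)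
      rw [hsplit]
      refine (norm_sub_le _ _).trans (add_le_add_left ((norm_add_le _ _).trans ?_) _)
      rw [norm_mul ((-1) ^ L), norm_pow, norm_neg, norm_one, one_pow, one_mul]
    · rw [tsum_congr hsplit, Summable.tsum_sub (sE.of_norm.add (sA.of_norm.mul_left _)) sO.of_norm,
        Summable.tsum_add sE.of_norm (sA.of_norm.mul_left _), tsum_mul_left, eE, eA, eO]
      simp only [prod_thetaSeries_mixedWt, Finset.prod_const, Finset.card_univ, Fintype.card_fin]
      rw [thetaBracket]
      have e1 : ∀ z : ℂ, z ^ a = z ^ P.card * z ^ (a - P.card) := fun z => by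
        rw [← pow_add, Nat.add_sub_cancel' hP]
      have e2 : ∀ z : ℂ, z ^ b = z ^ R.card * z ^ (b - R.card) := fun z => by
        rw [← pow_add, Nat.add_sub_cancel' hR]
      rw [e1, e2]
      ring
  have him : ∀ x : ℝ, ((x : ℂ) + y * Complex.I).im = y := fun x => by simp
  have hc := norm_coeff_le (fun p => E p + (-1) ^ L * A p - O p) sqForm (y := y) (B := B)
    (fun x => (hser _ (by rw [him]; exact hy)).1)
    (fun x => by rw [(hser _ (by rw [him]; exact hy)).2]; exact hB _ (him x)) M
  refine le_trans (le_of_eq ?_) hc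
  rw [tsum_eq_sum (s := reps a b M) (fun p hp => if_neg (by simpa using hp))]
  have : ∀ p ∈ reps a b M, (if sqForm p = M then E p + (-1) ^ L * A p - O p else 0) =
      2 * (if oddSupport p.1 = P ∧ oddSupport p.2 = R then 1 else 0) -
      (if oddSupport p.1 = Finset.univ ∧ oddSupport p.2 = Finset.univ then 1 else 0) := by
    intro p hp
    rw [mem_reps] at hp
    rw [if_pos hp, ← hEi, ← hOi]
    have : (-1) ^ L * A p = E p := prod_mixedWt_altWt_eq hL (by rwa [hp])
    rw [this]
    ring
  rw [Finset.sum_congr rfl this, Finset.sum_sub_distrib, ← Finset.mul_sum, Finset.sum_boole,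
    Finset.sum_boole, ← Real.norm_eq_abs, ← Complex.norm_real]
  simp only [patternCount]
  push_cast
  rfl

lemma oddSupport_eq_univ {a : ℕ} {x : Fin a → ℤ} :
    oddSupport x = Finset.univ ↔ ∀ i, Odd (x i) := by
  simp [oddSupport, Finset.filter_eq_self]

lemma oddSupport_eq_empty {a : ℕ} {x : Fin a → ℤ} :
    oddSupport x = ∅ ↔ ∀ i, Even (x i) := by
  simp [oddSupport, Finset.filter_eq_empty_iff]

lemma N_eq_card_reps (a b : ℕ) (M : ℤ) : N a b M = (reps a b M).card := by
  rw [N, ← Set.ncard_coe_finset]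
  congr 1
  ext p
  simp [sqForm, eq_comm]

lemma Nstar_eq_patternCount (a b : ℕ) (M : ℤ) : Nstar a b M =
    patternCount (Finset.univ : Finset (Fin a)) (Finset.univ : Finset (Fin b)) M := by
  rw [Nstar, patternCount, ← Set.ncard_coe_finset]
  congr 1
  ext p
  simp only [Set.mem_ofPred_eq, Finset.coe_filter, mem_reps, oddSupport_eq_univ, sqForm]
  constructor
  · rintro ⟨h1, h2, h3⟩
    exact ⟨h3.symm, h1, h2⟩
  · rintro ⟨h3, h1, h2⟩
    exact ⟨h1, h2, h3.symm⟩

lemma card_reps_eq_sum_patternCount (a b : ℕ) (M : ℤ) : (reps a b M).card =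
    ∑ S : Finset (Fin a) × Finset (Fin b), patternCount S.1 S.2 M := by
  classical
  rw [Finset.card_eq_sum_card_fiberwise (f := fun p => (oddSupport p.1, oddSupport p.2))
    (t := Finset.univ) (fun _ _ => Finset.mem_univ _)]
  refine Finset.sum_congr rfl fun S _ => ?_
  rw [patternCount]
  congr 1
  ext p
  simp [Prod.ext_iff]

lemma patternCount_empty (a b : ℕ) (M : ℤ) :
    patternCount (∅ : Finset (Fin a)) (∅ : Finset (Fin b)) M =
      if (4 : ℤ) ∣ M then N a b (M / 4) else 0 := by
  have hdouble : ∀ p : (Fin a → ℤ) × (Fin b → ℤ),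
      sqForm ((fun i => 2 * p.1 i, fun j => 2 * p.2 j) : (Fin a → ℤ) × (Fin b → ℤ)) =
        4 * sqForm p := fun p => by
    simp only [sqForm, mul_pow, ← Finset.mul_sum]
    ring
  have hex : ∀ p : (Fin a → ℤ) × (Fin b → ℤ), oddSupport p.1 = ∅ → oddSupport p.2 = ∅ →
      ∃ q : (Fin a → ℤ) × (Fin b → ℤ), (fun i => 2 * q.1 i, fun j => 2 * q.2 j) = p := by
    intro p h1 h2
    rw [oddSupport_eq_empty] at h1 h2
    choose f hf using h1
    choose g hg using h2
    exact ⟨(f, g), Prod.ext (funext fun i => by simp [hf, two_mul])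
      (funext fun i => by simp [hg, two_mul])⟩
  split_ifs with hM
  · obtain ⟨m, rfl⟩ := hM
    rw [N_eq_card_reps, Int.mul_ediv_cancel_left _ (by norm_num), patternCount]
    symm
    refine Finset.card_bij (fun p _ => (fun i => 2 * p.1 i, fun j => 2 * p.2 j)) ?_ ?_ ?_
    · intro p hp
      rw [mem_reps] at hp
      simp [hdouble, hp, oddSupport_eq_empty]
    · intro p _ q _ h
      rw [Prod.mk.injEq] at h
      refine Prod.ext (funext fun i => ?_) (funext fun i => ?_)
      · have := congrFun h.1 i
        simpa using this
      · have := congrFun h.2 i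
        simpa using this
    · intro p hp
      rw [Finset.mem_filter, mem_reps] at hp
      obtain ⟨q, rfl⟩ := hex p hp.2.1 hp.2.2
      refine ⟨q, ?_, rfl⟩
      rw [mem_reps]
      have := hp.1
      rw [hdouble] at this
      omega
  · rw [patternCount, Finset.card_eq_zero, Finset.filter_eq_empty_iff]
    rintro p hp ⟨h1, h2⟩
    obtain ⟨q, rfl⟩ := hex p h1 h2
    rw [mem_reps, hdouble] at hp
    exact hM ⟨_, hp.symm⟩

lemma sum_sq_modEq_card_oddSupport {a : ℕ} (x : Fin a → ℤ) :
    (4 : ℤ) ∣ ∑ i, x i ^ 2 - (oddSupport x).card := by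
  have : ((oddSupport x).card : ℤ) = ∑ i, if Odd (x i) then 1 else 0 := by
    rw [Finset.sum_boole]
    rfl
  rw [this, ← Finset.sum_sub_distrib]
  refine Finset.dvd_sum fun i _ => ?_
  split_ifs with h
  · obtain ⟨k, hk⟩ := h
    exact ⟨k ^ 2 + k, by rw [hk]; ring⟩
  · obtain ⟨k, hk⟩ := Int.not_odd_iff_even.1 h
    exact ⟨k ^ 2, by rw [hk]; ring⟩

lemma patternCount_eq_zero {a b : ℕ} {P : Finset (Fin a)} {R : Finset (Fin b)} {M : ℤ}
    (hM : (4 : ℤ) ∣ M) (h : ¬ 4 ∣ P.card + 3 * R.card) : patternCount P R M = 0 := by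
  rw [patternCount, Finset.card_eq_zero, Finset.filter_eq_empty_iff]
  rintro p hp ⟨rfl, rfl⟩
  rw [mem_reps, sqForm] at hp
  have h1 := sum_sq_modEq_card_oddSupport p.1
  have h2 := sum_sq_modEq_card_oddSupport p.2
  omega

/-- The pairs of coordinate sets that can be the odd coordinates of a representation of a
multiple of four. -/
noncomputable def admissible (a b : ℕ) : Finset (Finset (Fin a) × Finset (Fin b)) :=
  Finset.univ.filter fun S => 4 ∣ S.1.card + 3 * S.2.card

lemma two_mul_Ntilde_sub {a b : ℕ} (ha : 0 < a) (hmod : 4 ∣ a + 3 * b) {M : ℤ}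
    (hM : (4 : ℤ) ∣ M) :
    2 * (Ntilde a b M : ℝ) - (admissible a b).card * Nstar a b M =
      ∑ S ∈ ((admissible a b).erase (∅, ∅)).erase (Finset.univ, Finset.univ),
        (2 * (patternCount S.1 S.2 M : ℝ) - Nstar a b M) := by
  classical
  have h0 : ((∅, ∅) : Finset (Fin a) × Finset (Fin b)) ∈ admissible a b := by simp [admissible]
  have hne : ((Finset.univ, Finset.univ) : Finset (Fin a) × Finset (Fin b)) ≠ (∅, ∅) := by
    intro h
    rw [Prod.mk.injEq, Finset.univ_eq_empty_iff] at h
    exact h.1.false ⟨0, ha⟩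
  have h1 : ((Finset.univ, Finset.univ) : Finset (Fin a) × Finset (Fin b)) ∈
      (admissible a b).erase (∅, ∅) := by
    rw [Finset.mem_erase]
    exact ⟨hne, by simpa [admissible] using hmod⟩
  have hN : (N a b M : ℝ) = ∑ S ∈ admissible a b, (patternCount S.1 S.2 M : ℝ) := by
    rw [N_eq_card_reps, card_reps_eq_sum_patternCount, admissible, Finset.sum_filter]
    push_cast
    refine Finset.sum_congr rfl fun S _ => ?_
    split_ifs with h
    · rfl
    · rw [patternCount_eq_zero hM h, Nat.cast_zero]
  have hT : (Ntilde a b M : ℝ) = ∑ S ∈ (admissible a b).erase (∅, ∅),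
      (patternCount S.1 S.2 M : ℝ) := by
    rw [Ntilde]
    rw [if_pos hM]
    push_cast
    have := patternCount_empty a b M
    rw [if_pos hM] at this
    rw [hN, ← this, ← Finset.add_sum_erase _ _ h0]
    ring
  have hc : ((((admissible a b).erase (∅, ∅)).erase (Finset.univ, Finset.univ)).card : ℝ) + 2 =
      (admissible a b).card := by
    have e1 := Finset.card_erase_add_one h1
    have e2 := Finset.card_erase_add_one h0
    rw [← e2, ← e1]
    push_cast
    ring
  rw [hT, Finset.sum_sub_distrib, ← Finset.add_sum_erase _ _ h1, ← Finset.mul_sum,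
    Finset.sum_const, nsmul_eq_mul, ← hc, ← Nstar_eq_patternCount]
  ring

lemma card_admissible {a b : ℕ} (ha : 0 < a) (hpar : Even (a + b)) (hge : 2 ≤ a + b) :
    ((admissible a b).card : ℝ) = (2 : ℝ) ^ (a + b - 2) +
        (-1 : ℝ) ^ b * 2 ^ ((a + b - 2) / 2) * Real.cos (Real.pi * (a + 3 * b) / 4) := by
  have hgen : ∀ ω ω' : ℂ, ∑ S : Finset (Fin a) × Finset (Fin b), ω ^ S.1.card * ω' ^ S.2.card =
      (1 + ω) ^ a * (1 + ω') ^ b := fun ω ω' => by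
    have h : ∀ (n : ℕ) (z : ℂ), ∑ P : Finset (Fin n), z ^ P.card = (1 + z) ^ n := fun n z => by
      have := Fintype.sum_pow_mul_eq_add_pow (Fin n) z 1
      simpa [add_comm] using this
    rw [← h, ← h, Fintype.sum_prod_type, Finset.sum_mul_sum]
  have hfour : ∀ k : ℕ, (1 : ℂ) + Complex.I ^ k + (-1) ^ k + (-Complex.I) ^ k =
      if 4 ∣ k then 4 else 0 := fun k => by
    have hk := Nat.div_add_mod k 4
    have hlt := Nat.mod_lt k (show 4 > 0 by norm_num)
    have hI3 : Complex.I ^ 3 = -Complex.I := by rw [pow_succ, Complex.I_sq]; ring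
    have hnI3 : (-Complex.I) ^ 3 = Complex.I := by rw [Odd.neg_pow (by decide), hI3]; ring
    rw [← hk]
    simp only [pow_add, pow_mul, Complex.I_pow_four, show (-Complex.I) ^ 4 = 1 by
      rw [Even.neg_pow (by decide), Complex.I_pow_four], show (-1 : ℂ) ^ 4 = 1 by norm_num,
      one_pow, one_mul]
    interval_cases k % 4
    · norm_num
    · rw [if_neg (by omega)]; ring
    · rw [if_neg (by omega), neg_sq Complex.I, Complex.I_sq]; ring
    · rw [if_neg (by omega), hI3, hnI3]; ring
  have hsum : (4 : ℂ) * (admissible a b).card =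
      2 ^ a * 2 ^ b + (1 + Complex.I) ^ a * (1 - Complex.I) ^ b +
      (1 - Complex.I) ^ a * (1 + Complex.I) ^ b := by
    have h1 : (4 : ℂ) * (admissible a b).card =
        ∑ S : Finset (Fin a) × Finset (Fin b), ((1 : ℂ) ^ S.1.card * 1 ^ S.2.card +
          Complex.I ^ S.1.card * (-Complex.I) ^ S.2.card + (-1) ^ S.1.card * (-1) ^ S.2.card +
          (-Complex.I) ^ S.1.card * Complex.I ^ S.2.card) := by
      rw [admissible, Finset.card_filter]
      push_cast
      rw [Finset.mul_sum]
      refine Finset.sum_congr rfl fun S _ => ?_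
      have := hfour (S.1.card + 3 * S.2.card)
      rw [mul_ite, mul_one, mul_zero, ← this, pow_add, pow_add, pow_add, pow_mul, pow_mul, pow_mul]
      have hI3 : Complex.I ^ 3 = -Complex.I := by rw [pow_succ, Complex.I_sq]; ring
      have hnI3 : (-Complex.I) ^ 3 = Complex.I := by rw [Odd.neg_pow (by decide), hI3]; ring
      rw [hI3, hnI3]
      norm_num
    rw [h1]
    simp only [Finset.sum_add_distrib, hgen]
    rw [add_neg_cancel, zero_pow ha.ne', ← sub_eq_add_neg]
    norm_num
  obtain ⟨h, hh⟩ := hpar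
  have hpolar : ∀ σ : ℝ, σ ^ 2 = 1 → (1 + σ * Complex.I) ^ a * (1 - σ * Complex.I) ^ b =
      2 ^ h * Complex.exp (σ * (Real.pi * (a - b) / 4 : ℝ) * Complex.I) := by
    intro σ hσ
    have hs2 : (Real.sqrt 2 : ℂ) ^ 2 = 2 := by
      rw [← Complex.ofReal_pow, Real.sq_sqrt (by norm_num)]; norm_num
    have hbase : ∀ ε : ℝ, ε ^ 2 = 1 → (1 + ε * Complex.I : ℂ) =
        Real.sqrt 2 * Complex.exp (ε * (Real.pi / 4) * Complex.I) := by
      intro ε hε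
      have hcs : Complex.exp (ε * (Real.pi / 4) * Complex.I) =
          Real.sqrt 2 / 2 * (1 + ε * Complex.I) := by
        rw [show (ε * (Real.pi / 4) : ℂ) = ((ε * (Real.pi / 4) : ℝ) : ℂ) by push_cast; ring,
          Complex.exp_mul_I, ← Complex.ofReal_cos, ← Complex.ofReal_sin]
        rcases sq_eq_one_iff.1 hε with rfl | rfl
        · rw [one_mul, Real.cos_pi_div_four, Real.sin_pi_div_four]; push_cast; ring
        · rw [neg_one_mul, Real.cos_neg, Real.sin_neg, Real.cos_pi_div_four,
            Real.sin_pi_div_four]; push_cast; ring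
      rw [hcs]
      linear_combination -(1 + ε * Complex.I) / 2 * hs2
    have h2 := hbase (-σ) (by rw [neg_sq, hσ])
    rw [show (1 + ((-σ : ℝ) : ℂ) * Complex.I) = 1 - σ * Complex.I by push_cast; ring] at h2
    rw [hbase σ hσ, h2, mul_pow, mul_pow, ← Complex.exp_nat_mul, ← Complex.exp_nat_mul,
      mul_mul_mul_comm, ← pow_add, hh, ← two_mul, pow_mul, hs2, ← Complex.exp_add]
    congr 2
    push_cast
    ring
  have hcos : (-1 : ℝ) ^ b * Real.cos (Real.pi * (a + 3 * b) / 4) =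
      Real.cos (Real.pi * (a - b) / 4) := by
    rw [show Real.pi * (a - b) / 4 = Real.pi * (a + 3 * b) / 4 - b * Real.pi by ring,
      Real.cos_sub_nat_mul_pi]
  have hp := hpolar 1 (by norm_num)
  have hm := hpolar (-1) (by norm_num)
  push_cast at hp hm
  rw [one_mul] at hp
  rw [show (1 + -1 * Complex.I : ℂ) = 1 - Complex.I by ring,
    show (1 - -1 * Complex.I : ℂ) = 1 + Complex.I by ring] at hm
  rw [one_mul] at hp
  rw [hp, hm] at hsum
  have hcx : Complex.exp ((Real.pi * (a - b) / 4 : ℂ) * Complex.I) +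
      Complex.exp (-1 * (Real.pi * (a - b) / 4 : ℂ) * Complex.I) =
      2 * (Real.cos (Real.pi * (a - b) / 4) : ℝ) := by
    push_cast
    rw [Complex.two_cos]
    congr 2
    ring
  have hreal : (4 : ℝ) * (admissible a b).card =
      2 ^ a * 2 ^ b + 2 ^ h * (2 * Real.cos (Real.pi * (a - b) / 4)) := by
    have : (4 : ℂ) * (admissible a b).card =
      2 ^ a * 2 ^ b + 2 ^ h * (2 * (Real.cos (Real.pi * (a - b) / 4) : ℝ)) := by
      rw [hsum, ← hcx]; ring
    exact_mod_cast this
  obtain ⟨g, rfl⟩ : ∃ g, h = g + 1 := ⟨h - 1, by omega⟩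
  rw [← pow_add, hh] at hreal
  rw [mul_right_comm, hcos, hh, show g + 1 + (g + 1) - 2 = 2 * g by omega,
    Nat.mul_div_cancel_left _ (by norm_num : 0 < 2)]
  have e1 : (2 : ℝ) ^ (g + 1 + (g + 1)) = 4 * 2 ^ (2 * g) := by ring
  rw [e1, pow_succ] at hreal
  linarith

lemma card_of_mem_admissible {a b : ℕ} (hmod : 4 ∣ a + 3 * b)
    {S : Finset (Fin a) × Finset (Fin b)}
    (hS : S ∈ ((admissible a b).erase (∅, ∅)).erase (Finset.univ, Finset.univ)) :
    (∃ L, (a - S.1.card) + 3 * (b - S.2.card) = 4 * L) ∧ 1 ≤ S.1.card + S.2.card ∧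
      1 ≤ (a - S.1.card) + (b - S.2.card) ∧ S.1.card ≤ a ∧ S.2.card ≤ b ∧
      4 ∣ S.1.card + 3 * S.2.card := by
  simp only [Finset.mem_erase, admissible, Finset.mem_filter, Finset.mem_univ, true_and] at hS
  obtain ⟨hne, hne', h4⟩ := hS
  have hP := Finset.card_le_univ S.1
  have hR := Finset.card_le_univ S.2
  rw [Fintype.card_fin] at hP hR
  refine ⟨⟨((a - S.1.card) + 3 * (b - S.2.card)) / 4, by omega⟩, ?_, ?_, hP, hR, h4⟩
  · by_contra hlt
    exact hne' (Prod.ext (Finset.card_eq_zero.1 (by omega)) (Finset.card_eq_zero.1 (by omega)))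
  · by_contra hlt
    refine hne (Prod.ext ?_ ?_)
    · exact (Finset.card_eq_iff_eq_univ _).1 (by rw [Fintype.card_fin]; omega)
    · exact (Finset.card_eq_iff_eq_univ _).1 (by rw [Fintype.card_fin]; omega)

/-- The number of representations in odd integers approximates half the number of primitive
representations, weighted by the number of admissible patterns. -/
lemma exists_abs_two_mul_Ntilde_sub_le {a b : ℕ} (ha : 0 < a) (hmod : 4 ∣ a + 3 * b) :
    ∃ C : ℝ, ∀ M : ℤ, 0 < M → (8 : ℤ) ∣ M - (a + 3 * b) →
      |2 * (Ntilde a b M : ℝ) - (admissible a b).card * Nstar a b M| ≤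
        C * ((M : ℝ) ^ (1 / 4 : ℝ)) ^ (a + b) := by
  have hterm : ∀ S : Finset (Fin a) × Finset (Fin b), ∃ C : ℝ,
      S ∈ ((admissible a b).erase (∅, ∅)).erase (Finset.univ, Finset.univ) →
      ∀ M : ℤ, 0 < M → (8 : ℤ) ∣ M - (a + 3 * b) →
      |2 * (patternCount S.1 S.2 M : ℝ) - Nstar a b M| ≤
        C * ((M : ℝ) ^ (1 / 4 : ℝ)) ^ (a + b) := by
    intro S
    by_cases hS : S ∈ ((admissible a b).erase (∅, ∅)).erase (Finset.univ, Finset.univ)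
    swap
    · exact ⟨0, fun h => absurd h hS⟩
    obtain ⟨⟨L, hL⟩, h1, h2, hP, hR, -⟩ := card_of_mem_admissible hmod hS
    obtain ⟨C, hC⟩ := norm_thetaBracket_le hL h1 h2
    refine ⟨C * Real.exp (Real.pi / 4), fun _ M hM h8 => ?_⟩
    have hMr : (0 : ℝ) < M := by exact_mod_cast hM
    have hy : (0 : ℝ) < 1 / M := by positivity
    have hpow : 0 < (M : ℝ) ^ (1 / 4 : ℝ) := Real.rpow_pos_of_pos hMr _
    have key := norm_patternCount_sub_le hL h8 hy
      (B := C * ((M : ℝ) ^ (1 / 4 : ℝ)) ^ (a + b)) (fun τ hτ => by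
        have := hC ⟨τ, by rw [hτ]; exact hy⟩
        change (τ.im ^ (1 / 4 : ℝ)) ^ _ * ‖thetaBracket _ _ _ _ _ τ‖ ≤ C at this
        rw [show S.1.card + S.2.card + (a - S.1.card) + (b - S.2.card) = a + b by omega, hτ,
          one_div (M : ℝ), Real.inv_rpow hMr.le, inv_pow, inv_mul_le_iff₀ (by positivity)] at this
        linarith)
    rw [← Nstar_eq_patternCount] at key
    refine key.trans (le_of_eq ?_)
    rw [mul_one_div, mul_div_assoc, div_self hMr.ne', mul_one]
    ring
  choose C hC using hterm
  refine ⟨∑ S ∈ ((admissible a b).erase (∅, ∅)).erase (Finset.univ, Finset.univ), C S,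
    fun M hM h8 => ?_⟩
  rw [two_mul_Ntilde_sub ha hmod (by omega), Finset.sum_mul]
  exact (Finset.abs_sum_le_sum_abs _ _).trans (Finset.sum_le_sum fun S hS => hC S hS M hM h8)

lemma two_mul_Ntilde_of_four {a b : ℕ} (ha : 1 < a) (hmod : 4 ∣ a + 3 * b) (hab : a + b = 4)
    {M : ℤ} (h8 : (8 : ℤ) ∣ M - (a + 3 * b)) :
    2 * (Ntilde a b M : ℝ) = (admissible a b).card * Nstar a b M := by
  rw [← sub_eq_zero, two_mul_Ntilde_sub (by omega) hmod (by omega)]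
  refine Finset.sum_eq_zero fun S hS => ?_
  obtain ⟨⟨L, hL⟩, h1, h2, hP, hR, h4⟩ := card_of_mem_admissible hmod hS
  have hP1 : S.1.card = 1 := by omega
  have hR1 : S.2.card = 1 := by omega
  have hm : a - S.1.card = 1 := by omega
  have hn : b - S.2.card = 1 := by omega
  have key := norm_patternCount_sub_le hL h8 one_pos (B := 0) (fun τ hτ => by
    have hmod := theta_modular_equation (τ := τ) (by rw [hτ]; exact one_pos)
    rw [hm, hn, hP1, hR1, show L = 1 by omega, thetaBracket]
    simp only [pow_one, hmod]
    rw [show ∀ u v w : ℂ, u * (v + w + -1 * w - v) = 0 from fun u v w => by ring, norm_zero])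
  rw [zero_mul, ← Nstar_eq_patternCount] at key
  exact abs_eq_zero.1 (le_antisymm key (abs_nonneg _))

/-- The elements of norm `u` in `ℤ[√-D]`, as a finite set when `D > 0`. -/
noncomputable def normReps (D u : ℕ) : Finset (ℤ√(-(D : ℤ))) :=
  ((Finset.Icc (-(u : ℤ)) u ×ˢ Finset.Icc (-(u : ℤ)) u).image
    fun p => (⟨p.1, p.2⟩ : ℤ√(-(D : ℤ)))).filter fun α => α.norm = u

lemma Zsqrtd.norm_neg_natCast {D : ℕ} (α : ℤ√(-(D : ℤ))) :
    α.norm = α.re ^ 2 + D * α.im ^ 2 := by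
  rw [Zsqrtd.norm_def]
  ring

lemma mem_normReps {D u : ℕ} (hD : 0 < D) {α : ℤ√(-(D : ℤ))} :
    α ∈ normReps D u ↔ α.norm = u := by
  simp only [normReps, Finset.mem_filter, Finset.mem_image, Finset.mem_product, Finset.mem_Icc,
    and_iff_right_iff_imp]
  intro h
  refine ⟨(α.re, α.im), ?_, rfl⟩
  rw [Zsqrtd.norm_neg_natCast] at h
  have hD' : (1 : ℤ) ≤ D := by exact_mod_cast hD
  have h1 : α.re ^ 2 ≤ u := by nlinarith [sq_nonneg α.im]
  have h2 : α.im ^ 2 ≤ u := by nlinarith [sq_nonneg α.im, sq_nonneg α.re]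
  have key : ∀ z : ℤ, z ^ 2 ≤ u → -(u : ℤ) ≤ z ∧ z ≤ u := by
    intro z hz
    constructor <;> nlinarith [sq_nonneg (z - 1), sq_nonneg (z + 1)]
  exact ⟨key _ h1, key _ h2⟩

lemma Zsqrtd.mul_left_cancel_of_norm {d : ℤ} {x y z : ℤ√d} (hx : x.norm ≠ 0) (h : x * y = x * z) :
    y = z := by
  refine Zsqrtd.eq_of_smul_eq_smul_left hx ?_
  rw [Zsqrtd.norm_eq_mul_conj, mul_comm x, mul_assoc, mul_assoc, h]

lemma Zsqrtd.norm_pow {d : ℤ} (x : ℤ√d) (k : ℕ) : (x ^ k).norm = x.norm ^ k :=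
  map_pow Zsqrtd.normMonoidHom x k

lemma Zsqrtd.prime_not_dvd_pow {d : ℤ} {p : ℕ} (hp : p.Prime) {π : ℤ√d} (hπ : π.norm = p)
    (hre : ¬ (p : ℤ) ∣ 2 * π.re) (k : ℕ) : ¬ ((p : ℤ) : ℤ√d) ∣ π ^ (k + 1) := by
  have hpp : Prime (p : ℤ) := Nat.prime_iff_prime_int.mp hp
  have hsq : π ^ 2 = ((2 * π.re : ℤ) : ℤ√d) * π - ((p : ℤ) : ℤ√d) := by
    rw [← hπ]
    ext <;> simp [sq, Zsqrtd.norm_def] <;> ring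
  have hk : ∀ k : ℕ, ((p : ℤ) : ℤ√d) ∣ π ^ (k + 1) - (((2 * π.re) ^ k : ℤ) : ℤ√d) * π := by
    intro k
    induction k with
    | zero => simp
    | succ k ih =>
      obtain ⟨c, hc⟩ := ih
      refine ⟨π * c - (((2 * π.re) ^ k : ℤ) : ℤ√d), ?_⟩
      have e1 : π ^ (k + 1 + 1) = π * (π ^ (k + 1) - (((2 * π.re) ^ k : ℤ) : ℤ√d) * π)
          + (((2 * π.re) ^ k : ℤ) : ℤ√d) * π ^ 2 := by ring
      rw [e1, hc, hsq]
      push_cast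
      ring
  intro h
  have h1 := (dvd_sub_right h).mp (hk k)
  rw [Zsqrtd.intCast_dvd] at h1
  have h2 := h1.1
  rw [Zsqrtd.re_smul] at h2
  rcases hpp.dvd_or_dvd h2 with h3 | h3
  · exact hre (hpp.dvd_of_dvd_pow h3)
  · exact hre (h3.mul_left 2)

lemma card_normReps_split {D p w : ℕ} (hD : 0 < D) (hp : p.Prime) (hpw : ¬ p ∣ w)
    {π : ℤ√(-(D : ℤ))} (hπ : π.norm = p) (hre : ¬ (p : ℤ) ∣ 2 * π.re) (e : ℕ) :
    (e + 1) * (normReps D w).card ≤ (normReps D (p ^ e * w)).card := by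
  have hpp : Prime (p : ℤ) := Nat.prime_iff_prime_int.mp hp
  have hp0 : (p : ℤ) ≠ 0 := hpp.ne_zero
  have hπs : (star π).norm = p := by rw [Zsqrtd.norm_conj, hπ]
  rw [show e + 1 = (Finset.range (e + 1)).card by simp, ← Finset.card_product]
  refine Finset.card_le_card_of_injOn (fun x => π ^ x.1 * star π ^ (e - x.1) * x.2) ?_ ?_
  · rintro ⟨i, α⟩ hx
    simp only [Finset.coe_product, Set.mem_prod, Finset.mem_coe, Finset.mem_range,
      mem_normReps hD] at hx ⊢
    rw [Zsqrtd.norm_mul, Zsqrtd.norm_mul, Zsqrtd.norm_pow, Zsqrtd.norm_pow, hπ, hπs, hx.2,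
      ← pow_add, show i + (e - i) = e by omega]
    push_cast
    rfl
  · have main : ∀ i j : ℕ, ∀ α β : ℤ√(-(D : ℤ)), i < j → j ≤ e → β.norm = w →
        π ^ i * star π ^ (e - i) * α = π ^ j * star π ^ (e - j) * β → False := by
      intro i j α β hij hje hβ h
      obtain ⟨k, rfl⟩ : ∃ k, j = i + (k + 1) := ⟨j - i - 1, by omega⟩
      have e1 : star π ^ (e - i) = star π ^ (e - (i + (k + 1))) * star π ^ (k + 1) := by
        rw [← pow_add]
        congr 1
        omega
      have e2 : (π ^ i * star π ^ (e - (i + (k + 1)))) * (star π ^ (k + 1) * α) =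
          (π ^ i * star π ^ (e - (i + (k + 1)))) * (π ^ (k + 1) * β) := by
        rw [e1, pow_add π i (k + 1)] at h
        linear_combination h
      have e3 := Zsqrtd.mul_left_cancel_of_norm (by
        rw [Zsqrtd.norm_mul, Zsqrtd.norm_pow, Zsqrtd.norm_pow, hπ, hπs]
        positivity) e2
      have e4 : π ^ (k + 1 + 1) * ((w : ℤ) : ℤ√(-(D : ℤ))) =
          ((p : ℤ) : ℤ√(-(D : ℤ))) * (star π ^ k * α * star β) := by
        rw [← hβ, ← hπ, Zsqrtd.norm_eq_mul_conj, Zsqrtd.norm_eq_mul_conj]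
        linear_combination (-π * star β) * e3
      have hd : ((p : ℤ) : ℤ√(-(D : ℤ))) ∣ π ^ (k + 1 + 1) := by
        have h5 : ((p : ℤ) : ℤ√(-(D : ℤ))) ∣ π ^ (k + 1 + 1) * ((w : ℤ) : ℤ√(-(D : ℤ))) := ⟨_, e4⟩
        rw [mul_comm, Zsqrtd.intCast_dvd, Zsqrtd.re_smul, Zsqrtd.im_smul] at h5
        have hw : ¬ (p : ℤ) ∣ (w : ℤ) := by exact_mod_cast hpw
        rw [Zsqrtd.intCast_dvd]
        exact ⟨(hpp.dvd_or_dvd h5.1).resolve_left hw, (hpp.dvd_or_dvd h5.2).resolve_left hw⟩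
      exact Zsqrtd.prime_not_dvd_pow hp hπ hre _ hd
    rintro ⟨i, α⟩ hx ⟨j, β⟩ hy h
    simp only [Finset.coe_product, Set.mem_prod, Finset.mem_coe, Finset.mem_range,
      mem_normReps hD] at hx hy h
    rcases lt_trichotomy i j with hij | rfl | hij
    · exact (main i j α β hij (by omega) hy.2 h).elim
    · rw [Zsqrtd.mul_left_cancel_of_norm (by
        rw [Zsqrtd.norm_mul, Zsqrtd.norm_pow, Zsqrtd.norm_pow, hπ, hπs]
        positivity) h]
    · exact (main j i β α hij (by omega) hx.2 h.symm).elim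

lemma card_normReps_le_mul {D w v : ℕ} (hD : 0 < D) {γ : ℤ√(-(D : ℤ))} (hγ : γ.norm = v)
    (hv : v ≠ 0) : (normReps D w).card ≤ (normReps D (v * w)).card := by
  refine Finset.card_le_card_of_injOn (fun α => γ * α) ?_ ?_
  · intro α hα
    simp only [Finset.mem_coe, mem_normReps hD] at hα ⊢
    rw [Zsqrtd.norm_mul, hα, hγ]
    push_cast
    rfl
  · intro α _ β _ h
    exact Zsqrtd.mul_left_cancel_of_norm (by rw [hγ]; exact_mod_cast hv) h

lemma sum_divisors_prime_pow_mul (χ : ℕ →* ℤ) {p w : ℕ} (hp : p.Prime) (hpw : ¬ p ∣ w) (e : ℕ) :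
    ∑ d ∈ (p ^ e * w).divisors, χ d =
      (∑ i ∈ Finset.range (e + 1), χ p ^ i) * ∑ d ∈ w.divisors, χ d := by
  have hc : (p ^ e).Coprime w := Nat.Coprime.pow_left e ((Nat.Prime.coprime_iff_not_dvd hp).mpr hpw)
  rw [Nat.divisors_mul, Finset.mul_def, Finset.sum_image hc.mul_injOn_divisors,
    Finset.sum_product, Nat.divisors_prime_pow hp, Finset.sum_map, Finset.sum_mul]
  refine Finset.sum_congr rfl fun i _ => ?_
  rw [Finset.mul_sum]
  simp

/-- If every odd prime is either split, inert or equal to `D` according to the character `χ`, then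
the divisor sum of `χ` is nonnegative and bounds from below the number of elements of odd norm
`u`. -/
theorem sum_divisors_le_card_normReps {D : ℕ} (hD : 0 < D) (χ : ℕ →* ℤ)
    (hχ : ∀ p : ℕ, p.Prime → p ≠ 2 →
      (χ p = 1 ∧ ∃ π : ℤ√(-(D : ℤ)), π.norm = p ∧ ¬ (p : ℤ) ∣ 2 * π.re) ∨ χ p = -1 ∨
        (χ p = 0 ∧ p = D)) (u : ℕ) (hu : Odd u) :
    0 ≤ ∑ d ∈ u.divisors, χ d ∧ ∑ d ∈ u.divisors, χ d ≤ (normReps D u).card := by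
  induction u using Nat.strong_induction_on with
  | _ u ih =>
  rcases eq_or_ne u 1 with rfl | hu1
  · simp only [Nat.divisors_one, Finset.sum_singleton, map_one, zero_le_one, true_and,
      Nat.one_le_cast, Finset.one_le_card]
    exact ⟨1, by simp [mem_normReps hD]⟩
  have hu0 : u ≠ 0 := by rintro rfl; simp at hu
  obtain ⟨p, hp, hpu⟩ := Nat.exists_prime_and_dvd hu1
  obtain ⟨e, w, hpw, rfl⟩ := Nat.exists_eq_pow_mul_and_not_dvd hu0 p hp.ne_one
  have hw0 : 0 < w := Nat.pos_of_ne_zero (by rintro rfl; simp at hpw)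
  have he : e ≠ 0 := by rintro rfl; simp at hpu; exact hpw hpu
  have hp2 : p ≠ 2 := by
    rintro rfl
    exact (Nat.not_even_iff_odd.mpr hu) (((even_two).pow_of_ne_zero he).mul_right w)
  have hlt : w < p ^ e * w := by
    have := Nat.one_lt_pow he hp.one_lt
    nlinarith
  obtain ⟨ih0, ih1⟩ := ih w hlt (Nat.Odd.of_mul_right hu)
  rw [sum_divisors_prime_pow_mul χ hp hpw]
  rcases hχ p hp hp2 with ⟨h, π, hπ, hre⟩ | h | ⟨h, hpD⟩
  · rw [h]
    simp only [one_pow, Finset.sum_const, Finset.card_range, nsmul_eq_mul, mul_one]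
    refine ⟨by positivity, ?_⟩
    have := card_normReps_split hD hp hpw hπ hre e
    calc ((e + 1 : ℕ) : ℤ) * ∑ d ∈ w.divisors, χ d
        ≤ ((e + 1 : ℕ) : ℤ) * (normReps D w).card := by gcongr
      _ ≤ _ := by exact_mod_cast this
  · rw [h, neg_one_geom_sum]
    split_ifs with hev
    · simp
    · refine ⟨by simpa using ih0, ?_⟩
      rw [one_mul]
      refine ih1.trans ?_
      have hev' : Even e := by
        rw [← Nat.not_odd_iff_even]
        exact fun h => hev (h.add_one)
      obtain ⟨k, rfl⟩ := hev'
      exact_mod_cast card_normReps_le_mul hD (γ := ((p ^ k : ℕ) : ℤ√(-(D : ℤ))))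
        (v := p ^ (k + k)) (by rw [Zsqrtd.norm_natCast, pow_add]; push_cast; rfl)
        (pow_ne_zero _ hp.ne_zero)
  · rw [h]
    have h1 : ∑ i ∈ Finset.range (e + 1), (0 : ℤ) ^ i = 1 := by
      rw [Finset.sum_range_succ']
      simp
    rw [h1, one_mul]
    refine ⟨ih0, ih1.trans ?_⟩
    exact_mod_cast card_normReps_le_mul hD (γ := Zsqrtd.sqrtd ^ e) (v := p ^ e)
      (by rw [Zsqrtd.norm_pow, hpD]; simp [Zsqrtd.norm_def]) (pow_ne_zero _ hp.ne_zero)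

lemma not_dvd_two_mul_re {D p : ℕ} (hp : p.Prime) (hp2 : p ≠ 2) (hpD : ¬ p ∣ D)
    {π : ℤ√(-(D : ℤ))} (hπ : π.norm = p) : ¬ (p : ℤ) ∣ 2 * π.re := by
  have hpp : Prime (p : ℤ) := Nat.prime_iff_prime_int.mp hp
  intro h
  have h2 : (p : ℤ) ∣ π.re := by
    refine (hpp.dvd_or_dvd h).resolve_left fun h2 => hp2 ?_
    exact (Nat.prime_dvd_prime_iff_eq hp Nat.prime_two).mp (by exact_mod_cast h2)
  rw [Zsqrtd.norm_neg_natCast] at hπ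
  have h3 : (p : ℤ) ∣ D * π.im ^ 2 := by
    rw [show (D : ℤ) * π.im ^ 2 = p - π.re * π.re by linarith]
    exact dvd_sub dvd_rfl (h2.mul_left _)
  have h4 : (p : ℤ) ∣ π.im :=
    hpp.dvd_of_dvd_pow ((hpp.dvd_or_dvd h3).resolve_left (by exact_mod_cast hpD))
  obtain ⟨x, hx⟩ := h2
  obtain ⟨y, hy⟩ := h4
  rw [hx, hy] at hπ
  have h5 : (p : ℤ) * (p * (x ^ 2 + D * y ^ 2)) = p * 1 := by linarith
  have h6 := mul_left_cancel₀ hpp.ne_zero h5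
  exact hpp.not_isUnit (IsUnit.of_mul_eq_one _ h6)

lemma exists_sq_add_three_eq_zero {p : ℕ} [Fact p.Prime] (hp : p % 3 = 1) :
    ∃ t : ZMod p, t ^ 2 + 3 = 0 := by
  have hp1 : 1 < p := (Fact.out : p.Prime).one_lt
  have hcard : 3 ∣ Fintype.card (ZMod p)ˣ := by
    rw [ZMod.card_units]
    omega
  have : Fact (Nat.Prime 3) := ⟨Nat.prime_three⟩
  obtain ⟨g, hg⟩ := exists_prime_orderOf_dvd_card 3 hcard
  have h3 : (g : ZMod p) ^ 3 = 1 := by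
    rw [← Units.val_pow_eq_pow_val, ← hg, pow_orderOf_eq_one, Units.val_one]
  have h1 : (g : ZMod p) - 1 ≠ 0 := by
    intro h
    have : g = 1 := Units.ext (by simpa using sub_eq_zero.mp h)
    rw [this, orderOf_one] at hg
    omega
  have h2 : (g : ZMod p) ^ 2 + g + 1 = 0 := by
    refine (mul_eq_zero.mp ?_).resolve_left h1
    linear_combination h3
  exact ⟨2 * g + 1, by linear_combination 4 * h2⟩

/-- Thue's lemma. -/
lemma exists_small_mul_eq {p : ℕ} [hp : Fact p.Prime] (t : ZMod p) :
    ∃ x y : ℤ, (x, y) ≠ 0 ∧ x ^ 2 < p ∧ y ^ 2 < p ∧ (x : ZMod p) = t * y := by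
  classical
  set k := Nat.sqrt p with hk
  have hk1 : p < (k + 1) ^ 2 := by
    have := Nat.lt_succ_sqrt p
    rw [sq]
    exact this
  have hk2 : k ^ 2 < p := by
    have h1 : k * k ≤ p := Nat.sqrt_le p
    rcases h1.lt_or_eq with h | h
    · rw [sq]; exact h
    · exact absurd hp.out (h ▸ Nat.not_prime_mul (a := k) (b := k) (by rintro h1; rw [h1] at h; exact hp.out.ne_one h.symm) (by rintro h1; rw [h1] at h; exact hp.out.ne_one h.symm))
  have hcard : (Finset.univ : Finset (ZMod p)).card <
      (Finset.range (k + 1) ×ˢ Finset.range (k + 1)).card := by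
    rw [Finset.card_univ, ZMod.card, Finset.card_product, Finset.card_range, ← sq]
    exact hk1
  obtain ⟨⟨a, b⟩, hab, ⟨c, d⟩, hcd, hne, h⟩ :=
    Finset.exists_ne_map_eq_of_card_lt_of_maps_to hcard
      (f := fun x : ℕ × ℕ => ((x.1 : ZMod p) - t * x.2)) (fun _ _ => Finset.mem_coe.mpr (Finset.mem_univ _))
  simp only [Finset.mem_product, Finset.mem_range, Nat.lt_succ_iff] at hab hcd h
  have hk2' : (k : ℤ) ^ 2 < p := by exact_mod_cast hk2
  have key : ∀ a c : ℕ, a ≤ k → c ≤ k → ((a : ℤ) - c) ^ 2 < p := by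
    intro a c ha hc
    have ha' : (a : ℤ) ≤ k := by exact_mod_cast ha
    have hc' : (c : ℤ) ≤ k := by exact_mod_cast hc
    refine lt_of_le_of_lt ?_ hk2'
    exact sq_le_sq' (by linarith [a.cast_nonneg (α := ℤ)]) (by linarith [c.cast_nonneg (α := ℤ)])
  refine ⟨(a : ℤ) - c, (b : ℤ) - d, ?_, key a c hab.1 hcd.1, key b d hab.2 hcd.2, ?_⟩
  · intro h0
    apply hne
    simp only [Prod.mk_eq_zero] at h0
    ext <;> push_cast <;> omega
  · push_cast
    linear_combination h

lemma exists_norm_eq_of_mod_three {p : ℕ} (hp : p.Prime) (hp2 : p ≠ 2) (h : p % 3 = 1) :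
    ∃ π : ℤ√(-((3 : ℕ) : ℤ)), π.norm = p := by
  have : Fact p.Prime := ⟨hp⟩
  suffices ∃ x y : ℤ, x ^ 2 + 3 * y ^ 2 = p by
    obtain ⟨x, y, h⟩ := this
    exact ⟨⟨x, y⟩, by rw [Zsqrtd.norm_neg_natCast]; exact_mod_cast h⟩
  have hp4 : p % 2 = 1 := hp.eq_two_or_odd.resolve_left hp2
  obtain ⟨t, ht⟩ := exists_sq_add_three_eq_zero h
  obtain ⟨x, y, hne, hx, hy, hxy⟩ := exists_small_mul_eq t
  have hd : (p : ℤ) ∣ x ^ 2 + 3 * y ^ 2 := by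
    rw [← ZMod.intCast_zmod_eq_zero_iff_dvd]
    push_cast
    rw [hxy]
    linear_combination (y : ZMod p) ^ 2 * ht
  obtain ⟨m, hm⟩ := hd
  have hpos : 0 < x ^ 2 + 3 * y ^ 2 := by
    by_contra hcon
    have h1 : x = 0 := by nlinarith [sq_nonneg x, sq_nonneg y]
    have h2 : y = 0 := by nlinarith [sq_nonneg x, sq_nonneg y]
    exact hne (by simp [h1, h2])
  have hp0 : (0 : ℤ) < p := by exact_mod_cast hp.pos
  have hm0 : 0 < m := by nlinarith
  have hm4 : m < 4 := by nlinarith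
  interval_cases m
  · exact ⟨x, y, by linarith⟩
  · exfalso
    have hp4' : (p : ℤ) % 2 = 1 := by omega
    rcases Int.even_or_odd' x with ⟨r, rfl | rfl⟩ <;> rcases Int.even_or_odd' y with ⟨s, rfl | rfl⟩ <;>
      ring_nf at hm <;> omega
  · have h3 : (3 : ℤ) ∣ x := by
      refine Int.prime_three.dvd_of_dvd_pow (n := 2) ?_
      exact ⟨p - y ^ 2, by linarith⟩
    obtain ⟨z, rfl⟩ := h3
    exact ⟨y, z, by linarith⟩

/-- The nontrivial character modulo four, on natural numbers. -/
noncomputable def chiFour : ℕ →* ℤ :=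
  (ZMod.χ₄ : ZMod 4 →* ℤ).comp (Nat.castRingHom (ZMod 4) : ℕ →* ZMod 4)

/-- The nontrivial character modulo three, on natural numbers. -/
noncomputable def chiThree : ℕ →* ℤ :=
  (quadraticChar (ZMod 3) : ZMod 3 →* ℤ).comp (Nat.castRingHom (ZMod 3) : ℕ →* ZMod 3)

lemma chiFour_apply (n : ℕ) : chiFour n =
    if n % 2 = 0 then 0 else if n % 4 = 1 then 1 else -1 := ZMod.χ₄_nat_eq_if_mod_four n

lemma chiThree_apply (n : ℕ) : chiThree n =
    if n % 3 = 0 then 0 else if n % 3 = 1 then 1 else -1 := by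
  have h : ∀ z : ZMod 3, quadraticChar (ZMod 3) z = if z = 0 then 0 else if z = 1 then 1 else -1 := by
    decide
  have h0 : ((n : ZMod 3) = 0) ↔ n % 3 = 0 := by
    rw [ZMod.natCast_eq_zero_iff]
    omega
  have h1 : ((n : ZMod 3) = 1) ↔ n % 3 = 1 := by
    rw [← Nat.cast_one, ZMod.natCast_eq_natCast_iff]
    rfl
  have := h (n : ZMod 3)
  simp only [h0, h1] at this
  exact this

lemma sum_chiFour_bounds {u : ℕ} (hu : Odd u) : 0 ≤ ∑ d ∈ u.divisors, chiFour d ∧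
    ∑ d ∈ u.divisors, chiFour d ≤ (normReps 1 u).card := by
  refine sum_divisors_le_card_normReps one_pos chiFour (fun p hp hp2 => ?_) u hu
  have hodd : p % 2 = 1 := hp.eq_two_or_odd.resolve_left hp2
  rw [chiFour_apply, if_neg (by omega)]
  split_ifs with h
  · left
    have : Fact p.Prime := ⟨hp⟩
    obtain ⟨a, b, hab⟩ := Nat.Prime.sq_add_sq (p := p) (by omega)
    have hπ : (⟨a, b⟩ : ℤ√(-((1 : ℕ) : ℤ))).norm = p := by
      rw [Zsqrtd.norm_neg_natCast, ← hab]
      push_cast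
      ring
    exact ⟨rfl, _, hπ, not_dvd_two_mul_re hp hp2 (by simpa using hp.ne_one) hπ⟩
  · exact Or.inr (Or.inl rfl)

lemma sum_chiThree_bounds {u : ℕ} (hu : Odd u) : 0 ≤ ∑ d ∈ u.divisors, chiThree d ∧
    ∑ d ∈ u.divisors, chiThree d ≤ (normReps 3 u).card := by
  refine sum_divisors_le_card_normReps three_pos chiThree (fun p hp hp2 => ?_) u hu
  rw [chiThree_apply]
  split_ifs with h0 h1
  · exact Or.inr (Or.inr ⟨rfl, ((Nat.prime_dvd_prime_iff_eq Nat.prime_three hp).mp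
      (Nat.dvd_of_mod_eq_zero h0)).symm⟩)
  · left
    obtain ⟨π, hπ⟩ := exists_norm_eq_of_mod_three hp hp2 h1
    refine ⟨rfl, π, hπ, not_dvd_two_mul_re hp hp2 ?_ hπ⟩
    rw [Nat.prime_dvd_prime_iff_eq hp Nat.prime_three]
    rintro rfl
    simp at h1
  · exact Or.inr (Or.inl rfl)

/-- The quadruples `(d, δ, e, ε)` of odd natural numbers with `d δ + e ε = n`. -/
def oddQuads (n : ℕ) : Finset (ℕ × ℕ × ℕ × ℕ) :=
  (Finset.range (n + 1) ×ˢ Finset.range (n + 1) ×ˢ Finset.range (n + 1) ×ˢ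
    Finset.range (n + 1)).filter fun x => (Odd x.1 ∧ Odd x.2.1 ∧ Odd x.2.2.1 ∧ Odd x.2.2.2) ∧
      x.1 * x.2.1 + x.2.2.1 * x.2.2.2 = n

/-- The quadruples `(a, δ, e, c)` with `a`, `c` even and positive, `δ`, `e` odd and
`a δ + e c = n`. -/
def mixedQuads (n : ℕ) : Finset (ℕ × ℕ × ℕ × ℕ) :=
  (Finset.range (n + 1) ×ˢ Finset.range (n + 1) ×ˢ Finset.range (n + 1) ×ˢ
    Finset.range (n + 1)).filter fun x =>
      ((0 < x.1 ∧ Even x.1) ∧ Odd x.2.1 ∧ Odd x.2.2.1 ∧ (0 < x.2.2.2 ∧ Even x.2.2.2)) ∧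
      x.1 * x.2.1 + x.2.2.1 * x.2.2.2 = n

lemma le_of_mul_add_mul_eq {d δ e ε n : ℕ} (hd : 0 < d) (hδ : 0 < δ) (he : 0 < e) (hε : 0 < ε)
    (h : d * δ + e * ε = n) : d < n + 1 ∧ δ < n + 1 ∧ e < n + 1 ∧ ε < n + 1 := by
  refine ⟨?_, ?_, ?_, ?_⟩ <;> nlinarith

lemma mem_oddQuads {n d δ e ε : ℕ} : (d, δ, e, ε) ∈ oddQuads n ↔
    (Odd d ∧ Odd δ ∧ Odd e ∧ Odd ε) ∧ d * δ + e * ε = n := by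
  simp only [oddQuads, Finset.mem_filter, Finset.mem_product, Finset.mem_range,
    and_iff_right_iff_imp]
  rintro ⟨⟨h1, h2, h3, h4⟩, h⟩
  exact le_of_mul_add_mul_eq h1.pos h2.pos h3.pos h4.pos h

lemma mem_mixedQuads {n a δ e c : ℕ} : (a, δ, e, c) ∈ mixedQuads n ↔
    ((0 < a ∧ Even a) ∧ Odd δ ∧ Odd e ∧ (0 < c ∧ Even c)) ∧ a * δ + e * c = n := by
  simp only [mixedQuads, Finset.mem_filter, Finset.mem_product, Finset.mem_range,
    and_iff_right_iff_imp]
  rintro ⟨⟨h1, h2, h3, h4⟩, h⟩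
  exact le_of_mul_add_mul_eq h1.1 h2.pos h3.pos h4.1 h

lemma sum_oddQuads_lt_eq_sum_mixedQuads (F : ℕ → ℤ) (n : ℕ) :
    ∑ x ∈ (oddQuads n).filter (fun x => x.2.2.1 < x.1), F (x.1 - x.2.2.1) =
      ∑ x ∈ (mixedQuads n).filter (fun x => x.2.1 < x.2.2.2), F x.1 := by
  refine Finset.sum_nbij' (fun x => (x.1 - x.2.2.1, x.2.1, x.2.2.1, x.2.1 + x.2.2.2))
    (fun x => (x.1 + x.2.2.1, x.2.1, x.2.2.1, x.2.2.2 - x.2.1)) ?_ ?_ ?_ ?_ ?_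
  · rintro ⟨d, δ, e, ε⟩ h
    simp only [Finset.mem_filter, mem_oddQuads, mem_mixedQuads] at h ⊢
    obtain ⟨⟨⟨h1, h2, h3, h4⟩, h⟩, hlt⟩ := h
    obtain ⟨k, rfl⟩ := Nat.exists_eq_add_of_lt hlt
    refine ⟨⟨⟨⟨by omega, Nat.Odd.sub_odd h1 h3⟩, h2, h3, by have := h2.pos; omega, h2.add_odd h4⟩,
      ?_⟩, by have := h4.pos; omega⟩
    rw [show e + k + 1 - e = k + 1 by omega]
    linarith
  · rintro ⟨a, δ, e, c⟩ h
    simp only [Finset.mem_filter, mem_oddQuads, mem_mixedQuads] at h ⊢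
    obtain ⟨⟨⟨h1, h2, h3, h4⟩, h⟩, hlt⟩ := h
    obtain ⟨k, rfl⟩ := Nat.exists_eq_add_of_lt hlt
    refine ⟨⟨⟨h1.2.add_odd h3, h2, h3, Nat.Even.sub_odd (by omega) h4.2 h2⟩, ?_⟩, by omega⟩
    rw [show δ + k + 1 - δ = k + 1 by omega]
    linarith
  · rintro ⟨d, δ, e, ε⟩ h
    simp only [Finset.mem_filter] at h
    simp only [Prod.mk.injEq, true_and]
    omega
  · rintro ⟨a, δ, e, c⟩ h
    simp only [Finset.mem_filter] at h
    simp only [Prod.mk.injEq, true_and]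
    omega
  · rintro ⟨d, δ, e, ε⟩ h
    rfl

lemma sum_oddQuads_lt_eq_sum_mixedQuads' (F : ℕ → ℤ) (n : ℕ) :
    ∑ x ∈ (oddQuads n).filter (fun x => x.2.2.2 < x.2.1), F (x.1 + x.2.2.1) =
      ∑ x ∈ (mixedQuads n).filter (fun x => x.2.2.1 < x.1), F x.1 := by
  refine Finset.sum_nbij' (fun x => (x.1 + x.2.2.1, x.2.2.2, x.1, x.2.1 - x.2.2.2))
    (fun x => (x.2.2.1, x.2.2.2 + x.2.1, x.1 - x.2.2.1, x.2.1)) ?_ ?_ ?_ ?_ ?_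
  · rintro ⟨d, δ, e, ε⟩ h
    simp only [Finset.mem_filter, mem_oddQuads, mem_mixedQuads] at h ⊢
    obtain ⟨⟨⟨h1, h2, h3, h4⟩, h⟩, hlt⟩ := h
    obtain ⟨k, rfl⟩ := Nat.exists_eq_add_of_lt hlt
    refine ⟨⟨⟨⟨by have := h1.pos; omega, h1.add_odd h3⟩, h4, h1, by omega,
      Nat.Odd.sub_odd h2 h4⟩, ?_⟩, by have := h3.pos; omega⟩
    rw [show ε + k + 1 - ε = k + 1 by omega]
    linarith
  · rintro ⟨a, δ, e, c⟩ h
    simp only [Finset.mem_filter, mem_oddQuads, mem_mixedQuads] at h ⊢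
    obtain ⟨⟨⟨h1, h2, h3, h4⟩, h⟩, hlt⟩ := h
    obtain ⟨k, rfl⟩ := Nat.exists_eq_add_of_lt hlt
    refine ⟨⟨⟨h3, h4.2.add_odd h2, Nat.Even.sub_odd (by omega) h1.2 h3, h2⟩, ?_⟩, by omega⟩
    rw [show e + k + 1 - e = k + 1 by omega]
    linarith
  · rintro ⟨d, δ, e, ε⟩ h
    simp only [Finset.mem_filter] at h
    simp only [Prod.mk.injEq, true_and, and_true]
    omega
  · rintro ⟨a, δ, e, c⟩ h
    simp only [Finset.mem_filter] at h
    simp only [Prod.mk.injEq, true_and]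
    omega
  · rintro ⟨d, δ, e, ε⟩ h
    rfl

lemma sum_mixedQuads_filter_lt (F : ℕ → ℤ) (n : ℕ) :
    ∑ x ∈ (mixedQuads n).filter (fun x => x.2.1 < x.2.2.2), F x.1 =
      ∑ x ∈ (mixedQuads n).filter (fun x => x.2.2.1 < x.1), F x.1 := by
  have h1 := Finset.sum_filter_add_sum_filter_not (mixedQuads n) (fun x => x.2.1 < x.2.2.2)
    (fun x => F x.1)
  have h2 := Finset.sum_filter_add_sum_filter_not (mixedQuads n) (fun x => x.2.2.1 < x.1)
    (fun x => F x.1)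
  have h3 : ∑ x ∈ (mixedQuads n).filter (fun x => ¬ x.2.1 < x.2.2.2), F x.1 =
      ∑ x ∈ (mixedQuads n).filter (fun x => ¬ x.2.2.1 < x.1), F x.1 := by
    refine Finset.sum_nbij' (fun x => (x.1, x.2.1 - x.2.2.2, x.2.2.1 + x.1, x.2.2.2))
      (fun x => (x.1, x.2.1 + x.2.2.2, x.2.2.1 - x.1, x.2.2.2)) ?_ ?_ ?_ ?_ ?_
    · rintro ⟨a, δ, e, c⟩ h
      simp only [Finset.mem_filter, mem_mixedQuads] at h ⊢
      obtain ⟨⟨⟨h1, h2, h3, h4⟩, h⟩, hlt⟩ := h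
      obtain ⟨k, rfl⟩ := Nat.exists_eq_add_of_le (not_lt.mp hlt)
      refine ⟨⟨⟨h1, Nat.Odd.sub_even (by omega) h2 h4.2, h3.add_even h1.2, h4⟩, ?_⟩, by omega⟩
      rw [show c + k - c = k by omega]
      linarith
    · rintro ⟨a, δ, e, c⟩ h
      simp only [Finset.mem_filter, mem_mixedQuads] at h ⊢
      obtain ⟨⟨⟨h1, h2, h3, h4⟩, h⟩, hlt⟩ := h
      obtain ⟨k, rfl⟩ := Nat.exists_eq_add_of_le (not_lt.mp hlt)
      refine ⟨⟨⟨h1, h2.add_even h4.2, Nat.Odd.sub_even (by omega) h3 h1.2, h4⟩, ?_⟩, by omega⟩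
      rw [show a + k - a = k by omega]
      linarith
    · rintro ⟨a, δ, e, c⟩ h
      simp only [Finset.mem_filter] at h
      simp only [Prod.mk.injEq, true_and, and_true]
      omega
    · rintro ⟨a, δ, e, c⟩ h
      simp only [Finset.mem_filter] at h
      simp only [Prod.mk.injEq, true_and, and_true]
      omega
    · rintro ⟨d, δ, e, ε⟩ h
      rfl
  linarith

lemma sum_filter_oddQuads_comp {P : ℕ × ℕ × ℕ × ℕ → Prop} [DecidablePred P]
    (f : ℕ × ℕ × ℕ × ℕ → ℕ × ℕ × ℕ × ℕ) (hf : ∀ x, f (f x) = x)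
    (n : ℕ) (hfn : ∀ x ∈ oddQuads n, f x ∈ oddQuads n) (G : ℕ × ℕ × ℕ × ℕ → ℤ) :
    ∑ x ∈ (oddQuads n).filter P, G x =
      ∑ x ∈ (oddQuads n).filter (fun x => P (f x)), G (f x) := by
  refine Finset.sum_nbij' f f ?_ ?_ (fun x _ => hf x) (fun x _ => hf x) (fun x _ => by rw [hf])
  · intro x hx
    rw [Finset.mem_filter] at hx ⊢
    exact ⟨hfn x hx.1, by rw [hf]; exact hx.2⟩
  · intro x hx
    rw [Finset.mem_filter] at hx ⊢
    exact ⟨hfn x hx.1, hx.2⟩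

lemma sum_eq_sum_filter_trichotomy {ι : Type*} (s : Finset ι) (u v : ι → ℕ) (G : ι → ℤ) :
    ∑ x ∈ s, G x = ∑ x ∈ s.filter (fun x => u x = v x), G x +
      ∑ x ∈ s.filter (fun x => v x < u x), G x + ∑ x ∈ s.filter (fun x => u x < v x), G x := by
  simp only [Finset.sum_filter, ← Finset.sum_add_distrib]
  refine Finset.sum_congr rfl fun x _ => ?_
  rcases lt_trichotomy (u x) (v x) with h | h | h
  · simp [h, h.ne, h.not_gt]
  · simp [h]
  · simp [h, h.ne', h.not_gt]

/-- A Liouville-type identity. -/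
theorem sum_oddQuads_liouville (F : ℕ → ℤ) (n : ℕ) :
    ∑ x ∈ oddQuads n, (F (x.1 - x.2.2.1 + (x.2.2.1 - x.1)) - F (x.1 + x.2.2.1)) =
      ∑ x ∈ (oddQuads n).filter (fun x => x.1 = x.2.2.1), (F 0 - F (x.2.1 + x.2.2.2)) := by
  have hswap : ∀ x ∈ oddQuads n, (x.2.2.1, x.2.2.2, x.1, x.2.1) ∈ oddQuads n := by
    rintro ⟨d, δ, e, ε⟩ h
    rw [mem_oddQuads] at h ⊢
    exact ⟨by tauto, by linarith [h.2]⟩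
  have hflip : ∀ x ∈ oddQuads n, (x.2.1, x.1, x.2.2.2, x.2.2.1) ∈ oddQuads n := by
    rintro ⟨d, δ, e, ε⟩ h
    rw [mem_oddQuads] at h ⊢
    exact ⟨by tauto, by linarith [h.2]⟩
  have e1 := sum_eq_sum_filter_trichotomy (oddQuads n) (fun x => x.1) (fun x => x.2.2.1)
    (fun x => F (x.1 - x.2.2.1 + (x.2.2.1 - x.1)))
  have e2 := sum_eq_sum_filter_trichotomy (oddQuads n) (fun x => x.2.1) (fun x => x.2.2.2)
    (fun x => F (x.1 + x.2.2.1))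
  have e3 := sum_filter_oddQuads_comp (P := fun x => x.1 < x.2.2.1)
    (fun x => (x.2.2.1, x.2.2.2, x.1, x.2.1)) (fun _ => rfl) n hswap
    (fun x => F (x.1 - x.2.2.1 + (x.2.2.1 - x.1)))
  have e4 := sum_filter_oddQuads_comp (P := fun x => x.2.1 < x.2.2.2)
    (fun x => (x.2.2.1, x.2.2.2, x.1, x.2.1)) (fun _ => rfl) n hswap
    (fun x => F (x.1 + x.2.2.1))
  have e5 := sum_filter_oddQuads_comp (P := fun x => x.2.1 = x.2.2.2)
    (fun x => (x.2.1, x.1, x.2.2.2, x.2.2.1)) (fun _ => rfl) n hflip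
    (fun x => F (x.1 + x.2.2.1))
  have e6 : ∀ x : ℕ × ℕ × ℕ × ℕ, F (x.2.2.1 + x.1) = F (x.1 + x.2.2.1) :=
    fun x => by rw [add_comm]
  have e7 : ∑ x ∈ (oddQuads n).filter (fun x => x.2.2.1 < x.1),
      F (x.1 - x.2.2.1 + (x.2.2.1 - x.1)) =
      ∑ x ∈ (oddQuads n).filter (fun x => x.2.2.2 < x.2.1), F (x.1 + x.2.2.1) := by
    rw [sum_oddQuads_lt_eq_sum_mixedQuads', ← sum_mixedQuads_filter_lt,
      ← sum_oddQuads_lt_eq_sum_mixedQuads]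
    refine Finset.sum_congr rfl fun x hx => ?_
    rw [Finset.mem_filter] at hx
    rw [Nat.sub_eq_zero_of_le hx.2.le, add_zero]
  have e8 : ∑ x ∈ (oddQuads n).filter (fun x => x.2.2.1 < x.1),
      F (x.2.2.1 - x.1 + (x.1 - x.2.2.1)) = ∑ x ∈ (oddQuads n).filter (fun x => x.2.2.1 < x.1),
      F (x.1 - x.2.2.1 + (x.2.2.1 - x.1)) :=
    Finset.sum_congr rfl fun x _ => by rw [add_comm]
  have e9 : ∑ x ∈ (oddQuads n).filter (fun x => x.1 = x.2.2.1),
      F (x.1 - x.2.2.1 + (x.2.2.1 - x.1)) =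
      ∑ x ∈ (oddQuads n).filter (fun x => x.1 = x.2.2.1), F 0 := by
    refine Finset.sum_congr rfl fun x hx => ?_
    rw [Finset.mem_filter] at hx
    rw [hx.2, Nat.sub_self]
  simp only [e6] at e4
  simp only at e1 e2 e3 e5
  rw [Finset.sum_sub_distrib, Finset.sum_sub_distrib]
  linarith

lemma sum_antidiagonal_divisors_eq (χ : ℕ → ℤ) (n : ℕ) :
    ∑ p ∈ (Finset.HasAntidiagonal.antidiagonal n).filter (fun p => Odd p.1 ∧ Odd p.2),
      (∑ d ∈ p.1.divisors, χ d) * (∑ d ∈ p.2.divisors, χ d) =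
    ∑ x ∈ oddQuads n, χ x.1 * χ x.2.2.1 := by
  have h : ∀ u : ℕ, ∑ d ∈ u.divisors, χ d = ∑ d ∈ u.divisorsAntidiagonal, χ d.1 := fun u => by
    rw [Nat.sum_divisorsAntidiagonal (fun i _ => χ i)]
  simp only [h, Finset.sum_mul_sum]
  simp only [← Finset.sum_product', Finset.sum_sigma']
  refine Finset.sum_nbij' (fun x => (x.2.1.1, x.2.1.2, x.2.2.1, x.2.2.2))
    (fun x => ⟨(x.1 * x.2.1, x.2.2.1 * x.2.2.2), (x.1, x.2.1), (x.2.2.1, x.2.2.2)⟩) ?_ ?_ ?_ ?_ ?_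
  · rintro ⟨⟨u, v⟩, ⟨d, δ⟩, ⟨e, ε⟩⟩ h
    simp only [Finset.mem_sigma, Finset.mem_filter, Finset.HasAntidiagonal.mem_antidiagonal, Finset.mem_product,
      Nat.mem_divisorsAntidiagonal, mem_oddQuads] at h ⊢
    obtain ⟨⟨h1, h2, h3⟩, ⟨rfl, -⟩, ⟨rfl, -⟩⟩ := h
    rw [Nat.odd_mul] at h2 h3
    exact ⟨by tauto, h1⟩
  · rintro ⟨d, δ, e, ε⟩ h
    simp only [Finset.mem_sigma, Finset.mem_filter, Finset.HasAntidiagonal.mem_antidiagonal, Finset.mem_product,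
      Nat.mem_divisorsAntidiagonal, mem_oddQuads] at h ⊢
    obtain ⟨⟨h1, h2, h3, h4⟩, h⟩ := h
    exact ⟨⟨h, h1.mul h2, h3.mul h4⟩, ⟨trivial, (h1.mul h2).pos.ne'⟩, ⟨trivial, (h3.mul h4).pos.ne'⟩⟩
  · rintro ⟨⟨u, v⟩, ⟨d, δ⟩, ⟨e, ε⟩⟩ h
    simp only [Finset.mem_sigma, Finset.mem_filter, Finset.HasAntidiagonal.mem_antidiagonal, Finset.mem_product,
      Nat.mem_divisorsAntidiagonal] at h
    obtain ⟨-, ⟨rfl, -⟩, ⟨rfl, -⟩⟩ := h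
    rfl
  · intro x _
    rfl
  · intro x _
    rfl

lemma sum_liouville_nonneg_le {F : ℕ → ℤ} (hF : ∀ m, F m ≤ F 0) {n k : ℕ} {c : ℤ}
    (f : ℕ → ℕ × ℕ × ℕ × ℕ) (hf : ∀ i < k, f i ∈ oddQuads n ∧ (f i).1 = (f i).2.2.1 ∧
      F ((f i).2.1 + (f i).2.2.2) + c ≤ F 0) (hinj : Set.InjOn f (Finset.range k)) :
    k * c ≤ ∑ x ∈ oddQuads n, (F (x.1 - x.2.2.1 + (x.2.2.1 - x.1)) - F (x.1 + x.2.2.1)) := by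
  rw [sum_oddQuads_liouville]
  calc (k * c : ℤ) = ∑ i ∈ Finset.range k, c := by simp
    _ ≤ ∑ i ∈ Finset.range k, (F 0 - F ((f i).2.1 + (f i).2.2.2)) := by
        refine Finset.sum_le_sum fun i hi => ?_
        linarith [(hf i (Finset.mem_range.mp hi)).2.2]
    _ = ∑ x ∈ (Finset.range k).image f, (F 0 - F (x.2.1 + x.2.2.2)) := by
        rw [Finset.sum_image hinj]
    _ ≤ _ := by
        refine Finset.sum_le_sum_of_subset_of_nonneg ?_ fun x _ _ => by linarith [hF (x.2.1 + x.2.2.2)]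
        intro x hx
        obtain ⟨i, hi, rfl⟩ := Finset.mem_image.mp hx
        have := hf i (Finset.mem_range.mp hi)
        exact Finset.mem_filter.mpr ⟨this.1, this.2.1⟩

lemma le_sum_oddQuads_chiFour (m : ℕ) :
    (2 * m + 1 : ℤ) ≤ ∑ x ∈ oddQuads (4 * m + 2), chiFour x.1 * chiFour x.2.2.1 := by
  have h := sum_liouville_nonneg_le (F := fun m => if m % 4 = 0 then 1 else -1) (n := 4 * m + 2)
    (k := 2 * m + 1) (c := 2) (by intro m; simp only [Nat.zero_mod, if_true]; split_ifs <;> norm_num)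
    (fun i => (1, 2 * i + 1, 1, 4 * m + 1 - 2 * i)) (by
      intro i hi
      refine ⟨mem_oddQuads.mpr ⟨⟨odd_one, by simp, odd_one, ?_⟩, by omega⟩, rfl, ?_⟩
      · rw [Nat.odd_iff]
        omega
      · simp only
        rw [if_neg (by omega)]
        norm_num) (by
      intro i _ j _ h
      simp only [Prod.mk.injEq] at h
      omega)
  have h2 : ∑ x ∈ oddQuads (4 * m + 2), ((if (x.1 - x.2.2.1 + (x.2.2.1 - x.1)) % 4 = 0 then (1 : ℤ)
      else -1) - (if (x.1 + x.2.2.1) % 4 = 0 then 1 else -1)) =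
      ∑ x ∈ oddQuads (4 * m + 2), 2 * (chiFour x.1 * chiFour x.2.2.1) := by
    refine Finset.sum_congr rfl ?_
    rintro ⟨d, δ, e, ε⟩ hx
    rw [mem_oddQuads] at hx
    have hd := Nat.odd_iff.mp hx.1.1
    have he := Nat.odd_iff.mp hx.1.2.2.1
    simp only [chiFour_apply]
    split_ifs <;> omega
  rw [h2, ← Finset.mul_sum] at h
  push_cast at h
  linarith

lemma sum_oddQuads_chiThree (n : ℕ) :
    ∑ x ∈ oddQuads n, ((if (x.1 - x.2.2.1 + (x.2.2.1 - x.1)) % 3 = 0 then (1 : ℤ)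
      else 0) - (if (x.1 + x.2.2.1) % 3 = 0 then 1 else 0)) =
      ∑ x ∈ oddQuads n, chiThree x.1 * chiThree x.2.2.1 := by
  refine Finset.sum_congr rfl fun x _ => ?_
  simp only [chiThree_apply]
  split_ifs <;> omega

lemma le_sum_oddQuads_chiThree {m : ℕ} (hm : ¬ 3 ∣ m + 1) :
    (m + 1 : ℤ) ≤ ∑ x ∈ oddQuads (2 * m + 2), chiThree x.1 * chiThree x.2.2.1 := by
  have h := sum_liouville_nonneg_le (F := fun m => if m % 3 = 0 then 1 else 0) (n := 2 * m + 2)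
    (k := m + 1) (c := 1) (by intro m; simp only [Nat.zero_mod, if_true]; split_ifs <;> norm_num)
    (fun i => (1, 2 * i + 1, 1, 2 * m + 1 - 2 * i)) (by
      intro i hi
      refine ⟨mem_oddQuads.mpr ⟨⟨odd_one, by simp, odd_one, ?_⟩, by omega⟩, rfl, ?_⟩
      · rw [Nat.odd_iff]
        omega
      · simp only
        rw [if_neg (by omega)]
        norm_num) (by
      intro i _ j _ h
      simp only [Prod.mk.injEq] at h
      omega)
  rw [sum_oddQuads_chiThree] at h
  push_cast at h
  linarith

lemma one_le_sum_oddQuads_chiThree (m : ℕ) :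
    (1 : ℤ) ≤ ∑ x ∈ oddQuads (2 * m + 2), chiThree x.1 * chiThree x.2.2.1 := by
  obtain ⟨e, w, hw, he⟩ := Nat.exists_eq_pow_mul_and_not_dvd (n := m + 1) (by omega) 3 (by omega)
  have hw0 : w ≠ 0 := by rintro rfl; simp at hw
  have h := sum_liouville_nonneg_le (F := fun m => if m % 3 = 0 then 1 else 0) (n := 2 * m + 2)
    (k := 1) (c := 1) (by intro m; simp only [Nat.zero_mod, if_true]; split_ifs <;> norm_num)
    (fun i => (3 ^ e, 1, 3 ^ e, 2 * w - 1)) (by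
      intro i hi
      have h3 : Odd (3 ^ e) := Odd.pow (by decide)
      refine ⟨mem_oddQuads.mpr ⟨⟨h3, odd_one, h3, ?_⟩, ?_⟩, rfl, ?_⟩
      · rw [Nat.odd_iff]
        omega
      · obtain ⟨k, rfl⟩ := Nat.exists_eq_succ_of_ne_zero hw0
        rw [show 2 * (k + 1) - 1 = 2 * k + 1 by omega]
        simp only [Nat.succ_eq_add_one] at he
        linarith
      · simp only
        rw [if_neg (by omega)]
        norm_num) (by
      intro i hi j hj h
      simp only [Finset.coe_range, Set.mem_Iio] at hi hj
      omega)
  rw [sum_oddQuads_chiThree] at h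
  push_cast at h
  linarith

lemma sum_oddQuads_le_card (χ : ℕ → ℤ) (D n : ℕ) (h : ∀ u, Odd u → 0 ≤ ∑ d ∈ u.divisors, χ d ∧
    ∑ d ∈ u.divisors, χ d ≤ (normReps D u).card) :
    ∑ x ∈ oddQuads n, χ x.1 * χ x.2.2.1 ≤
      (((Finset.HasAntidiagonal.antidiagonal n).filter (fun p => Odd p.1 ∧ Odd p.2)).sigma
        fun p => normReps D p.1 ×ˢ normReps D p.2).card := by
  rw [← sum_antidiagonal_divisors_eq, Finset.card_sigma]
  push_cast
  refine Finset.sum_le_sum fun p hp => ?_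
  rw [Finset.mem_filter] at hp
  rw [Finset.card_product]
  push_cast
  obtain ⟨h1, h2⟩ := h p.1 hp.2.1
  obtain ⟨h3, h4⟩ := h p.2 hp.2.2
  gcongr

lemma card_le_Nstar {ι : Type*} {a b : ℕ} {M : ℤ} (s : Finset ι)
    (f : ι → (Fin a → ℤ) × (Fin b → ℤ))
    (hf : ∀ i ∈ s, (∀ j, Odd ((f i).1 j)) ∧ (∀ j, Odd ((f i).2 j)) ∧ sqForm (f i) = M)
    (hinj : Set.InjOn f s) : s.card ≤ Nstar a b M := by
  rw [Nstar, ← Set.ncard_coe_finset]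
  refine Set.ncard_le_ncard_of_injOn f ?_ hinj ?_
  · intro i hi
    obtain ⟨h1, h2, h3⟩ := hf i hi
    exact ⟨h1, h2, h3.symm⟩
  · exact (finite_sqForm_eq a b M).subset fun p hp => hp.2.2.symm

lemma odd_of_sq_add_mul {D : ℕ} (hD : Odd D) {x y : ℤ} {u : ℕ} (hu : Odd u)
    (h : x ^ 2 + D * y ^ 2 = u) : Odd (x + y) ∧ Odd (x - D * y) := by
  have hu' : Odd ((u : ℕ) : ℤ) := by exact_mod_cast hu
  have hD' : Odd ((D : ℕ) : ℤ) := by exact_mod_cast hD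
  rw [← h, Int.odd_add, Int.odd_pow' two_ne_zero, Int.even_mul, Int.even_pow' two_ne_zero] at hu'
  rw [Int.odd_add, Int.odd_sub, Int.even_mul]
  simp only [← Int.not_odd_iff_even] at hu' ⊢
  tauto

lemma card_le_Nstar_four (n : ℕ) :
    (((Finset.HasAntidiagonal.antidiagonal n).filter (fun p => Odd p.1 ∧ Odd p.2)).sigma
        fun p => normReps 1 p.1 ×ˢ normReps 1 p.2).card ≤ Nstar 4 0 (2 * n) := by
  refine card_le_Nstar _ (fun x => (![x.2.1.re + x.2.1.im, x.2.1.re - x.2.1.im,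
    x.2.2.re + x.2.2.im, x.2.2.re - x.2.2.im], ![])) ?_ ?_
  · rintro ⟨⟨u, v⟩, α, β⟩ h
    simp only [Finset.mem_sigma, Finset.mem_filter, Finset.HasAntidiagonal.mem_antidiagonal,
      Finset.mem_product, mem_normReps one_pos, Zsqrtd.norm_neg_natCast] at h
    obtain ⟨⟨rfl, hu, hv⟩, h1, h2⟩ := h
    have h3 := odd_of_sq_add_mul odd_one hu h1
    have h4 := odd_of_sq_add_mul odd_one hv h2
    push_cast at h1 h2 h3 h4
    rw [one_mul] at h1 h2 h3 h4
    refine ⟨by simp [Fin.forall_fin_succ, h3, h4], by simp, ?_⟩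
    simp [sqForm, Fin.sum_univ_succ]
    linarith
  · rintro ⟨⟨u, v⟩, α, β⟩ h ⟨⟨u', v'⟩, α', β'⟩ h' hh
    simp only [Finset.coe_sigma, Finset.coe_product, Set.mem_sigma_iff, Set.mem_prod,
      Finset.mem_coe, mem_normReps one_pos] at h h'
    simp only [Prod.mk.injEq, Matrix.vecCons_inj] at hh
    obtain rfl : α = α' := by ext <;> omega
    obtain rfl : β = β' := by ext <;> omega
    obtain rfl : u = u' := by exact_mod_cast h.2.1.symm.trans h'.2.1
    obtain rfl : v = v' := by exact_mod_cast h.2.2.symm.trans h'.2.2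
    rfl

lemma card_le_Nstar_two_two (n : ℕ) :
    (((Finset.HasAntidiagonal.antidiagonal n).filter (fun p => Odd p.1 ∧ Odd p.2)).sigma
        fun p => normReps 3 p.1 ×ˢ normReps 3 p.2).card ≤ Nstar 2 2 (4 * n) := by
  refine card_le_Nstar _ (fun x => (![x.2.1.re - 3 * x.2.1.im, x.2.2.re - 3 * x.2.2.im],
    ![x.2.1.re + x.2.1.im, x.2.2.re + x.2.2.im])) ?_ ?_
  · rintro ⟨⟨u, v⟩, α, β⟩ h
    simp only [Finset.mem_sigma, Finset.mem_filter, Finset.HasAntidiagonal.mem_antidiagonal,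
      Finset.mem_product, mem_normReps three_pos, Zsqrtd.norm_neg_natCast] at h
    obtain ⟨⟨rfl, hu, hv⟩, h1, h2⟩ := h
    have h3 := odd_of_sq_add_mul (by decide) hu h1
    have h4 := odd_of_sq_add_mul (by decide) hv h2
    push_cast at h1 h2 h3 h4
    refine ⟨by simp [Fin.forall_fin_succ, h3, h4], by simp [Fin.forall_fin_succ, h3, h4], ?_⟩
    simp [sqForm, Fin.sum_univ_succ]
    linarith
  · rintro ⟨⟨u, v⟩, α, β⟩ h ⟨⟨u', v'⟩, α', β'⟩ h' hh
    simp only [Finset.coe_sigma, Finset.coe_product, Set.mem_sigma_iff, Set.mem_prod,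
      Finset.mem_coe, mem_normReps three_pos] at h h'
    simp only [Prod.mk.injEq, Matrix.vecCons_inj] at hh
    obtain rfl : α = α' := by ext <;> omega
    obtain rfl : β = β' := by ext <;> omega
    obtain rfl : u = u' := by exact_mod_cast h.2.1.symm.trans h'.2.1
    obtain rfl : v = v' := by exact_mod_cast h.2.2.symm.trans h'.2.2
    rfl

theorem le_Nstar_four (m : ℕ) : 2 * m + 1 ≤ Nstar 4 0 (8 * m + 4) := by
  have h := card_le_Nstar_four (4 * m + 2)
  rw [show (2 * ((4 * m + 2 : ℕ) : ℤ)) = 8 * m + 4 by push_cast; ring] at h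
  refine le_trans ?_ h
  exact_mod_cast (le_sum_oddQuads_chiFour m).trans
    (sum_oddQuads_le_card chiFour 1 _ fun u hu => sum_chiFour_bounds hu)

theorem le_Nstar_two_two {m : ℕ} (hm : ¬ 3 ∣ m + 1) : m + 1 ≤ Nstar 2 2 (8 * m + 8) := by
  have h := card_le_Nstar_two_two (2 * m + 2)
  rw [show (4 * ((2 * m + 2 : ℕ) : ℤ)) = 8 * m + 8 by push_cast; ring] at h
  refine le_trans ?_ h
  exact_mod_cast (le_sum_oddQuads_chiThree hm).trans
    (sum_oddQuads_le_card chiThree 3 _ fun u hu => sum_chiThree_bounds hu)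

theorem one_le_Nstar_two_two (m : ℕ) : 1 ≤ Nstar 2 2 (8 * m + 8) := by
  have h := card_le_Nstar_two_two (2 * m + 2)
  rw [show (4 * ((2 * m + 2 : ℕ) : ℤ)) = 8 * m + 8 by push_cast; ring] at h
  refine le_trans ?_ h
  exact_mod_cast (one_le_sum_oddQuads_chiThree m).trans
    (sum_oddQuads_le_card chiThree 3 _ fun u hu => sum_chiThree_bounds hu)

lemma finite_odd_sqForm (a b : ℕ) (M : ℤ) : {p : (Fin a → ℤ) × (Fin b → ℤ) |
    (∀ i, Odd (p.1 i)) ∧ (∀ j, Odd (p.2 j)) ∧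
    M = ∑ i, (p.1 i) ^ 2 + 3 * ∑ j, (p.2 j) ^ 2}.Finite :=
  (finite_sqForm_eq a b M).subset fun _ hp => hp.2.2.symm

lemma sum_Nstar_le_Nstar_succ_left (a b : ℕ) (M : ℤ) (s : Finset ℤ) (hs : ∀ x ∈ s, Odd x) :
    ∑ x ∈ s, Nstar a b (M - 1 * x ^ 2) ≤ Nstar (a + 1) b M := by
  have h : ∀ x, Nstar a b (M - 1 * x ^ 2) = (finite_odd_sqForm a b (M - 1 * x ^ 2)).toFinset.card :=
    fun x => Set.ncard_eq_toFinset_card _ _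
  simp only [h, ← Finset.card_sigma]
  refine card_le_Nstar _ (fun z => (Fin.cons z.1 z.2.1, z.2.2)) ?_ ?_
  · rintro ⟨x, p⟩ hz
    simp only [Finset.mem_sigma, Set.Finite.mem_toFinset, Set.mem_ofPred_eq] at hz
    obtain ⟨hx, h1, h2, h3⟩ := hz
    refine ⟨Fin.cases (by simpa using hs x hx) (by simpa using h1), h2, ?_⟩
    simp only [sqForm, Fin.sum_univ_succ, Fin.cons_zero, Fin.cons_succ]
    linarith
  · rintro ⟨x, p⟩ _ ⟨y, q⟩ _ h
    simp only [Prod.mk.injEq, Fin.cons_inj] at h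
    obtain ⟨⟨rfl, h1⟩, h2⟩ := h
    rw [Prod.ext h1 h2]

lemma sum_Nstar_le_Nstar_succ_right (a b : ℕ) (M : ℤ) (s : Finset ℤ) (hs : ∀ x ∈ s, Odd x) :
    ∑ x ∈ s, Nstar a b (M - 3 * x ^ 2) ≤ Nstar a (b + 1) M := by
  have h : ∀ x, Nstar a b (M - 3 * x ^ 2) = (finite_odd_sqForm a b (M - 3 * x ^ 2)).toFinset.card :=
    fun x => Set.ncard_eq_toFinset_card _ _
  simp only [h, ← Finset.card_sigma]
  refine card_le_Nstar _ (fun z => (z.2.1, Fin.cons z.1 z.2.2)) ?_ ?_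
  · rintro ⟨x, p⟩ hz
    simp only [Finset.mem_sigma, Set.Finite.mem_toFinset, Set.mem_ofPred_eq] at hz
    obtain ⟨hx, h1, h2, h3⟩ := hz
    refine ⟨h1, Fin.cases (by simpa using hs x hx) (by simpa using h2), ?_⟩
    simp only [sqForm, Fin.sum_univ_succ, Fin.cons_zero, Fin.cons_succ]
    linarith
  · rintro ⟨x, p⟩ _ ⟨y, q⟩ _ h
    simp only [Prod.mk.injEq, Fin.cons_inj] at h
    obtain ⟨h1, rfl, h2⟩ := h
    rw [Prod.ext h1 h2]

lemma Nstar_swap_le (a b : ℕ) (M : ℤ) : Nstar b a M ≤ Nstar a b (3 * M) := by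
  have h : Nstar b a M = (finite_odd_sqForm b a M).toFinset.card := Set.ncard_eq_toFinset_card _ _
  rw [h]
  refine card_le_Nstar _ (fun p => (fun i => 3 * p.2 i, p.1)) ?_ ?_
  · intro p hp
    simp only [Set.Finite.mem_toFinset, Set.mem_ofPred_eq] at hp
    obtain ⟨h1, h2, h3⟩ := hp
    refine ⟨fun i => Odd.mul (by decide) (h2 i), h1, ?_⟩
    simp only [sqForm, mul_pow, ← Finset.mul_sum]
    linarith
  · rintro p _ q _ h
    simp only [Prod.mk.injEq] at h
    refine Prod.ext h.2 (funext fun i => ?_)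
    have := congrFun h.1 i
    omega

/-- On the integers satisfying `G` and the necessary congruence modulo eight, the number of
representations by odd integers grows at least as fast as the expected order of magnitude. -/
def NstarGrows (a b : ℕ) (G : ℤ → Prop) : Prop :=
  ∃ c : ℝ, 0 < c ∧ ∃ n₀ : ℤ, ∀ n : ℤ, n₀ ≤ n → (8 : ℤ) ∣ n - (a + 3 * b) → G n →
    c * √(n : ℝ) ^ (a + b - 2) ≤ Nstar a b n

lemma exists_finset_odd {n : ℤ} (hn : 400 ≤ n) {ρ : ℤ} (hρ : ρ = 1 ∨ ρ = 3) :
    ∃ s : Finset ℤ, (∀ x ∈ s, Odd x ∧ x % 6 = ρ ∧ 6 * x ^ 2 ≤ n) ∧ √(n : ℝ) / 100 ≤ s.card := by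
  have hn' : (400 : ℝ) ≤ n := by exact_mod_cast hn
  have hq : (20 : ℝ) ≤ √(n : ℝ) := Real.le_sqrt_of_sq_le (by linarith)
  have hq2 : √(n : ℝ) ^ 2 = n := Real.sq_sqrt (by linarith)
  set K := ⌊√(n : ℝ) / 15⌋₊ with hK
  have hK1 : (K : ℝ) ≤ √(n : ℝ) / 15 := Nat.floor_le (by positivity)
  have hK2 : √(n : ℝ) / 15 < K + 1 := Nat.lt_floor_add_one _
  have hK3 : 225 * (K : ℤ) ^ 2 ≤ n := by
    have : 225 * (K : ℝ) ^ 2 ≤ n := by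
      rw [← hq2]
      nlinarith [K.cast_nonneg (α := ℝ)]
    exact_mod_cast this
  refine ⟨(Finset.range K).image fun k : ℕ => 6 * (k : ℤ) + ρ, ?_, ?_⟩
  · intro x hx
    obtain ⟨k, hk, rfl⟩ := Finset.mem_image.mp hx
    have hk' : (k : ℤ) + 1 ≤ K := by exact_mod_cast Finset.mem_range.mp hk
    refine ⟨by rw [Int.odd_iff]; omega, by omega, ?_⟩
    have h1 : 6 * (k : ℤ) + ρ ≤ 6 * K := by omega
    have h2 : 0 ≤ 6 * (k : ℤ) + ρ := by omega
    nlinarith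
  · rw [Finset.card_image_of_injective _ fun i j h => by simpa using h, Finset.card_range]
    linarith

lemma NstarGrows.step {a b a' b' : ℕ} {G G' : ℤ → Prop} (h : NstarGrows a b G) {w : ℤ}
    (hw : w = 1 ∨ w = 3) (hab : 2 ≤ a + b) (hs : a' + b' = a + b + 1)
    (hmod : (a' + 3 * b' : ℤ) = a + 3 * b + w)
    (hsum : ∀ (M : ℤ) (s : Finset ℤ), (∀ x ∈ s, Odd x) →
      ∑ x ∈ s, Nstar a b (M - w * x ^ 2) ≤ Nstar a' b' M)
    (hG : ∀ n, G' n → ∃ ρ : ℤ, (ρ = 1 ∨ ρ = 3) ∧ ∀ x, x % 6 = ρ → G (n - w * x ^ 2)) :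
    NstarGrows a' b' G' := by
  obtain ⟨c, hc, n₀, h⟩ := h
  refine ⟨c / (100 * 2 ^ (a + b - 2)), by positivity, max 400 (2 * n₀), fun n hn h8 hGn => ?_⟩
  obtain ⟨ρ, hρ, hGρ⟩ := hG n hGn
  have hn1 : 400 ≤ n := (le_max_left _ _).trans hn
  have hn2 : 2 * n₀ ≤ n := (le_max_right _ _).trans hn
  obtain ⟨s, hs1, hs2⟩ := exists_finset_odd hn1 hρ
  have hterm : ∀ x ∈ s, c * (√(n : ℝ) / 2) ^ (a + b - 2) ≤ Nstar a b (n - w * x ^ 2) := by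
    intro x hx
    obtain ⟨hodd, hx6, hxn⟩ := hs1 x hx
    have hwx : 2 * (w * x ^ 2) ≤ n := by
      rcases hw with rfl | rfl <;> nlinarith [sq_nonneg x]
    have h8x : (8 : ℤ) ∣ x ^ 2 - 1 := Int.eight_dvd_sq_sub_one_of_odd hodd
    refine le_trans ?_ (h (n - w * x ^ 2) (by linarith) ?_ (hGρ x hx6))
    · gcongr
      rw [show √(n : ℝ) / 2 = √((n : ℝ) / 4) by
        rw [Real.sqrt_div' _ (by norm_num), show (4 : ℝ) = 2 ^ 2 by norm_num,
          Real.sqrt_sq (by norm_num)]]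
      apply Real.sqrt_le_sqrt
      have hwx' : 2 * ((w : ℝ) * x ^ 2) ≤ n := by exact_mod_cast hwx
      have hn' : (400 : ℝ) ≤ n := by exact_mod_cast hn1
      push_cast
      linarith
    · have : n - w * x ^ 2 - (a + 3 * b) = (n - (a' + 3 * b')) - w * (x ^ 2 - 1) := by
        rw [hmod]
        ring
      rw [this]
      exact dvd_sub h8 (h8x.mul_left w)
  calc c / (100 * 2 ^ (a + b - 2)) * √(n : ℝ) ^ (a' + b' - 2)
      = √(n : ℝ) / 100 * (c * (√(n : ℝ) / 2) ^ (a + b - 2)) := by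
        rw [show a' + b' - 2 = (a + b - 2) + 1 by omega, pow_succ, div_pow]
        field_simp
    _ ≤ s.card * (c * (√(n : ℝ) / 2) ^ (a + b - 2)) := by gcongr
    _ = ∑ x ∈ s, c * (√(n : ℝ) / 2) ^ (a + b - 2) := by simp
    _ ≤ ∑ x ∈ s, (Nstar a b (n - w * x ^ 2) : ℝ) := Finset.sum_le_sum hterm
    _ ≤ Nstar a' b' n := by exact_mod_cast hsum n s fun x hx => (hs1 x hx).1

lemma NstarGrows.succ_left {a b : ℕ} {G G' : ℤ → Prop} (h : NstarGrows a b G) (hab : 2 ≤ a + b)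
    (hG : ∀ n, G' n → ∃ ρ : ℤ, (ρ = 1 ∨ ρ = 3) ∧ ∀ x, x % 6 = ρ → G (n - 1 * x ^ 2)) :
    NstarGrows (a + 1) b G' :=
  h.step (Or.inl rfl) hab (by omega) (by push_cast; ring) (sum_Nstar_le_Nstar_succ_left a b) hG

lemma NstarGrows.succ_right {a b : ℕ} {G G' : ℤ → Prop} (h : NstarGrows a b G) (hab : 2 ≤ a + b)
    (hG : ∀ n, G' n → ∃ ρ : ℤ, (ρ = 1 ∨ ρ = 3) ∧ ∀ x, x % 6 = ρ → G (n - 3 * x ^ 2)) :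
    NstarGrows a (b + 1) G' :=
  h.step (Or.inr rfl) hab (by omega) (by push_cast; ring) (sum_Nstar_le_Nstar_succ_right a b) hG

lemma NstarGrows.mono {a b : ℕ} (h : NstarGrows a b fun _ => True) (hab : 2 ≤ a + b) {a' b' : ℕ}
    (ha : a ≤ a') (hb : b ≤ b') : NstarGrows a' b' fun _ => True := by
  induction a', ha using Nat.le_induction with
  | base =>
    induction b', hb using Nat.le_induction with
    | base => exact h
    | succ b' hb ih => exact ih.succ_right (by omega) fun _ _ => ⟨1, Or.inl rfl, fun _ _ => trivial⟩
  | succ a' ha ih => exact ih.succ_left (by omega) fun _ _ => ⟨1, Or.inl rfl, fun _ _ => trivial⟩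

lemma NstarGrows_four : NstarGrows 4 0 fun _ => True := by
  refine ⟨1 / 8, by norm_num, 4, fun n hn h8 _ => ?_⟩
  obtain ⟨m, rfl⟩ : ∃ m : ℕ, n = 8 * m + 4 := by
    obtain ⟨k, hk⟩ := h8
    push_cast at hk
    exact ⟨k.toNat, by omega⟩
  have h : ((2 * m + 1 : ℕ) : ℝ) ≤ Nstar 4 0 (8 * m + 4) := by exact_mod_cast le_Nstar_four m
  refine le_trans ?_ h
  rw [show 4 + 0 - 2 = 2 by norm_num, Real.sq_sqrt (by push_cast; positivity)]
  push_cast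
  linarith [m.cast_nonneg (α := ℝ)]

lemma NstarGrows_two_two : NstarGrows 2 2 fun n => ¬ 3 ∣ n := by
  refine ⟨1 / 8, by norm_num, 8, fun n hn h8 h3 => ?_⟩
  obtain ⟨m, rfl⟩ : ∃ m : ℕ, n = 8 * m + 8 := by
    obtain ⟨k, hk⟩ := h8
    push_cast at hk
    exact ⟨k.toNat, by omega⟩
  have h : ((m + 1 : ℕ) : ℝ) ≤ Nstar 2 2 (8 * m + 8) := by
    exact_mod_cast le_Nstar_two_two (m := m) (by omega)
  refine le_trans ?_ h
  rw [show 2 + 2 - 2 = 2 by norm_num, Real.sq_sqrt (by push_cast; positivity)]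
  push_cast
  linarith [m.cast_nonneg (α := ℝ)]

lemma NstarGrows_three_two : NstarGrows 3 2 fun _ => True := by
  refine NstarGrows_two_two.succ_left (by norm_num) fun n _ => ?_
  by_cases h : 3 ∣ n
  · refine ⟨1, Or.inl rfl, fun x hx => ?_⟩
    obtain ⟨k, rfl⟩ : ∃ k, x = 6 * k + 1 := ⟨x / 6, by omega⟩
    ring_nf
    omega
  · refine ⟨3, Or.inr rfl, fun x hx => ?_⟩
    obtain ⟨k, rfl⟩ : ∃ k, x = 6 * k + 3 := ⟨x / 6, by omega⟩
    ring_nf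
    omega

lemma NstarGrows_two (b : ℕ) (hb : 2 ≤ b) : NstarGrows 2 b fun n => ¬ 3 ∣ n := by
  induction b, hb using Nat.le_induction with
  | base => exact NstarGrows_two_two
  | succ b hb ih =>
    exact ih.succ_right (by omega) fun n hn => ⟨1, Or.inl rfl, fun x _ => by omega⟩

lemma NstarGrows_two_of_four_le (b : ℕ) (hb : 4 ≤ b) : NstarGrows 2 b fun _ => True := by
  obtain ⟨c, hc, n₀, h⟩ := NstarGrows_two b (by omega)
  obtain ⟨c', hc', n₁, h'⟩ := NstarGrows_four.mono (by norm_num) hb (Nat.zero_le 2)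
  refine ⟨min c (c' / 2 ^ (2 + b - 2)), by positivity, max 0 (max n₀ (3 * n₁)),
    fun n hn h8 _ => ?_⟩
  have hn0 : 0 ≤ n := (le_max_left _ _).trans hn
  have hn1 : n₀ ≤ n := (le_max_left _ _).trans ((le_max_right _ _).trans hn)
  have hn2 : 3 * n₁ ≤ n := (le_max_right _ _).trans ((le_max_right _ _).trans hn)
  by_cases h3 : 3 ∣ n
  · obtain ⟨m, rfl⟩ := h3
    have h4 := h' m (by omega) (by push_cast at h8 ⊢; omega) trivial
    have h5 : (Nstar b 2 m : ℝ) ≤ Nstar 2 b (3 * m) := by exact_mod_cast Nstar_swap_le 2 b m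
    refine le_trans ?_ (h4.trans h5)
    have hm : (0 : ℝ) ≤ m := by exact_mod_cast (by omega : 0 ≤ m)
    have h6 : √((3 * m : ℤ) : ℝ) ≤ 2 * √(m : ℝ) := by
      rw [Real.sqrt_le_left (by positivity), mul_pow, Real.sq_sqrt hm]
      push_cast
      linarith
    calc min c (c' / 2 ^ (2 + b - 2)) * √((3 * m : ℤ) : ℝ) ^ (2 + b - 2)
        ≤ (c' / 2 ^ (2 + b - 2)) * (2 * √(m : ℝ)) ^ (2 + b - 2) := by
          gcongr
          exact min_le_right _ _
      _ = c' * √(m : ℝ) ^ (b + 2 - 2) := by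
          rw [mul_pow, add_comm b 2]
          field_simp
  · refine le_trans ?_ (h n hn1 h8 h3)
    gcongr
    exact min_le_left _ _

theorem NstarGrows_of_six_le {a b : ℕ} (ha : 1 < a) (hpar : Even (a + b)) (hge : 6 ≤ a + b) :
    NstarGrows a b fun _ => True := by
  rcases Nat.lt_or_ge a 4 with h | h
  · have : a = 2 ∨ a = 3 := by omega
    rcases this with rfl | rfl
    · exact NstarGrows_two_of_four_le b (by omega)
    · exact NstarGrows_three_two.mono (by norm_num) le_rfl (by omega)
  · exact NstarGrows_four.mono (by norm_num) h (Nat.zero_le b)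

lemma card_admissible_pos (a b : ℕ) : 0 < (admissible a b).card :=
  Finset.card_pos.mpr ⟨(∅, ∅), by simp [admissible]⟩

lemma tendsto_Ntilde_div_Nstar {a b : ℕ} (ha : 1 < a) (hpar : Even (a + b)) (hge : 6 ≤ a + b)
    (hmod : 4 ∣ a + 3 * b) : Filter.Tendsto (fun n : ℕ =>
      2 * (Ntilde a b (8 * (n : ℤ) + a + 3 * b) : ℝ) / (Nstar a b (8 * (n : ℤ) + a + 3 * b) : ℝ))
      Filter.atTop (nhds ((admissible a b).card : ℝ)) := by
  obtain ⟨C, hC⟩ := exists_abs_two_mul_Ntilde_sub_le (by omega : 0 < a) hmod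
  obtain ⟨c, hc, n₀, hN⟩ := NstarGrows_of_six_le ha hpar hge
  rw [tendsto_iff_norm_sub_tendsto_zero]
  have hlim : Filter.Tendsto (fun n : ℕ => |C| / c * (√(n : ℝ))⁻¹) Filter.atTop (nhds 0) := by
    rw [← mul_zero (|C| / c)]
    exact (tendsto_inv_atTop_zero.comp
      (Real.tendsto_sqrt_atTop.comp tendsto_natCast_atTop_atTop)).const_mul _
  refine squeeze_zero' (Filter.Eventually.of_forall fun _ => norm_nonneg _) ?_ hlim
  filter_upwards [Filter.eventually_ge_atTop (max 1 n₀.toNat)] with n hn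
  have hn1 : 1 ≤ n := (le_max_left _ _).trans hn
  have hn2 : n₀.toNat ≤ n := (le_max_right _ _).trans hn
  set M : ℤ := 8 * (n : ℤ) + a + 3 * b with hM
  have hMn : (n : ℤ) ≤ M := by omega
  have h8 : (8 : ℤ) ∣ M - (a + 3 * b) := ⟨n, by rw [hM]; ring⟩
  have h1 := hC M (by omega) h8
  have h2 := hN M (by omega) h8 trivial
  have hMn' : (n : ℝ) ≤ M := by exact_mod_cast hMn
  have hn1' : (1 : ℝ) ≤ n := by exact_mod_cast hn1
  have hM0 : (0 : ℝ) ≤ M := by linarith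
  set q : ℝ := (M : ℝ) ^ (1 / 4 : ℝ) with hq
  have hq2 : √(M : ℝ) = q ^ 2 := by
    rw [hq, Real.sqrt_eq_rpow, ← Real.rpow_natCast, ← Real.rpow_mul hM0]
    norm_num
  have hq1 : 1 ≤ q := Real.one_le_rpow (by linarith) (by norm_num)
  have hq0 : 0 < q := by linarith
  have hns : √(n : ℝ) ≤ q ^ 2 := hq2 ▸ Real.sqrt_le_sqrt hMn'
  have hsq : 0 < √(n : ℝ) := Real.sqrt_pos.mpr (by linarith)
  rw [hq2, ← pow_mul] at h2
  have hpos : 0 < (Nstar a b M : ℝ) := lt_of_lt_of_le (by positivity) h2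
  rw [Real.norm_eq_abs, div_sub' hpos.ne', abs_div, abs_of_pos hpos, mul_comm (Nstar a b M : ℝ),
    div_le_iff₀ hpos]
  calc _ ≤ C * q ^ (a + b) := h1
    _ ≤ |C| * q ^ (a + b) := by gcongr; exact le_abs_self C
    _ = |C| / c * (√(n : ℝ))⁻¹ * (c * (q ^ (a + b) * √(n : ℝ))) := by field_simp
    _ ≤ |C| / c * (√(n : ℝ))⁻¹ * (c * q ^ (2 * (a + b - 2))) := by
        gcongr
        calc q ^ (a + b) * √(n : ℝ) ≤ q ^ (a + b) * q ^ 2 := by gcongr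
          _ = q ^ (a + b + 2) := (pow_add q (a + b) 2).symm
          _ ≤ q ^ (2 * (a + b - 2)) := pow_le_pow_right₀ hq1 (by omega)
    _ ≤ |C| / c * (√(n : ℝ))⁻¹ * Nstar a b M := by gcongr

lemma Nstar_pos_of_four {a b : ℕ} (ha : 1 < a) (hmod : 4 ∣ a + 3 * b) (hab : a + b = 4) {n : ℕ} :
    0 < Nstar a b (8 * (n : ℤ) + a + 3 * b) := by
  have h : (a = 4 ∧ b = 0) ∨ (a = 2 ∧ b = 2) := by omega
  rcases h with ⟨rfl, rfl⟩ | ⟨rfl, rfl⟩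
  · have := le_Nstar_four n
    rw [show (8 * (n : ℤ) + (4 : ℕ) + 3 * (0 : ℕ)) = 8 * n + 4 by push_cast; ring]
    omega
  · have := one_le_Nstar_two_two n
    rw [show (8 * (n : ℤ) + (2 : ℕ) + 3 * (2 : ℕ)) = 8 * n + 8 by push_cast; ring]
    omega

theorem stmt_4 (a b : ℕ) (ha : 1 < a) (hpar : Even (a + b)) (hge : 4 ≤ a + b)
    (hmod : 4 ∣ a + 3 * b) :
    Filter.Tendsto (fun n : ℕ =>
        (Nstar a b (8 * (n : ℤ) + a + 3 * b) : ℝ) /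
          (Ntilde a b (8 * (n : ℤ) + a + 3 * b) : ℝ))
      Filter.atTop
      (nhds (2 / ((2 : ℝ) ^ (a + b - 2) +
        (-1 : ℝ) ^ b * 2 ^ ((a + b - 2) / 2) * Real.cos (Real.pi * (a + 3 * b) / 4)))) := by
  rw [← card_admissible (by omega : 0 < a) hpar (by omega)]
  have hS : ((admissible a b).card : ℝ) ≠ 0 := by exact_mod_cast (card_admissible_pos a b).ne'
  rcases Nat.lt_or_ge (a + b) 6 with h | h
  · have hab : a + b = 4 := by
      obtain ⟨k, hk⟩ := hpar
      omega
    refine tendsto_const_nhds.congr fun n => ?_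
    have h1 := two_mul_Ntilde_of_four (M := 8 * (n : ℤ) + a + 3 * b) ha hmod hab ⟨n, by ring⟩
    have h2 : (Nstar a b (8 * (n : ℤ) + a + 3 * b) : ℝ) ≠ 0 := by
      exact_mod_cast (Nstar_pos_of_four ha hmod hab).ne'
    have h3 : (Ntilde a b (8 * (n : ℤ) + a + 3 * b) : ℝ) ≠ 0 := by
      intro h0
      rw [h0, mul_zero] at h1
      exact mul_ne_zero hS h2 h1.symm
    rw [div_eq_div_iff hS h3, h1]
    ring
  · refine (tendsto_const_nhds.div (tendsto_Ntilde_div_Nstar ha hpar h hmod) hS).congr fun n => ?_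
    simp only [Pi.div_apply]
    rw [div_div_eq_mul_div]
    exact mul_div_mul_left _ _ two_ne_zero
end

section
/- For every nonnegative integer n, 5 · N*(1,3; 8n+10) = 2 · N(1,3; 8n+10), i.e., the number of representations of 8n+10 as x² + 3y₁² + 3y₂² + 3y₃² with x, y₁, y₂, y₃ all odd equals 2/5 times the total number of representations of 8n+10 in this form with integer x, y₁, y₂, y₃. -/
theorem Set.ncard_eq_of_inverse_maps {α β : Type*} {s : Set α} {t : Set β} (f : α → β) (g : β → α)
    (hf : ∀ a ∈ s, f a ∈ t ∧ g (f a) = a) (hg : ∀ b ∈ t, g b ∈ s ∧ f (g b) = b) :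
    s.ncard = t.ncard :=
  Set.ncard_congr (fun a _ => f a) (fun a ha => (hf a ha).1)
    (fun a b ha hb h => by rw [← (hf a ha).2, ← (hf b hb).2, h])
    (fun b hb => ⟨g b, (hg b hb).1, (hg b hb).2⟩)

theorem ncard_pi_fin_one_prod_pi_fin_three (P : ℤ → ℤ → ℤ → ℤ → Prop) :
    Set.ncard {p : (Fin 1 → ℤ) × (Fin 3 → ℤ) | P (p.1 0) (p.2 0) (p.2 1) (p.2 2)} =
      Set.ncard {q : ℤ × ℤ × ℤ × ℤ | P q.1 q.2.1 q.2.2.1 q.2.2.2} := by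
  refine Set.ncard_eq_of_inverse_maps (fun p => (p.1 0, p.2 0, p.2 1, p.2 2))
    (fun q => (![q.1], ![q.2.1, q.2.2.1, q.2.2.2])) (fun p hp => ⟨hp, ?_⟩) (fun q hq => ⟨hq, rfl⟩)
  refine Prod.ext ?_ ?_ <;> ext i <;> fin_cases i <;> rfl

/-- The integer points `(x, y, z, w)` with `m = x² + 3(y² + z² + w²)`. -/
def representations (m : ℤ) : Set (ℤ × ℤ × ℤ × ℤ) :=
  {q | m = q.1 ^ 2 + 3 * (q.2.1 ^ 2 + q.2.2.1 ^ 2 + q.2.2.2 ^ 2)}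

/-- The representations of `m` with all coordinates odd. -/
def oddRepresentations (m : ℤ) : Set (ℤ × ℤ × ℤ × ℤ) :=
  {q | q ∈ representations m ∧
    q.1 % 2 = 1 ∧ q.2.1 % 2 = 1 ∧ q.2.2.1 % 2 = 1 ∧ q.2.2.2 % 2 = 1}

/-- The representations of `m` with `x` and `y` even, `z` and `w` odd. -/
def evenEvenRepresentations (m : ℤ) : Set (ℤ × ℤ × ℤ × ℤ) :=
  {q | q ∈ representations m ∧
    q.1 % 2 = 0 ∧ q.2.1 % 2 = 0 ∧ q.2.2.1 % 2 = 1 ∧ q.2.2.2 % 2 = 1}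

theorem N_one_three (m : ℤ) : N 1 3 m = (representations m).ncard := by
  rw [representations, ← ncard_pi_fin_one_prod_pi_fin_three
    (fun x y z w => m = x ^ 2 + 3 * (y ^ 2 + z ^ 2 + w ^ 2))]
  simp [N, Fin.sum_univ_three]

theorem Nstar_one_three (m : ℤ) : Nstar 1 3 m = (oddRepresentations m).ncard := by
  simp only [oddRepresentations, representations, Set.mem_ofPred_eq]
  rw [← ncard_pi_fin_one_prod_pi_fin_three
    (fun x y z w => m = x ^ 2 + 3 * (y ^ 2 + z ^ 2 + w ^ 2) ∧
      x % 2 = 1 ∧ y % 2 = 1 ∧ z % 2 = 1 ∧ w % 2 = 1), Nstar]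
  congr 1
  ext p
  simp only [Set.mem_ofPred_eq, Fin.forall_fin_succ, Fin.sum_univ_three, Int.odd_iff]
  simp
  tauto

theorem representations_finite (m : ℤ) : (representations m).Finite := by
  refine Set.Finite.subset
    ((Set.finite_Icc (-m) m).prod ((Set.finite_Icc (-m) m).prod
      ((Set.finite_Icc (-m) m).prod (Set.finite_Icc (-m) m)))) ?_
  rintro ⟨x, y, z, w⟩ h
  simp only [representations, Set.mem_ofPred_eq] at h
  have le_sq (t : ℤ) : t ≤ t ^ 2 ∧ -t ≤ t ^ 2 ∧ 0 ≤ t ^ 2 :=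
    ⟨Int.le_self_sq t, by simpa using Int.le_self_sq (-t), sq_nonneg t⟩
  have hx := le_sq x
  have hy := le_sq y
  have hz := le_sq z
  have hw := le_sq w
  simp only [Set.mem_prod, Set.mem_Icc]
  omega

theorem Int.sq_emod_eight_cases (t : ℤ) :
    t % 4 = 0 ∧ t ^ 2 % 8 = 0 ∨ t % 4 = 2 ∧ t ^ 2 % 8 = 4 ∨ t % 2 = 1 ∧ t ^ 2 % 8 = 1 := by
  have h : t % 8 = 0 ∨ t % 8 = 1 ∨ t % 8 = 2 ∨ t % 8 = 3 ∨ t % 8 = 4 ∨ t % 8 = 5 ∨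
    t % 8 = 6 ∨ t % 8 = 7 := by omega
  have hsq : t ^ 2 % 8 = (t % 8) ^ 2 % 8 := by rw [pow_two, pow_two, Int.mul_emod]
  rcases h with h | h | h | h | h | h | h | h <;> rw [h] at hsq <;> norm_num at hsq <;> omega

theorem ncard_oddRepresentations_sub_eq_add (m : ℤ) :
    {q ∈ oddRepresentations m | (q.1 - q.2.1) % 4 = 0}.ncard =
      {q ∈ oddRepresentations m | (q.1 + q.2.1) % 4 = 0}.ncard := by
  refine Set.ncard_eq_of_inverse_maps (fun q => (q.1, -q.2.1, q.2.2)) (fun q => (q.1, -q.2.1, q.2.2))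
    ?_ ?_ <;>
  · rintro ⟨x, y, z, w⟩ h
    simp only [oddRepresentations, representations, Set.mem_ofPred_eq, neg_sq, neg_neg, and_true] at h ⊢
    omega

/-- Multiplication of `x + y√-3` by a primitive cube root of unity makes two even coordinates
odd. -/
theorem ncard_evenEvenRepresentations_eq {m : ℤ} (hm : m % 8 = 2) :
    (evenEvenRepresentations m).ncard =
      {q ∈ oddRepresentations m | (q.1 + q.2.1) % 4 = 0}.ncard := by
  refine Set.ncard_eq_of_inverse_maps
    (fun q => ((-q.1 - 3 * q.2.1) / 2, (q.1 - q.2.1) / 2, q.2.2))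
    (fun q => ((-q.1 + 3 * q.2.1) / 2, (-q.1 - q.2.1) / 2, q.2.2)) ?_ ?_
  · rintro ⟨x, y, z, w⟩ h
    simp only [evenEvenRepresentations, oddRepresentations, representations,
      Set.mem_ofPred_eq, Prod.mk.injEq, and_true] at h ⊢
    have hx := Int.sq_emod_eight_cases x
    have hy := Int.sq_emod_eight_cases y
    have hz := Int.sq_emod_eight_cases z
    have hw := Int.sq_emod_eight_cases w
    obtain ⟨u, hu⟩ : ∃ u, u = (-x - 3 * y) / 2 := ⟨_, rfl⟩
    obtain ⟨v, hv⟩ : ∃ v, v = (x - y) / 2 := ⟨_, rfl⟩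
    have hu2 : 2 * u = -x - 3 * y := by omega
    have hv2 : 2 * v = x - y := by omega
    have hsq : u ^ 2 + 3 * v ^ 2 = x ^ 2 + 3 * y ^ 2 := by
      refine mul_left_cancel₀ (four_ne_zero (α := ℤ)) ?_
      linear_combination (2 * u - x - 3 * y) * hu2 + 3 * (2 * v + x - y) * hv2
    rw [← hu, ← hv]
    omega
  · rintro ⟨x, y, z, w⟩ h
    simp only [evenEvenRepresentations, oddRepresentations, representations,
      Set.mem_ofPred_eq, Prod.mk.injEq, and_true] at h ⊢
    obtain ⟨u, hu⟩ : ∃ u, u = (-x + 3 * y) / 2 := ⟨_, rfl⟩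
    obtain ⟨v, hv⟩ : ∃ v, v = (-x - y) / 2 := ⟨_, rfl⟩
    have hu2 : 2 * u = -x + 3 * y := by omega
    have hv2 : 2 * v = -x - y := by omega
    have hsq : u ^ 2 + 3 * v ^ 2 = x ^ 2 + 3 * y ^ 2 := by
      refine mul_left_cancel₀ (four_ne_zero (α := ℤ)) ?_
      linear_combination (2 * u - x + 3 * y) * hu2 + 3 * (2 * v - x - y) * hv2
    rw [← hu, ← hv]
    omega

theorem ncard_oddRepresentations {m : ℤ} (hm : m % 8 = 2) :
    (oddRepresentations m).ncard = 2 * (evenEvenRepresentations m).ncard := by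
  have hfin : (oddRepresentations m).Finite := (representations_finite m).subset fun _ h => h.1
  have hunion : oddRepresentations m =
      {q ∈ oddRepresentations m | (q.1 - q.2.1) % 4 = 0} ∪
        {q ∈ oddRepresentations m | (q.1 + q.2.1) % 4 = 0} := by
    ext ⟨x, y, z, w⟩
    simp only [oddRepresentations, Set.mem_ofPred_eq, Set.mem_union]
    by_cases hp : (x, y, z, w) ∈ representations m <;>
      (simp only [hp, true_and, false_and, or_self]; try omega)
  have hdisj : Disjoint {q ∈ oddRepresentations m | (q.1 - q.2.1) % 4 = 0}
      {q ∈ oddRepresentations m | (q.1 + q.2.1) % 4 = 0} := by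
    rw [Set.disjoint_left]
    rintro ⟨x, y, z, w⟩ h h'
    simp only [oddRepresentations, Set.mem_ofPred_eq] at h h'
    omega
  rw [hunion, Set.ncard_union_eq hdisj (hfin.subset (Set.sep_subset _ _))
    (hfin.subset (Set.sep_subset _ _)), ncard_oddRepresentations_sub_eq_add,
    ncard_evenEvenRepresentations_eq hm, two_mul]

theorem ncard_representations {m : ℤ} (hm : m % 8 = 2) :
    (representations m).ncard =
      (oddRepresentations m).ncard + 3 * (evenEvenRepresentations m).ncard := by
  set s₁ := {q ∈ representations m |
    q.1 % 2 = 0 ∧ q.2.1 % 2 = 1 ∧ q.2.2.1 % 2 = 0 ∧ q.2.2.2 % 2 = 1} with hs₁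
  set s₂ := {q ∈ representations m |
    q.1 % 2 = 0 ∧ q.2.1 % 2 = 1 ∧ q.2.2.1 % 2 = 1 ∧ q.2.2.2 % 2 = 0} with hs₂
  have card_s₁ : s₁.ncard = (evenEvenRepresentations m).ncard := by
    refine Set.ncard_eq_of_inverse_maps (fun q => (q.1, q.2.2.1, q.2.1, q.2.2.2))
      (fun q => (q.1, q.2.2.1, q.2.1, q.2.2.2)) ?_ ?_ <;>
    · rintro ⟨x, y, z, w⟩ h
      simp only [s₁, evenEvenRepresentations, representations, Set.mem_ofPred_eq, and_true] at h ⊢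
      omega
  have card_s₂ : s₂.ncard = (evenEvenRepresentations m).ncard := by
    refine Set.ncard_eq_of_inverse_maps (fun q => (q.1, q.2.2.2, q.2.2.1, q.2.1))
      (fun q => (q.1, q.2.2.2, q.2.2.1, q.2.1)) ?_ ?_ <;>
    · rintro ⟨x, y, z, w⟩ h
      simp only [s₂, evenEvenRepresentations, representations, Set.mem_ofPred_eq, and_true] at h ⊢
      omega
  have hfin := representations_finite m
  have hO : (oddRepresentations m).Finite := hfin.subset fun _ h => h.1
  have hE : (evenEvenRepresentations m).Finite := hfin.subset fun _ h => h.1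
  have h₁ : s₁.Finite := hfin.subset fun _ h => h.1
  have h₂ : s₂.Finite := hfin.subset fun _ h => h.1
  have hunion : representations m =
      oddRepresentations m ∪ (evenEvenRepresentations m ∪ (s₁ ∪ s₂)) := by
    ext ⟨x, y, z, w⟩
    simp only [s₁, s₂, oddRepresentations, evenEvenRepresentations, representations,
      Set.mem_ofPred_eq, Set.mem_union]
    have sq_emod_four (t : ℤ) : t ^ 2 % 4 = t % 2 := by
      have := Int.sq_emod_eight_cases t
      omega
    have hx := sq_emod_four x
    have hy := sq_emod_four y
    have hz := sq_emod_four z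
    have hw := sq_emod_four w
    refine ⟨fun h => ?_, by tauto⟩
    simp only [eq_true h, true_and]
    rcases Int.emod_two_eq x with hx' | hx' <;> rcases Int.emod_two_eq y with hy' | hy' <;>
      rcases Int.emod_two_eq z with hz' | hz' <;> rcases Int.emod_two_eq w with hw' | hw' <;>
      simp only [hx', hy', hz', hw'] at hx hy hz hw ⊢ <;> first | omega | simp
  have d₁ : Disjoint s₁ s₂ := by
    rw [Set.disjoint_left]
    intro q h h'
    have := h.2
    have := h'.2
    omega
  have d₂ : Disjoint (evenEvenRepresentations m) (s₁ ∪ s₂) := by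
    rw [Set.disjoint_left]
    rintro q h (h' | h') <;>
    · have := h.2
      have := h'.2
      omega
  have d₃ : Disjoint (oddRepresentations m) (evenEvenRepresentations m ∪ (s₁ ∪ s₂)) := by
    rw [Set.disjoint_left]
    rintro q h (h' | h' | h') <;>
    · have := h.2
      have := h'.2
      omega
  rw [hunion, Set.ncard_union_eq d₃ hO (hE.union (h₁.union h₂)),
    Set.ncard_union_eq d₂ hE (h₁.union h₂), Set.ncard_union_eq d₁ h₁ h₂, card_s₁, card_s₂]
  ring

theorem stmt_5 (n : ℕ) :
    5 * Nstar 1 3 (8 * (n : ℤ) + 10) = 2 * N 1 3 (8 * (n : ℤ) + 10) := by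
  have hm : (8 * (n : ℤ) + 10) % 8 = 2 := by omega
  rw [Nstar_one_three, N_one_three, ncard_representations hm, ncard_oddRepresentations hm]
  ring
end
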